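/- For fixed q, as g → ∞ one has Σ_{u ∈ I_{g+1}} h_u = 2·P(2)·q^{3g+1} + O(g·q^{5g/2}) and Σ_{u ∈ F'_{g+1}} h_u = 2·ζ_A(2)^{−1}·ζ_A(3)·P(2)·q^{3g+2} + O(g·q^{5g/2}). -/

import Mathlib

open Polynomial

noncomputable section

namespace EvenChar

variable {Fq : Type} [Field Fq] [Fintype Fq]

variable (Fq) in
/-- The family `F_n` of real quadratic `u`'s. -/
def Ffam (n : ℕ) : Set (RatFunc Fq) :=
  { u | ∃ (S : Finset (Polynomial Fq)) (e : Polynomial Fq → ℕ)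
        (a : Polynomial Fq → ℕ → Polynomial Fq),
      (∀ P ∈ S, P.Monic ∧ Irreducible P) ∧
      (∀ P ∈ S, 1 ≤ e P) ∧
      (∀ P ∈ S, ∀ i, 1 ≤ i → i ≤ e P → (a P i).degree < P.degree) ∧
      (∀ P ∈ S, a P (e P) ≠ 0) ∧
      (∑ P ∈ S, e P * P.natDegree) = n ∧
      u = ∑ P ∈ S, ∑ i ∈ Finset.Icc 1 (e P),
            algebraMap (Polynomial Fq) (RatFunc Fq) (a P i) /
              algebraMap (Polynomial Fq) (RatFunc Fq) P ^ (2 * i - 1) }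

/-- The family `G_s` of odd polynomial parts. -/
def Gfam (ξ : Fq) (s : ℕ) : Set (Polynomial Fq) :=
  { G | ∃ (α : Fq) (c : ℕ → Fq), (α = 0 ∨ α = ξ) ∧ c s ≠ 0 ∧
      G = Polynomial.C α + ∑ i ∈ Finset.Icc 1 s, Polynomial.C (c i) * Polynomial.X ^ (2 * i - 1) }

/-- The family `I_{(r,s)}`. -/
def Irs (ξ : Fq) (r s : ℕ) : Set (RatFunc Fq) :=
  { u | ∃ v ∈ Ffam Fq r, ∃ G ∈ Gfam ξ s,
      u = v + algebraMap (Polynomial Fq) (RatFunc Fq) G }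

/-- The family `I_n` of ramified imaginary `u`'s. -/
def Ifam (ξ : Fq) (n : ℕ) : Set (RatFunc Fq) :=
  ⋃ (r : ℕ) (s : ℕ) (_ : 1 ≤ s) (_ : r + s = n), Irs ξ r s

/-- The family `F'_n` of inert imaginary `u`'s. -/
def F'fam (ξ : Fq) (n : ℕ) : Set (RatFunc Fq) :=
  (fun u => u + RatFunc.C ξ) '' Ffam Fq n

/-- `ζ_A(s) = (1 - q^{1-s})⁻¹`, real version. -/
def zetaR (q : ℕ) (s : ℝ) : ℝ := (1 - (q : ℝ) ^ ((1 : ℝ) - s))⁻¹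

variable (Fq) in
/-- The Euler product `P(s) = ∏_P (1 - 1/(|P|^s (|P|+1)))`, real version. -/
def eulerPR (s : ℝ) : ℝ :=
  ∏' P : {P : Polynomial Fq // P.Monic ∧ Irreducible P},
    (1 - (((Fintype.card Fq : ℝ) ^ (P.1.natDegree : ℝ)) ^ s *
          ((Fintype.card Fq : ℝ) ^ (P.1.natDegree : ℝ) + 1))⁻¹)

open Polynomial in
open scoped Classical in
/-- The ideal class number `h_u` of the integral closure `O_u` of `Fq[T]` in
`K_u = k(x_u)`, where `x_u² + x_u = u`. -/
def hClass (u : RatFunc Fq) : ℕ :=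
  if hirr : Irreducible (X ^ 2 + X + C u : Polynomial (RatFunc Fq)) then
    letI : IsDomain (AdjoinRoot (X ^ 2 + X + C u : Polynomial (RatFunc Fq))) :=
      AdjoinRoot.isDomain_of_prime hirr.prime
    letI : IsDomain (integralClosure (Polynomial Fq)
        (AdjoinRoot (X ^ 2 + X + C u : Polynomial (RatFunc Fq)))) := Subalgebra.isDomain _
    Nat.card (ClassGroup (integralClosure (Polynomial Fq)
      (AdjoinRoot (X ^ 2 + X + C u : Polynomial (RatFunc Fq)))))
  else 0

end EvenChar

set_option linter.unusedSectionVars false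
namespace EvenChar
section Helpers1
open scoped Classical
variable {Fq : Type} [Field Fq] [Fintype Fq]

/-- polynomials of degree `< n`. -/
lemma finite_degLT (n : ℕ) : ({p : Fq[X] | p.degree < n}).Finite := by
  have : Finite (degreeLT Fq n) := Finite.of_equiv _ (degreeLTEquiv Fq n).toEquiv.symm
  have h : ({p : Fq[X] | p.degree < n}) = (degreeLT Fq n : Set Fq[X]) := by
    ext p; simp [mem_degreeLT]
  rw [h]; exact Set.toFinite _

variable (Fq) in
def PLT (n : ℕ) : Finset Fq[X] := (finite_degLT (Fq := Fq) n).toFinset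

@[simp] lemma mem_PLT {n : ℕ} {p : Fq[X]} : p ∈ PLT Fq n ↔ p.degree < n := by
  simp [PLT]

lemma card_PLT (n : ℕ) : (PLT Fq n).card = Fintype.card Fq ^ n := by
  have h1 : Nat.card (degreeLT Fq n) = Fintype.card Fq ^ n := by
    rw [Nat.card_congr (degreeLTEquiv Fq n).toEquiv]; simp
  rw [← h1, ← Nat.card_eq_finsetCard]
  exact Nat.card_congr (Equiv.subtypeEquivRight fun p => by simp [mem_degreeLT])

/-- polynomials of formal degree `n` with `n`-th coefficient in `L`. -/
def LD (L : Finset Fq) (n : ℕ) : Finset Fq[X] :=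
  (PLT Fq (n + 1)).filter (fun p => p.coeff n ∈ L)

lemma mem_LD {L : Finset Fq} {n : ℕ} {p : Fq[X]} :
    p ∈ LD L n ↔ p.degree < (n + 1 : ℕ) ∧ p.coeff n ∈ L := by
  simp [LD]

lemma mem_LD_iff {L : Finset Fq} (h0 : (0 : Fq) ∉ L) {n : ℕ} {p : Fq[X]} :
    p ∈ LD L n ↔ p.natDegree = n ∧ p.leadingCoeff ∈ L := by
  rw [mem_LD]
  constructor
  · rintro ⟨h1, h2⟩
    have hn : p.natDegree = n := by
      apply le_antisymm
      · by_cases hp : p = 0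
        · simp [hp]
        · rw [degree_eq_natDegree hp] at h1
          have := Nat.cast_lt.mp h1; omega
      · apply le_natDegree_of_ne_zero
        intro h; rw [h] at h2; exact h0 h2
    refine ⟨hn, ?_⟩
    rw [leadingCoeff, hn]; exact h2
  · rintro ⟨rfl, h2⟩
    refine ⟨?_, h2⟩
    exact lt_of_le_of_lt degree_le_natDegree (by exact_mod_cast Nat.lt_succ_self _)

variable (Fq) in
/-- monic polynomials of degree `n`. -/
def Mon (n : ℕ) : Finset Fq[X] := LD {1} n

@[simp] lemma mem_Mon {n : ℕ} {p : Fq[X]} : p ∈ Mon Fq n ↔ p.Monic ∧ p.natDegree = n := by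
  rw [Mon, mem_LD_iff (by simp)]; simp [Monic, and_comm]

/-- division with remainder as a bijection. -/
lemma sum_LD_div {M : Type*} [AddCommMonoid M] (L : Finset Fq) {n e : ℕ} {d : Fq[X]}
    (hd : d.Monic) (hde : d.natDegree = e) (hen : e ≤ n) (F : Fq[X] → M) :
    ∑ c ∈ LD L n, F c = ∑ k ∈ LD L (n - e), ∑ r ∈ PLT Fq e, F (d * k + r) := by
  have hdd : d.degree = e := by rw [degree_eq_natDegree hd.ne_zero, hde]
  rw [← Finset.sum_product']
  symm
  refine Finset.sum_bij' (fun x _ => d * x.1 + x.2) (fun c _ => (c /ₘ d, c %ₘ d)) ?_ ?_ ?_ ?_ ?_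
  · rintro ⟨k, r⟩ h
    simp only [Finset.mem_product, mem_LD, mem_PLT] at h
    obtain ⟨⟨h1, h2⟩, h3⟩ := h
    rw [mem_LD]
    have hr : r.degree < (n + 1 : ℕ) := lt_of_lt_of_le h3 (by exact_mod_cast (by omega))
    constructor
    · apply lt_of_le_of_lt (degree_add_le _ _)
      apply max_lt _ hr
      rw [degree_mul, hdd]
      by_cases hk : k = 0
      · simp [hk]
      · rw [degree_eq_natDegree hk] at h1 ⊢
        have := Nat.cast_lt.mp h1
        exact_mod_cast (by omega)
    · rw [coeff_add, coeff_eq_zero_of_degree_lt (lt_of_lt_of_le h3 (by exact_mod_cast hen)), add_zero]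
      have : (d * k).coeff n = k.coeff (n - e) := by
        have h4 : n = e + (n - e) := by omega
        conv_lhs => rw [h4]
        rw [coeff_mul_add_eq_of_natDegree_le (by omega)]
        · rw [← hde, hd.coeff_natDegree, one_mul]
        · by_cases hk : k = 0
          · simp [hk]
          · rw [degree_eq_natDegree hk] at h1
            have := Nat.cast_lt.mp h1
            omega
      rw [this]; exact h2
  · intro c h
    rw [mem_LD] at h
    simp only [Finset.mem_product, mem_LD, mem_PLT]
    have hr : (c %ₘ d).degree < e := by rw [← hdd]; exact degree_modByMonic_lt _ hd
    have hc := modByMonic_add_div c d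
    have h1 : (c /ₘ d).natDegree ≤ n - e := by
      rw [natDegree_divByMonic c hd, hde]
      by_cases hk : c = 0
      · simp [hk]
      · have h1 := h.1
        rw [degree_eq_natDegree hk] at h1
        have := Nat.cast_lt.mp h1
        omega
    refine ⟨⟨?_, ?_⟩, hr⟩
    · exact lt_of_le_of_lt degree_le_natDegree (by exact_mod_cast (by omega))
    · have h3 : c.coeff n = (c /ₘ d).coeff (n - e) := by
        conv_lhs => rw [← hc]
        rw [coeff_add, coeff_eq_zero_of_degree_lt (lt_of_lt_of_le hr (by exact_mod_cast hen)), zero_add]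
        have h4 : n = e + (n - e) := by omega
        conv_lhs => rw [h4]
        rw [coeff_mul_add_eq_of_natDegree_le (by omega) h1]
        rw [← hde, hd.coeff_natDegree, one_mul]
      rw [← h3]; exact h.2
  · rintro ⟨k, r⟩ h
    simp only [Finset.mem_product, mem_LD, mem_PLT] at h
    have := div_modByMonic_unique k r hd (f := d * k + r) ⟨by ring, by rw [hdd]; exact h.2⟩
    simp [this.1, this.2]
  · intro c h
    simp only
    rw [add_comm]; exact modByMonic_add_div c d
  · rintro ⟨k, r⟩ h
    rfl

/-- sum over multiples of `d`. -/
lemma sum_LD_dvd {M : Type*} [AddCommMonoid M] (L : Finset Fq) {n e : ℕ} {d : Fq[X]}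
    (hd : d.Monic) (hde : d.natDegree = e) (hen : e ≤ n) (F : Fq[X] → M) :
    ∑ c ∈ (LD L n).filter (fun c => d ∣ c), F c = ∑ k ∈ LD L (n - e), F (d * k) := by
  have hdd : d.degree = e := by rw [degree_eq_natDegree hd.ne_zero, hde]
  rw [Finset.sum_filter, sum_LD_div L hd hde hen]
  refine Finset.sum_congr rfl fun k _ => ?_
  rw [Finset.sum_eq_single 0]
  · simp
  · intro r hr hr0
    rw [if_neg]
    intro h
    have h1 : d ∣ r := (dvd_add_right (dvd_mul_right d k)).1 h
    have := degree_le_of_dvd h1 hr0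
    rw [mem_PLT] at hr
    rw [hdd] at this
    exact absurd hr (not_lt.2 this)
  · intro h; exact absurd (by simp) h

lemma card_LD (L : Finset Fq) (n : ℕ) : (LD L n).card = L.card * Fintype.card Fq ^ n := by
  have h := sum_LD_div L (n := n) (e := n) (d := X ^ n) (monic_X_pow n) (by simp) le_rfl (fun _ => 1)
  simp only [Finset.sum_const, smul_eq_mul, mul_one, Nat.sub_self, card_PLT] at h
  rw [h]; congr 1
  refine Finset.card_bij' (fun p _ => p.coeff 0) (fun a _ => C a) ?_ ?_ ?_ ?_
  · intro p hp; rw [mem_LD] at hp; exact hp.2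
  · intro a ha; rw [mem_LD]; refine ⟨lt_of_le_of_lt degree_C_le (by norm_num), by simpa using ha⟩
  · intro p hp; rw [mem_LD] at hp
    have : p.degree ≤ 0 := by
      have := hp.1
      exact Order.lt_succ_iff.1 this
    exact (eq_C_of_degree_le_zero this).symm
  · intro a _; simp

lemma card_Mon (n : ℕ) : (Mon Fq n).card = Fintype.card Fq ^ n := by
  rw [Mon, card_LD]; simp

end Helpers1
end EvenChar

set_option linter.unusedSectionVars false
namespace EvenChar
section Helpers1b
open scoped Classical
variable {Fq : Type} [Field Fq] [Fintype Fq]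

variable (Fq) in
abbrev Pr := {P : Fq[X] // P.Monic ∧ Irreducible P}

/-- prime factors -/
def pf (N : Fq[X]) : Finset (Pr Fq) :=
  ((PLT Fq (N.natDegree + 1)).filter (fun P => P ∣ N)).subtype (fun P => P.Monic ∧ Irreducible P)

lemma mem_pf {N : Fq[X]} (hN : N ≠ 0) {P : Pr Fq} : P ∈ pf N ↔ P.1 ∣ N := by
  simp only [pf, Finset.mem_subtype, Finset.mem_filter, mem_PLT, and_iff_right_iff_imp]
  intro h
  refine lt_of_le_of_lt (degree_le_of_dvd h hN) ?_
  rw [degree_eq_natDegree hN]; exact_mod_cast Nat.lt_succ_self _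

def dl (S : Finset (Pr Fq)) : ℕ := ∑ P ∈ S, P.1.natDegree
def pr (S : Finset (Pr Fq)) : Fq[X] := ∏ P ∈ S, P.1

lemma pr_monic (S : Finset (Pr Fq)) : (pr S).Monic := monic_prod_of_monic _ _ fun P _ => P.2.1

lemma pr_natDegree (S : Finset (Pr Fq)) : (pr S).natDegree = dl S :=
  natDegree_prod_of_monic _ _ fun P _ => P.2.1

lemma Pr_coprime {P Q : Pr Fq} (h : P ≠ Q) : IsCoprime P.1 Q.1 := by
  rw [P.2.2.coprime_iff_not_dvd]
  intro hd
  apply h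
  have := (P.2.2.associated_of_dvd Q.2.2 hd)
  exact Subtype.ext (eq_of_monic_of_associated P.2.1 Q.2.1 this)

lemma Pr_pos (P : Pr Fq) : 0 < P.1.natDegree := P.2.2.natDegree_pos

lemma pr_dvd {S : Finset (Pr Fq)} {N : Fq[X]} : pr S ∣ N ↔ ∀ P ∈ S, P.1 ∣ N := by
  constructor
  · intro h P hP
    exact (Finset.dvd_prod_of_mem _ hP).trans h
  · intro h
    exact Finset.prod_dvd_of_coprime (fun P _ Q _ hPQ => Pr_coprime hPQ) h

lemma pr_sq_dvd {S : Finset (Pr Fq)} {N : Fq[X]} : pr S ^ 2 ∣ N ↔ ∀ P ∈ S, P.1 ^ 2 ∣ N := by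
  rw [pr, ← Finset.prod_pow]
  constructor
  · intro h P hP
    exact (Finset.dvd_prod_of_mem (fun P : Pr Fq => P.1 ^ 2) hP).trans h
  · intro h
    exact Finset.prod_dvd_of_coprime (fun P _ Q _ hPQ => (Pr_coprime hPQ).pow) h

lemma pr_dvd_iff_subset {S : Finset (Pr Fq)} {N : Fq[X]} (hN : N ≠ 0) : pr S ∣ N ↔ S ⊆ pf N := by
  rw [pr_dvd]
  exact ⟨fun h P hP => (mem_pf hN).2 (h P hP), fun h P hP => (mem_pf hN).1 (h hP)⟩

lemma pf_pr (S : Finset (Pr Fq)) : pf (pr S) = S := by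
  ext P
  rw [mem_pf (pr_monic S).ne_zero]
  constructor
  · intro h
    obtain ⟨Q, hQ, hPQ⟩ := (P.2.2.prime.dvd_finsetProd_iff _).1 h
    have := (P.2.2.associated_of_dvd Q.2.2 hPQ)
    have h2 : P = Q := Subtype.ext (eq_of_monic_of_associated P.2.1 Q.2.1 this)
    rwa [h2]
  · intro h; exact Finset.dvd_prod_of_mem _ h

lemma pr_inj : Function.Injective (pr (Fq := Fq)) := fun S T h => by
  rw [← pf_pr S, ← pf_pr T, h]

lemma pr_squarefree (S : Finset (Pr Fq)) : Squarefree (pr S) := by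
  rw [pr]
  apply Finset.squarefree_prod_of_pairwise_isCoprime
  · intro P _ Q _ h; exact (Pr_coprime h).isRelPrime
  · intro P _; exact P.2.2.squarefree

variable (Fq) in
/-- finsets of primes of total degree at most `r`. -/
def SS (r : ℕ) : Finset (Finset (Pr Fq)) :=
  (((PLT Fq (r + 1)).subtype (fun P => P.Monic ∧ Irreducible P)).powerset).filter (fun S => dl S ≤ r)

@[simp] lemma mem_SS {r : ℕ} {S : Finset (Pr Fq)} : S ∈ SS Fq r ↔ dl S ≤ r := by
  simp only [SS, Finset.mem_filter, Finset.mem_powerset, and_iff_right_iff_imp]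
  intro h P hP
  simp only [Finset.mem_subtype, mem_PLT]
  have : P.1.natDegree ≤ dl S := Finset.single_le_sum (f := fun P : Pr Fq => P.1.natDegree) (fun _ _ => Nat.zero_le _) hP
  exact lt_of_le_of_lt degree_le_natDegree (by exact_mod_cast (by omega))

lemma sum_pf {M : Type*} [AddCommMonoid M] (r : ℕ) (F : Finset (Pr Fq) → M) :
    ∑ N ∈ Mon Fq r, ∑ S ∈ (pf N).powerset, F S =
      ∑ S ∈ SS Fq r, (Fintype.card Fq ^ (r - dl S)) • F S := by
  rw [Finset.sum_comm' (t' := SS Fq r) (s' := fun S => (Mon Fq r).filter (fun N => pr S ∣ N))]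
  · refine Finset.sum_congr rfl fun S hS => ?_
    rw [Finset.sum_const]; congr 1
    have := sum_LD_dvd (M := ℕ) {1} (pr_monic S) (pr_natDegree S) (mem_SS.1 hS) (fun _ => 1)
    simp only [Finset.sum_const, smul_eq_mul, mul_one] at this
    rw [Mon, this, card_LD]; simp
  · intro N S
    simp only [mem_Mon, Finset.mem_powerset, Finset.mem_filter, mem_SS]
    constructor
    · rintro ⟨⟨h1, h2⟩, h3⟩
      have h4 := (pr_dvd_iff_subset h1.ne_zero).2 h3
      refine ⟨⟨⟨h1, h2⟩, h4⟩, ?_⟩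
      rw [← pr_natDegree, ← h2]; exact natDegree_le_of_dvd h4 h1.ne_zero
    · rintro ⟨⟨⟨h1, h2⟩, h4⟩, h3⟩
      exact ⟨⟨h1, h2⟩, (pr_dvd_iff_subset h1.ne_zero).1 h4⟩

lemma card_SS_eq (r k : ℕ) : ((SS Fq r).filter (fun S => dl S = k)).card ≤ Fintype.card Fq ^ k := by
  rw [← card_Mon]
  apply Finset.card_le_card_of_injOn pr
  · intro S hS
    simp only [Finset.coe_filter, mem_SS, Set.mem_ofPred_eq] at hS
    simp only [Finset.mem_coe, mem_Mon]
    exact ⟨pr_monic S, by rw [pr_natDegree]; exact hS.2⟩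
  · exact pr_inj.injOn

lemma two_le_q : 2 ≤ Fintype.card Fq := Fintype.one_lt_card

/-- geometric bound. -/
lemma sum_SS_tail (r D : ℕ) (x : ℝ) (hx : 0 ≤ x) (F : ℕ → ℝ) (hF : ∀ k, 0 ≤ F k)
    (hb : ∀ k, D ≤ k → (Fintype.card Fq : ℝ) ^ k * F k ≤ x * (1 / 2) ^ (k - D)) :
    ∑ S ∈ (SS Fq r).filter (fun S => D ≤ dl S), F (dl S) ≤ 2 * x := by
  have h1 : ∑ S ∈ (SS Fq r).filter (fun S => D ≤ dl S), F (dl S)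
      = ∑ k ∈ Finset.Icc D r, ∑ S ∈ ((SS Fq r).filter (fun S => D ≤ dl S)).filter (fun S => dl S = k), F (dl S) := by
    rw [Finset.sum_fiberwise_of_maps_to]
    intro S hS
    simp only [Finset.mem_filter, mem_SS] at hS
    simp [hS.1, hS.2]
  rw [h1]
  have h2 : ∀ k ∈ Finset.Icc D r, ∑ S ∈ ((SS Fq r).filter (fun S => D ≤ dl S)).filter (fun S => dl S = k), F (dl S)
      ≤ x * (1 / 2) ^ (k - D) := by
    intro k hk
    refine le_trans ?_ (hb k (Finset.mem_Icc.1 hk).1)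
    calc _ = ∑ S ∈ ((SS Fq r).filter (fun S => D ≤ dl S)).filter (fun S => dl S = k), F k := by
            refine Finset.sum_congr rfl fun S hS => ?_
            rw [(Finset.mem_filter.1 hS).2]
      _ = (((SS Fq r).filter (fun S => D ≤ dl S)).filter (fun S => dl S = k)).card * F k := by
            rw [Finset.sum_const, nsmul_eq_mul]
      _ ≤ _ := by
            apply mul_le_mul_of_nonneg_right _ (hF k)
            have := card_SS_eq (Fq := Fq) r k
            have h3 : (((SS Fq r).filter (fun S => D ≤ dl S)).filter (fun S => dl S = k)).card ≤
              ((SS Fq r).filter (fun S => dl S = k)).card :=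
              Finset.card_le_card (Finset.filter_subset_filter _ (Finset.filter_subset _ _))
            exact_mod_cast h3.trans this
  refine (Finset.sum_le_sum h2).trans ?_
  rw [← Finset.mul_sum, mul_comm]
  apply mul_le_mul_of_nonneg_right _ hx
  have h3 : ∑ k ∈ Finset.Icc D r, ((1 : ℝ) / 2) ^ (k - D) ≤ ∑ j ∈ Finset.range (r + 1), ((1 : ℝ) / 2) ^ j := by
    rw [← Finset.sum_image (s := Finset.Icc D r) (g := fun k => k - D) (f := fun j => ((1:ℝ)/2) ^ j)]
    · apply Finset.sum_le_sum_of_subset_of_nonneg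
      · intro j hj
        simp only [Finset.mem_image, Finset.mem_Icc] at hj
        obtain ⟨k, hk, rfl⟩ := hj
        simp; omega
      · intros; positivity
    · intro a ha b hb hab
      simp only [Finset.coe_Icc, Set.mem_Icc] at ha hb
      simp only at hab
      omega
  refine h3.trans ?_
  have := geom_sum_eq (x := (1:ℝ)/2) (by norm_num) (r+1)
  rw [this]
  have : (0:ℝ) ≤ (1/2)^(r+1) := by positivity
  have h5 : ((1:ℝ)/2 - 1) = -(1/2) := by norm_num
  rw [h5]
  rw [div_le_iff_of_neg (by norm_num)]
  linarith

end Helpers1b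
end EvenChar

set_option linter.unusedSectionVars false
namespace EvenChar
section Helpers2
open scoped Classical
variable {Fq : Type} [Field Fq] [Fintype Fq]

lemma exists_Pr {P : Fq[X]} (h : Irreducible P) : ∃ Q : Pr Fq, Associated P Q.1 := by
  have h0 : P.leadingCoeff ≠ 0 := leadingCoeff_ne_zero.2 h.ne_zero
  have hu : IsUnit (C P.leadingCoeff⁻¹) := isUnit_C.2 (IsUnit.mk0 _ (inv_ne_zero h0))
  have ha : Associated P (P * C P.leadingCoeff⁻¹) := associated_mul_isUnit_right_iff hu |>.2 (Associated.refl _)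
  exact ⟨⟨P * C P.leadingCoeff⁻¹, monic_mul_leadingCoeff_inv h.ne_zero, ha.irreducible h⟩, ha⟩

/-- `P` is a singular prime of `y² + N y + E`. -/
def bad (N E P : Fq[X]) : Prop := ∃ t, P ^ 2 ∣ E + t ^ 2 + N * t

def Smooth (N E : Fq[X]) : Prop := ∀ P : Pr Fq, P.1 ∣ N → ¬ bad N E P.1

def sqc (N a : Fq[X]) : Prop := ∀ P : Pr Fq, P.1 ∣ N → ¬ P.1 ^ 2 ∣ a

def rho (N E a : Fq[X]) : ℕ := ((PLT Fq a.natDegree).filter (fun b => a ∣ b ^ 2 + N * b + E)).card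

variable [CharP Fq 2]

lemma two0 : (2 : Fq[X]) = 0 := CharTwo.two_eq_zero

lemma exists_sqrt {d : Fq[X]} (hd : d.Monic) (hs : Squarefree d) (E : Fq[X]) :
    ∃ t : Fq[X], t.degree < (d.natDegree : ℕ) ∧ d ∣ E + t ^ 2 := by
  have hdd : d.degree = d.natDegree := degree_eq_natDegree hd.ne_zero
  have hfin : Finite (degreeLT Fq d.natDegree) := Finite.of_equiv _ (degreeLTEquiv Fq _).toEquiv.symm
  let f : degreeLT Fq d.natDegree → degreeLT Fq d.natDegree := fun t =>
    ⟨(t.1 ^ 2) %ₘ d, by rw [mem_degreeLT, ← hdd]; exact degree_modByMonic_lt _ hd⟩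
  have hinj : Function.Injective f := by
    intro t t' h
    have h1 : (t.1 ^ 2) %ₘ d = (t'.1 ^ 2) %ₘ d := congrArg Subtype.val h
    have h2 : d ∣ t.1 ^ 2 - t'.1 ^ 2 := by
      rw [← modByMonic_eq_zero_iff_dvd hd, sub_modByMonic, h1, sub_self]
    have h3 : t.1 ^ 2 - t'.1 ^ 2 = (t.1 - t'.1) ^ 2 := by
      linear_combination (t'.1 * t.1 - t'.1^2) * (two0 (Fq := Fq))
    rw [h3, hs.dvd_pow_iff_dvd (by norm_num)] at h2
    apply Subtype.ext
    by_contra hne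
    have h4 := degree_le_of_dvd h2 (sub_ne_zero.2 hne)
    have h5 := (degreeLT Fq d.natDegree).sub_mem t.2 t'.2
    rw [mem_degreeLT] at h5
    rw [hdd] at h4
    exact absurd h5 (not_lt.2 h4)
  have hsur := Finite.surjective_of_injective hinj
  obtain ⟨t, ht⟩ := hsur ⟨E %ₘ d, by rw [mem_degreeLT, ← hdd]; exact degree_modByMonic_lt _ hd⟩
  refine ⟨t.1, mem_degreeLT.1 t.2, ?_⟩
  have h1 : (t.1 ^ 2) %ₘ d = E %ₘ d := congrArg Subtype.val ht
  have h2 : d ∣ t.1 ^ 2 - E := by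
    rw [← modByMonic_eq_zero_iff_dvd hd, sub_modByMonic, h1, sub_self]
  have h3 : E + t.1 ^ 2 = t.1 ^ 2 - E := by linear_combination E * (two0 (Fq := Fq))
  rw [h3]; exact h2

/-- shifting `t` by a multiple of `d` does not change things mod `d²` if `d ∣ N`. -/
lemma shift_dvd {d N E t t' : Fq[X]} (hdN : d ∣ N) (h : d ∣ t + t') :
    d ^ 2 ∣ E + t ^ 2 + N * t ↔ d ^ 2 ∣ E + t' ^ 2 + N * t' := by
  obtain ⟨k, hk⟩ := h
  obtain ⟨l, rfl⟩ := hdN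
  have ht : t = t' + d * k := by linear_combination hk - t' * (two0 (Fq := Fq))
  have : E + t ^ 2 + d * l * t = (E + t' ^ 2 + d * l * t') + d ^ 2 * (k ^ 2 + l * k) := by
    rw [ht]; linear_combination (t' * d * k) * (two0 (Fq := Fq))
  rw [this]
  exact dvd_add_left (dvd_mul_right _ _)

lemma dvd_add_of_sq {d E t t' : Fq[X]} (hs : Squarefree d) (h : d ∣ E + t ^ 2) (h' : d ∣ E + t' ^ 2) :
    d ∣ t + t' := by
  have : (t + t') ^ 2 = (E + t ^ 2) + (E + t' ^ 2) := by
    linear_combination (t * t' - E) * (two0 (Fq := Fq))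
  rw [← hs.dvd_pow_iff_dvd (n := 2) (by norm_num), this]
  exact dvd_add h h'

lemma dvd_of_bad {d N E t : Fq[X]} (hdN : d ∣ N) (h : d ^ 2 ∣ E + t ^ 2 + N * t) : d ∣ E + t ^ 2 := by
  have h1 : d ∣ E + t ^ 2 + N * t := (dvd_pow_self d (by norm_num)).trans h
  exact (dvd_add_left (hdN.mul_right t)).1 h1

lemma bad_iff {S : Finset (Pr Fq)} {N E : Fq[X]} (hN : pr S ∣ N) :
    (∀ P ∈ S, bad N E P.1) ↔ ∃ t : Fq[X], t.degree < (dl S : ℕ) ∧ (pr S) ^ 2 ∣ E + t ^ 2 + N * t := by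
  constructor
  · intro h
    obtain ⟨t, ht, hd⟩ := exists_sqrt (pr_monic S) (pr_squarefree S) E
    rw [pr_natDegree] at ht
    refine ⟨t, ht, ?_⟩
    rw [pr_sq_dvd]
    intro P hP
    obtain ⟨t', ht'⟩ := h P hP
    have hPN : P.1 ∣ N := pr_dvd.1 hN P hP
    rw [shift_dvd (t' := t') hPN]
    · exact ht'
    · exact dvd_add_of_sq P.2.2.squarefree (pr_dvd.1 hd P hP) (dvd_of_bad hPN ht')
  · rintro ⟨t, _, h⟩ P hP
    exact ⟨t, pr_sq_dvd.1 h P hP⟩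

/-- existence of `c` -/
lemma exists_c {S : Finset (Pr Fq)} {N a : Fq[X]} (hN : pr S ∣ N) (ha : ∀ P ∈ S, ¬ P.1 ^ 2 ∣ a) (z : Fq[X]) :
    ∃ c t : Fq[X], t.degree < (dl S : ℕ) ∧ (pr S) ^ 2 ∣ a * c + t ^ 2 + N * t + z := by
  set d := pr S with hd
  obtain ⟨t, ht, hdv⟩ := exists_sqrt (pr_monic S) (pr_squarefree S) z
  rw [pr_natDegree] at ht
  have hdv' : d ∣ z + t ^ 2 + N * t := dvd_add hdv (hN.mul_right t)
  obtain ⟨w, hw⟩ := hdv'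
  have hd0 : d ≠ 0 := (pr_monic S).ne_zero
  set e := EuclideanDomain.gcd a (d ^ 2) with he
  have he0 : e ≠ 0 := by
    intro h
    have := EuclideanDomain.gcd_eq_zero_iff.1 h
    exact hd0 (pow_eq_zero_iff (by norm_num) |>.1 this.2)
  have hed : e ∣ d := by
    have hsq : Squarefree e := by
      rw [squarefree_iff_irreducible_sq_not_dvd_of_ne_zero he0]
      intro x hx hxe
      obtain ⟨P, hP⟩ := exists_Pr hx
      have hPe : P.1 * P.1 ∣ e := (mul_dvd_mul hP.symm.dvd hP.symm.dvd).trans hxe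
      have h1 : P.1 ^ 2 ∣ a := by rw [sq]; exact hPe.trans (EuclideanDomain.gcd_dvd_left _ _)
      have h2 : P.1 ∣ d := by
        have : P.1 ∣ d ^ 2 := (dvd_mul_right _ _).trans (hPe.trans (EuclideanDomain.gcd_dvd_right _ _))
        exact P.2.2.prime.dvd_of_dvd_pow this
      have h3 : P ∈ S := by rw [← pf_pr S, mem_pf hd0]; exact h2
      exact ha P h3 h1
    rw [← hsq.dvd_pow_iff_dvd (n := 2) (by norm_num)]
    exact EuclideanDomain.gcd_dvd_right _ _
  obtain ⟨k, hk⟩ := hed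
  have hbez := EuclideanDomain.gcd_eq_gcd_ab a (d ^ 2)
  rw [← he] at hbez
  refine ⟨EuclideanDomain.gcdA a (d ^ 2) * k * w, t, ht, ?_⟩
  have : a * (EuclideanDomain.gcdA a (d ^ 2) * k * w) + t ^ 2 + N * t + z
      = d ^ 2 * (- EuclideanDomain.gcdB a (d ^ 2) * k * w) := by
    linear_combination hw - k * w * hbez - w * hk + (w * d) * (two0 (Fq := Fq))
  rw [this]; exact dvd_mul_right _ _

lemma card_bad_res {S : Finset (Pr Fq)} {N a : Fq[X]} (hN : pr S ∣ N) (ha : ∀ P ∈ S, ¬ P.1 ^ 2 ∣ a) :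
    ((PLT Fq (2 * dl S)).filter (fun c => ∀ P ∈ S, bad N (a * c) P.1)).card = Fintype.card Fq ^ (dl S) := by
  set d := pr S with hd
  set δ := dl S with hδ
  have hdm : (d ^ 2).Monic := (pr_monic S).pow 2
  have hd0 : d ≠ 0 := (pr_monic S).ne_zero
  have hdeg : (d ^ 2).degree = (2 * δ : ℕ) := by
    rw [degree_eq_natDegree hdm.ne_zero, natDegree_pow, hd, pr_natDegree]
  have hdeg1 : d.degree = (δ : ℕ) := by
    rw [degree_eq_natDegree hd0, hd, pr_natDegree]
  let V := degreeLT Fq (2 * δ)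
  let W := degreeLT Fq δ
  have hVf : Finite V := Finite.of_equiv _ (degreeLTEquiv Fq _).toEquiv.symm
  have hWf : Finite W := Finite.of_equiv _ (degreeLTEquiv Fq _).toEquiv.symm
  have hVc : Nat.card V = Fintype.card Fq ^ (2 * δ) := by
    rw [Nat.card_congr (degreeLTEquiv Fq _).toEquiv]; simp
  have hWc : Nat.card W = Fintype.card Fq ^ δ := by
    rw [Nat.card_congr (degreeLTEquiv Fq _).toEquiv]; simp
  have hmodadd : ∀ x y : Fq[X], (x + y) %ₘ (d ^ 2) = x %ₘ (d ^ 2) + y %ₘ (d ^ 2) := fun x y => add_modByMonic x y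
  let f : V × W →+ V := 
    { toFun := fun x => ⟨(a * x.1.1 + x.2.1 ^ 2 + N * x.2.1) %ₘ (d ^ 2), by
        rw [mem_degreeLT, ← hdeg]; exact degree_modByMonic_lt _ hdm⟩
      map_zero' := by apply Subtype.ext; simp
      map_add' := by
        intro x y
        apply Subtype.ext
        simp only [Prod.fst_add, Prod.snd_add, Submodule.coe_add]
        rw [← hmodadd]
        congr 1
        linear_combination (x.2.1 * y.2.1) * (two0 (Fq := Fq)) }
  have hfk : ∀ x : V × W, f x = 0 ↔ d ^ 2 ∣ a * x.1.1 + x.2.1 ^ 2 + N * x.2.1 := by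
    intro x
    rw [← modByMonic_eq_zero_iff_dvd hdm]
    exact ⟨fun h => congrArg Subtype.val h, fun h => Subtype.ext h⟩
  have hsurj : Function.Surjective f := by
    intro z
    obtain ⟨c, t, ht, h⟩ := exists_c hN ha z.1
    refine ⟨(⟨c %ₘ (d ^ 2), by rw [mem_degreeLT, ← hdeg]; exact degree_modByMonic_lt _ hdm⟩,
      ⟨t, mem_degreeLT.2 ht⟩), ?_⟩
    apply Subtype.ext
    change (a * (c %ₘ (d ^ 2)) + t ^ 2 + N * t) %ₘ (d ^ 2) = z.1
    have hz : z.1 %ₘ (d ^ 2) = z.1 := by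
      rw [modByMonic_eq_self_iff hdm, hdeg]; exact mem_degreeLT.1 z.2
    rw [← hz, ← sub_eq_zero, ← sub_modByMonic, modByMonic_eq_zero_iff_dvd hdm]
    have h1 : a * (c %ₘ (d ^ 2)) + t ^ 2 + N * t - z.1 =
       (a * c + t ^ 2 + N * t + z.1) - (d ^ 2) * (a * (c /ₘ d ^ 2)) := by
      linear_combination a * modByMonic_add_div c (d ^ 2) - z.1 * (two0 (Fq := Fq))
    rw [h1]
    exact dvd_sub h (dvd_mul_right _ _)
  have hcard : Nat.card f.ker * Nat.card V = Nat.card (V × W) := by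
    have h1 := AddSubgroup.card_eq_card_quotient_mul_card_addSubgroup f.ker
    rw [Nat.card_congr (QuotientAddGroup.quotientKerEquivOfSurjective f hsurj).toEquiv] at h1
    rw [h1, mul_comm]
  rw [Nat.card_prod, hVc, hWc, mul_comm] at hcard
  have hq : 0 < Fintype.card Fq ^ (2 * δ) := pow_pos (by have := two_le_q (Fq := Fq); omega) _
  have hker : Nat.card f.ker = Fintype.card Fq ^ δ := Nat.eq_of_mul_eq_mul_left hq hcard
  rw [← hker, ← Nat.card_eq_finsetCard]
  symm
  have hmemf : ∀ x : f.ker, d ^ 2 ∣ a * x.1.1.1 + x.1.2.1 ^ 2 + N * x.1.2.1 := fun x =>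
    (hfk x.1).1 x.2
  refine Nat.card_eq_of_bijective (fun x : f.ker => ⟨x.1.1.1, ?_⟩) ⟨?_, ?_⟩
  · rw [Finset.mem_filter, mem_PLT]
    refine ⟨mem_degreeLT.1 x.1.1.2, ?_⟩
    rw [bad_iff hN]
    exact ⟨x.1.2.1, mem_degreeLT.1 x.1.2.2, hmemf x⟩
  · intro x y hxy
    have h1 : x.1.1.1 = y.1.1.1 := by
      have h0 := Subtype.ext_iff.1 hxy
      exact h0
    have h2 := dvd_of_bad hN (hmemf x)
    have h3 := dvd_of_bad hN (hmemf y)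
    rw [← h1] at h3
    have h4 := dvd_add_of_sq (pr_squarefree S) h2 h3
    have h5 : x.1.2.1 = y.1.2.1 := by
      by_contra hne
      have h6 : x.1.2.1 + y.1.2.1 = x.1.2.1 - y.1.2.1 := by linear_combination y.1.2.1 * (two0 (Fq := Fq))
      rw [h6] at h4
      have h7 := degree_le_of_dvd h4 (sub_ne_zero.2 hne)
      have h8 := W.sub_mem x.1.2.2 y.1.2.2
      rw [mem_degreeLT, ← hdeg1] at h8
      exact absurd h8 (not_lt.2 h7)
    exact Subtype.ext (Prod.ext (Subtype.ext h1) (Subtype.ext h5))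
  · rintro ⟨c, hc⟩
    rw [Finset.mem_filter, mem_PLT, bad_iff hN] at hc
    obtain ⟨hc1, t, ht, h⟩ := hc
    exact ⟨⟨(⟨c, mem_degreeLT.2 hc1⟩, ⟨t, mem_degreeLT.2 ht⟩), (hfk _).2 h⟩, rfl⟩

lemma bad_mod {N E d k P : Fq[X]} (h : P ^ 2 ∣ d) : bad N (d * k + E) P ↔ bad N E P := by
  unfold bad
  refine exists_congr fun t => ?_
  have : d * k + E + t ^ 2 + N * t = d * k + (E + t ^ 2 + N * t) := by ring
  rw [this]
  exact dvd_add_right (h.mul_right k)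

lemma card_bad_LD (L : Finset Fq) {S : Finset (Pr Fq)} {N a : Fq[X]} {K : ℕ} (ham : a.Monic)
    (hN : pr S ∣ N) (ha : ∀ P ∈ S, ¬ P.1 ^ 2 ∣ a) (hK : a.natDegree + 2 * dl S ≤ K) :
    ((LD L K).filter (fun E => a ∣ E ∧ ∀ P ∈ S, bad N E P.1)).card =
      L.card * Fintype.card Fq ^ (K - a.natDegree - dl S) := by
  have h1 := sum_LD_dvd L (n := K) ham rfl (by omega) (fun E => if ∀ P ∈ S, bad N E P.1 then 1 else 0)
  rw [← Finset.filter_filter, Finset.card_filter, h1]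
  have hdm : (pr S ^ 2).Monic := (pr_monic S).pow 2
  rw [sum_LD_div L (n := K - a.natDegree) hdm (e := 2 * dl S) (by rw [natDegree_pow, pr_natDegree]) (by omega)]
  have h2 : ∀ k ∈ LD L (K - a.natDegree - 2 * dl S), (∑ r ∈ PLT Fq (2 * dl S),
      if ∀ P ∈ S, bad N (a * (pr S ^ 2 * k + r)) P.1 then 1 else 0) = Fintype.card Fq ^ (dl S) := by
    intro k _
    rw [← card_bad_res hN ha, Finset.card_filter]
    refine Finset.sum_congr rfl fun r _ => ?_
    congr 1
    apply propext
    refine forall₂_congr fun P hP => ?_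
    have : a * (pr S ^ 2 * k + r) = pr S ^ 2 * (a * k) + a * r := by ring
    rw [this]
    exact bad_mod (pr_sq_dvd.1 dvd_rfl P hP)
  rw [Finset.sum_congr rfl h2, Finset.sum_const, card_LD, smul_eq_mul, mul_assoc, ← pow_add]
  congr 2; omega

end Helpers2
end EvenChar

set_option linter.unusedSectionVars false
namespace EvenChar
section Helpers3
open scoped Classical
variable {Fq : Type} [Field Fq] [Fintype Fq] [CharP Fq 2]

/-- norm form -/
def nm (N E z w : Fq[X]) : Fq[X] := z ^ 2 + N * z * w + w ^ 2 * E

lemma nm_mul (N E z w z' w' : Fq[X]) : nm N E (z * z' + w * w' * E) (z * w' + z' * w + w * w' * N)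
    = nm N E z w * nm N E z' w' := by
  unfold nm
  linear_combination (z * z' * w * w' * E + z*z'*w*w'*E + w*w'*N*w*w'*N*E - w*w'*N*w*w'*N*E
    + N*z*w*w'^2*E + w ^ 2*N*w'*z'*E + w^2*w'^2*E*N^2) * (two0 (Fq := Fq))

/-- `R = A ⊕ A y` with `y² = N y + E`. -/
structure QR {R : Type*} [CommRing R] [Algebra Fq[X] R] (N E : Fq[X]) (y : R) (K : ℕ) : Prop where
  hy : y * y = algebraMap Fq[X] R N * y + algebraMap Fq[X] R E
  rep : ∀ r : R, ∃ z w : Fq[X], r = algebraMap Fq[X] R z + algebraMap Fq[X] R w * y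
  uniq : ∀ z w : Fq[X], algebraMap Fq[X] R z + algebraMap Fq[X] R w * y = 0 → z = 0 ∧ w = 0
  hK : 1 ≤ K
  nd : ∀ z w : Fq[X], w ≠ 0 → K + 2 * w.natDegree ≤ (nm N E z w).natDegree ∧
    2 * z.natDegree ≤ (nm N E z w).natDegree

variable {R : Type*} [CommRing R] [Algebra Fq[X] R] {N E : Fq[X]} {y : R} {K : ℕ}

local notation "φ" => algebraMap Fq[X] R

/-- the ideal `(a, b + y)` -/
def Iab (y : R) (a b : Fq[X]) : Ideal R := Ideal.span {algebraMap Fq[X] R a, algebraMap Fq[X] R b + y}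

lemma QR.inj2 (h : QR N E y K) {z w z' w' : Fq[X]} (he : φ z + φ w * y = φ z' + φ w' * y) :
    z = z' ∧ w = w' := by
  have := h.uniq (z - z') (w - w') (by rw [map_sub, map_sub]; linear_combination he)
  exact ⟨sub_eq_zero.1 this.1, sub_eq_zero.1 this.2⟩

lemma QR.inj1 (h : QR N E y K) {z z' : Fq[X]} (he : φ z = φ z') : z = z' :=
  (h.inj2 (w := 0) (w' := 0) (by simpa using he)).1

lemma QR.two (_h : QR N E y K) : (2 : R) = 0 := by
  have := congrArg (algebraMap Fq[X] R) (two0 (Fq := Fq))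
  rwa [map_ofNat, map_zero] at this

lemma QR.mulf (h : QR N E y K) (z w z' w' : Fq[X]) : (φ z + φ w * y) * (φ z' + φ w' * y) =
    φ (z * z' + w * w' * E) + φ (z * w' + z' * w + w * w' * N) * y := by
  simp only [map_add, map_mul]
  linear_combination (φ w * φ w') * h.hy

lemma QR.nm_ne (h : QR N E y K) {z w : Fq[X]} (hzw : z ≠ 0 ∨ w ≠ 0) : nm N E z w ≠ 0 := by
  by_cases hw : w = 0
  · subst hw
    have hz : z ≠ 0 := by tauto
    simp [nm, hz]
  · intro h0
    have := (h.nd z w hw).1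
    have := h.hK
    rw [h0, natDegree_zero] at *
    omega

lemma QR.conj (h : QR N E y K) (z w : Fq[X]) : (φ z + φ w * y) * (φ (z + w * N) + φ w * y) = φ (nm N E z w) := by
  rw [h.mulf]
  have h1 : z * w + (z + w * N) * w + w * w * N = 0 := by
    linear_combination (z * w + w * N * w) * (two0 (Fq := Fq))
  have h2 : z * (z + w * N) + w * w * E = nm N E z w := by unfold nm; ring
  rw [h1, h2]; simp

lemma QR.mem (h : QR N E y K) {a b : Fq[X]} (hab : a ∣ b ^ 2 + N * b + E) (z w : Fq[X]) :
    φ z + φ w * y ∈ Iab y a b ↔ a ∣ z + w * b := by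
  constructor
  · intro hm
    rw [Iab, Ideal.mem_span_pair] at hm
    obtain ⟨s, t, hst⟩ := hm
    obtain ⟨s1, s2, rfl⟩ := h.rep s
    obtain ⟨t1, t2, rfl⟩ := h.rep t
    have e1 := h.mulf s1 s2 a 0
    have e2 := h.mulf t1 t2 b 1
    simp only [map_zero, zero_mul, add_zero, map_one, one_mul] at e1 e2
    rw [e1, e2] at hst
    have := h.inj2 (z := s1 * a + s2 * 0 * E + (t1 * b + t2 * 1 * E))
      (w := s1 * 0 + a * s2 + s2 * 0 * N + (t1 * 1 + b * t2 + t2 * 1 * N)) (z' := z) (w' := w)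
      (by rw [← hst]; simp only [map_add, map_mul, map_one, map_zero]; ring)
    rw [← this.1, ← this.2]
    obtain ⟨k, hk⟩ := hab
    refine ⟨s1 + s2 * b + t2 * k, ?_⟩
    linear_combination t2 * hk + (t1 * b) * (two0 (Fq := Fq))
  · rintro ⟨k, hk⟩
    have : φ z + φ w * y = φ k * φ a + φ w * (φ b + y) := by
      have := congrArg (algebraMap Fq[X] R) hk
      simp only [map_add, map_mul] at this
      linear_combination this - (φ w * φ b) * h.two
    rw [this, Iab, Ideal.mem_span_pair]
    exact ⟨_, _, rfl⟩

lemma QR.mem0 (h : QR N E y K) {a b : Fq[X]} (hab : a ∣ b ^ 2 + N * b + E) (z : Fq[X]) :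
    φ z ∈ Iab y a b ↔ a ∣ z := by
  have := h.mem hab z 0
  simpa using this

lemma QR.mem1 (h : QR N E y K) {a b : Fq[X]} (hab : a ∣ b ^ 2 + N * b + E) (z : Fq[X]) :
    φ z + y ∈ Iab y a b ↔ a ∣ z + b := by
  have := h.mem hab z 1
  simpa using this

lemma QR.ext (h : QR N E y K) {a b a' b' : Fq[X]} (hab : a ∣ b ^ 2 + N * b + E)
    (hab' : a' ∣ b' ^ 2 + N * b' + E) (ha : a.Monic) (ha' : a'.Monic)
    (he : Iab y a b = Iab y a' b') : a = a' ∧ a ∣ b + b' := by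
  have h1 : a ∣ a' := by rw [← h.mem0 hab, he, h.mem0 hab']
  have h2 : a' ∣ a := by rw [← h.mem0 hab', ← he, h.mem0 hab]
  have h3 : a = a' := eq_of_monic_of_associated ha ha' (associated_of_dvd_dvd h1 h2)
  refine ⟨h3, ?_⟩
  have : φ b' + y ∈ Iab y a b := by
    rw [he, h.mem1 hab']
    exact ⟨0, by linear_combination b' * (two0 (Fq := Fq))⟩
  rw [h.mem1 hab] at this
  rwa [add_comm]

lemma QR.sol_shift {N E a b b' : Fq[X]} (hab : a ∣ b ^ 2 + N * b + E) (hd : a ∣ b + b') :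
    a ∣ b' ^ 2 + N * b' + E := by
  obtain ⟨k, hk⟩ := hd
  obtain ⟨l, hl⟩ := hab
  refine ⟨l + (b + b') * k + N * k, ?_⟩
  linear_combination hl + (b + b' + N) * hk - (b ^ 2 + N * b + b * b') * (two0 (Fq := Fq))

lemma Iab_congr (h : QR N E y K) {a b b' : Fq[X]} (hd : a ∣ b + b') : Iab y a b = Iab y a b' := by
  have key : ∀ b b' : Fq[X], a ∣ b + b' → Iab y a b ≤ Iab y a b' := by
    intro b b' ⟨k, hk⟩
    rw [Iab, Ideal.span_le]
    intro x hx
    simp only [Set.mem_insert_iff, Set.mem_singleton_iff] at hx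
    rcases hx with rfl | rfl
    · exact Ideal.subset_span (by simp)
    · rw [Iab, SetLike.mem_coe, Ideal.mem_span_pair]
      refine ⟨φ k, 1, ?_⟩
      have := congrArg (algebraMap Fq[X] R) hk
      simp only [map_add, map_mul] at this
      linear_combination φ b' * h.two - this
  exact le_antisymm (key _ _ hd) (key _ _ (by rwa [add_comm]))

lemma Iab_assoc {a a' b : Fq[X]} (hd : Associated a a') : Iab y a b = Iab y a' b := by
  have key : ∀ a a' : Fq[X], a' ∣ a → Iab y a b ≤ Iab y a' b := by
    intro a a' ⟨k, hk⟩
    rw [Iab, Ideal.span_le]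
    intro x hx
    simp only [Set.mem_insert_iff, Set.mem_singleton_iff] at hx
    rcases hx with rfl | rfl
    · rw [Iab, SetLike.mem_coe, Ideal.mem_span_pair]
      refine ⟨φ k, 0, ?_⟩
      rw [hk]; simp only [map_mul]; ring
    · exact Ideal.subset_span (by simp)
  exact le_antisymm (key _ _ hd.symm.dvd) (key _ _ hd.dvd)

lemma QR.red (h : QR N E y K) {a b a' : Fq[X]} (hab : b ^ 2 + N * b + E = a * a') :
    Ideal.span {φ (b + N) + y} * Iab y a b = Ideal.span {φ a} * Iab y a' (b + N) := by
  have h1 : (φ (b + N) + y) * (φ b + y) = φ a * φ a' := by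
    have := h.conj b 1
    rw [show nm N E b 1 = b ^ 2 + N * b + E by unfold nm; ring, hab] at this
    simp only [map_one, one_mul, map_mul] at this
    rw [← this]; ring
  rw [Iab, Iab, Ideal.span_mul_span', Ideal.span_mul_span', Set.singleton_mul, Set.singleton_mul,
    Set.image_pair, Set.image_pair, h1, mul_comm _ (φ a), Set.pair_comm]

/-- two ideals related by elements of `A` -/
lemma QR.eq_of_A [IsDomain R] (h : QR N E y K) {a1 b1 a2 b2 s t : Fq[X]} (h1 : a1 ∣ b1 ^ 2 + N * b1 + E)
    (h2 : a2 ∣ b2 ^ 2 + N * b2 + E) (hs : s ≠ 0)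
    (he : Ideal.span {φ s} * Iab y a1 b1 = Ideal.span {φ t} * Iab y a2 b2) :
    Associated s t ∧ Iab y a1 b1 = Iab y a2 b2 := by
  have key : ∀ s t a1 b1 a2 b2 : Fq[X], 
      Ideal.span {φ s} * Iab y a1 b1 = Ideal.span {φ t} * Iab y a2 b2 → t ∣ s := by
    intro s t a1 b1 a2 b2 he
    have hm : φ s * (φ b1 + y) ∈ Ideal.span {φ t} * Iab y a2 b2 := by
      rw [← he]
      exact Ideal.mul_mem_mul (Ideal.mem_span_singleton_self _) (Ideal.subset_span (by simp))
    rw [Ideal.mem_span_singleton_mul] at hm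
    obtain ⟨r, _, hr⟩ := hm
    obtain ⟨z, w, rfl⟩ := h.rep r
    have := h.inj2 (z := t * z) (w := t * w) (z' := s * b1) (w' := s)
      (by simp only [map_mul]; linear_combination hr)
    exact ⟨w, this.2.symm⟩
  have ha : Associated s t := associated_of_dvd_dvd (key _ _ _ _ _ _ he.symm) (key _ _ _ _ _ _ he)
  refine ⟨ha, ?_⟩
  have h3 : Ideal.span {φ s} = Ideal.span {φ t} := by
    rw [Ideal.span_singleton_eq_span_singleton]
    exact ha.map (algebraMap Fq[X] R)
  rw [← h3] at he
  have h4 : φ s ≠ 0 := by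
    intro h0
    exact hs (h.inj1 (by simpa using h0))
  exact (Ideal.span_singleton_mul_right_inj h4).1 he

lemma QR.phi_ne (h : QR N E y K) {s : Fq[X]} (hs : s ≠ 0) : φ s ≠ 0 := by
  intro h0
  exact hs (h.inj1 (by simpa using h0))

lemma QR.elt_ne (h : QR N E y K) {s w : Fq[X]} (hs : w ≠ 0) : φ s + φ w * y ≠ 0 := by
  intro h0
  exact hs (h.uniq _ _ h0).2

/-- equivalence of ideals: either equal or related by an element not in `A`. -/
lemma QR.inj [IsDomain R] (h : QR N E y K) {a1 b1 a2 b2 : Fq[X]} (h1 : a1 ∣ b1 ^ 2 + N * b1 + E)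
    (h2 : a2 ∣ b2 ^ 2 + N * b2 + E) (ha1 : a1 ≠ 0) (ha2 : a2 ≠ 0) {x z : R} (hx : x ≠ 0) (hz : z ≠ 0)
    (he : Ideal.span {x} * Iab y a1 b1 = Ideal.span {z} * Iab y a2 b2) :
    Iab y a1 b1 = Iab y a2 b2 ∨ ∃ s t s' t' : Fq[X], t ≠ 0 ∧ t' ≠ 0 ∧ a2 ∣ s + t * b2 ∧
      (nm N E s t).natDegree + (nm N E s' t').natDegree = 2 * (a1.natDegree + a2.natDegree) ∧
      Ideal.span {φ s + φ t * y} * Iab y a1 b1 = Ideal.span {φ a1} * Iab y a2 b2 := by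
  have hm : x * φ a1 ∈ Ideal.span {z} * Iab y a2 b2 := by
    rw [← he]
    exact Ideal.mul_mem_mul (Ideal.mem_span_singleton_self _) (Ideal.subset_span (by simp))
  have hm' : z * φ a2 ∈ Ideal.span {x} * Iab y a1 b1 := by
    rw [he]
    exact Ideal.mul_mem_mul (Ideal.mem_span_singleton_self _) (Ideal.subset_span (by simp))
  rw [Ideal.mem_span_singleton_mul] at hm hm'
  obtain ⟨γ, hγ, hγe⟩ := hm
  obtain ⟨γ', hγ', hγe'⟩ := hm'
  have hprod : γ * γ' = φ a1 * φ a2 := by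
    apply mul_left_cancel₀ (mul_ne_zero hx hz)
    linear_combination x * γ' * hγe + x * φ a1 * hγe'
  have hid : Ideal.span {γ} * Iab y a1 b1 = Ideal.span {φ a1} * Iab y a2 b2 := by
    rw [← Ideal.span_singleton_mul_right_inj hz, ← mul_assoc, ← mul_assoc,
      Ideal.span_singleton_mul_span_singleton, hγe, mul_comm (Ideal.span {z}), mul_assoc, ← he, ← mul_assoc,
      Ideal.span_singleton_mul_span_singleton, mul_comm x]
  obtain ⟨s, t, rfl⟩ := h.rep γ
  obtain ⟨s', t', rfl⟩ := h.rep γ'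
  have hpr := hprod
  rw [h.mulf] at hpr
  have hc := h.inj2 (z' := a1 * a2) (w' := 0) (by rw [hpr]; simp)
  have hnm : nm N E s t * nm N E s' t' = (a1 * a2) ^ 2 := by
    rw [← nm_mul, hc.1, hc.2]; simp [nm]
  by_cases ht : t = 0
  · left
    subst ht
    simp only [map_zero, zero_mul, add_zero] at hid
    refine (h.eq_of_A h1 h2 ?_ hid).2
    rintro rfl
    have := mul_ne_zero ha1 ha2
    simp at hc
    tauto
  · right
    refine ⟨s, t, s', t', ht, ?_, (h.mem h2 s t).1 hγ, ?_, hid⟩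
    · rintro rfl
      simp at hc
      have := mul_ne_zero ha1 ha2
      rcases hc.2 with h0 | h0
      · rw [h0, mul_zero] at hc; exact this hc.1.symm
      · exact ht h0
    · have h0 : nm N E s t * nm N E s' t' ≠ 0 := by
        rw [hnm]; exact pow_ne_zero _ (mul_ne_zero ha1 ha2)
      rw [← natDegree_mul (left_ne_zero_of_mul h0) (right_ne_zero_of_mul h0), hnm, natDegree_pow,
        natDegree_mul ha1 ha2]

end Helpers3
end EvenChar

set_option linter.unusedSectionVars false
set_option linter.unusedVariables false
set_option linter.overlappingInstances false
namespace EvenChar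
section Helpers3b
open scoped Classical
variable {Fq : Type} [Field Fq] [Fintype Fq] [CharP Fq 2]
variable {R : Type*} [CommRing R] [Algebra Fq[X] R] {N E : Fq[X]} {y : R} {K : ℕ}

local notation "φ" => algebraMap Fq[X] R

lemma QR.ideal_form [IsDomain R] (h : QR N E y K) (J : Ideal R) (hJ : J ≠ ⊥) :
    ∃ c a b : Fq[X], c ≠ 0 ∧ a ≠ 0 ∧ a ∣ b ^ 2 + N * b + E ∧ J = Ideal.span {φ c} * Iab y a b := by
  obtain ⟨j, hj, hj0⟩ := Submodule.exists_mem_ne_zero_of_ne_bot hJ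
  -- ideal J ∩ A
  set J0 : Ideal Fq[X] := J.comap (algebraMap Fq[X] R) with hJ0
  have mJ0 : ∀ z, z ∈ J0 ↔ φ z ∈ J := fun z => Iff.rfl
  let J1 : Ideal Fq[X] :=
    { carrier := {w | ∃ z, φ z + φ w * y ∈ J}
      zero_mem' := ⟨0, by simp⟩
      add_mem' := by
        rintro w w' ⟨z, hz⟩ ⟨z', hz'⟩
        refine ⟨z + z', ?_⟩
        have := J.add_mem hz hz'
        convert this using 1
        simp only [map_add]; ring
      smul_mem' := by
        rintro r w ⟨z, hz⟩
        refine ⟨r * z, ?_⟩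
        have := J.mul_mem_left (φ r) hz
        convert this using 1
        simp only [map_mul, smul_eq_mul]; ring }
  have mJ1 : ∀ w, w ∈ J1 ↔ ∃ z, φ z + φ w * y ∈ J := fun w => Iff.rfl
  obtain ⟨d, hd⟩ := IsPrincipalIdealRing.principal J0
  obtain ⟨c, hc⟩ := IsPrincipalIdealRing.principal J1
  have mJ0' : ∀ z, φ z ∈ J ↔ d ∣ z := by
    intro z; rw [← mJ0, hd]; exact Ideal.mem_span_singleton
  have mJ1' : ∀ w, (∃ z, φ z + φ w * y ∈ J) ↔ c ∣ w := by
    intro z; rw [← mJ1, hc]; exact Ideal.mem_span_singleton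
  have hd0 : d ≠ 0 := by
    obtain ⟨z, w, rfl⟩ := h.rep j
    have hn : nm N E z w ≠ 0 := by
      apply h.nm_ne
      by_contra hcon
      push Not at hcon
      apply hj0; rw [hcon.1, hcon.2]; simp
    have : φ (nm N E z w) ∈ J := by
      rw [← h.conj]; exact J.mul_mem_right _ hj
    rw [mJ0'] at this
    rintro rfl
    exact hn (zero_dvd_iff.1 this)
  have hcd : c ∣ d := by
    rw [← mJ1']
    refine ⟨0, ?_⟩
    have := J.mul_mem_right y ((mJ0' d).2 dvd_rfl)
    simpa using this
  have hc0 : c ≠ 0 := by rintro rfl; exact hd0 (zero_dvd_iff.1 hcd)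
  obtain ⟨a, rfl⟩ := hcd
  obtain ⟨z0, hz0⟩ := (mJ1' c).2 dvd_rfl
  have hcz : c ∣ z0 := by
    have h1 : c ∣ z0 + c * N := by
      rw [← mJ1']
      refine ⟨c * E, ?_⟩
      have := J.mul_mem_right y hz0
      convert this using 1
      simp only [map_add, map_mul]
      linear_combination -φ c * h.hy
    exact (dvd_add_left (dvd_mul_right c N)).1 h1
  obtain ⟨b, rfl⟩ := hcz
  have ha : a ∣ b ^ 2 + N * b + E := by
    have h1 : φ (c * (b ^ 2 + N * b + E)) ∈ J := by
      have := J.mul_mem_right (φ (b + N) + y) hz0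
      convert this using 1
      have h2 := h.conj b 1
      rw [show nm N E b 1 = b ^ 2 + N * b + E by unfold nm; ring] at h2
      rw [map_mul, ← h2]
      simp only [map_add, map_mul, map_one]
      ring
    rw [mJ0'] at h1
    exact (mul_dvd_mul_iff_left hc0).1 h1
  refine ⟨c, a, b, hc0, right_ne_zero_of_mul hd0, ha, ?_⟩
  have hspan : Ideal.span {φ c} * Iab y a b = Ideal.span {φ (c * a), φ c * (φ b + y)} := by
    rw [Iab, Ideal.span_mul_span', Set.singleton_mul, Set.image_pair, map_mul]
  rw [hspan]
  apply le_antisymm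
  · intro x hx
    obtain ⟨z, w, rfl⟩ := h.rep x
    obtain ⟨w1, rfl⟩ := (mJ1' w).1 ⟨z, hx⟩
    have h3 : φ (z - w1 * c * b) ∈ J := by
      have := J.sub_mem hx (J.mul_mem_left (φ w1) hz0)
      convert this using 1
      simp only [map_sub, map_mul]; ring
    rw [mJ0'] at h3
    obtain ⟨k, hk⟩ := h3
    rw [Ideal.mem_span_pair]
    refine ⟨φ k, φ w1, ?_⟩
    have := congrArg (algebraMap Fq[X] R) hk
    simp only [map_sub, map_mul] at this ⊢
    linear_combination -this
  · rw [Ideal.span_le]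
    intro x hx
    simp only [Set.mem_insert_iff, Set.mem_singleton_iff] at hx
    rcases hx with rfl | rfl
    · exact (mJ0' _).2 dvd_rfl
    · have e : φ c * (φ b + y) = φ (c * b) + φ c * y := by simp only [map_mul]; ring
      rw [SetLike.mem_coe, e]; exact hz0

lemma QR.normalize (h : QR N E y K) {a b : Fq[X]} (ha : a ≠ 0) (hab : a ∣ b ^ 2 + N * b + E) :
    ∃ a1 b1 : Fq[X], a1.Monic ∧ a1.natDegree = a.natDegree ∧ b1 ∈ PLT Fq a1.natDegree ∧
      a1 ∣ b1 ^ 2 + N * b1 + E ∧ Iab y a b = Iab y a1 b1 := by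
  have h0 : a.leadingCoeff ≠ 0 := leadingCoeff_ne_zero.2 ha
  have hu : IsUnit (C a.leadingCoeff⁻¹) := isUnit_C.2 (IsUnit.mk0 _ (inv_ne_zero h0))
  have haa : Associated a (a * C a.leadingCoeff⁻¹) := associated_mul_isUnit_right_iff hu |>.2 (Associated.refl _)
  have hm : (a * C a.leadingCoeff⁻¹).Monic := monic_mul_leadingCoeff_inv ha
  set a1 := a * C a.leadingCoeff⁻¹ with ha1
  have hdv : a1 ∣ b + b %ₘ a1 := by
    refine ⟨b /ₘ a1, ?_⟩
    linear_combination -(modByMonic_add_div b a1) + (b %ₘ a1) * (two0 (Fq := Fq))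
  refine ⟨a1, b %ₘ a1, hm, ?_, ?_, QR.sol_shift (haa.symm.dvd.trans hab) hdv, ?_⟩
  · exact natDegree_eq_of_degree_eq (degree_eq_degree_of_associated haa.symm)
  · rw [mem_PLT, ← degree_eq_natDegree hm.ne_zero]; exact degree_modByMonic_lt _ hm
  · rw [Iab_assoc haa, Iab_congr h hdv]

variable [IsDomain R] [IsDedekindDomain R]

/-- the class of `(a, b + y)` -/
def cl (y : R) (p : Fq[X] × Fq[X]) : ClassGroup R :=
  if h : Iab y p.1 p.2 ≠ ⊥ then ClassGroup.mk0 ⟨Iab y p.1 p.2, mem_nonZeroDivisors_iff_ne_zero.2 h⟩ else 1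

lemma QR.Iab_ne (h : QR N E y K) {a b : Fq[X]} (ha : a ≠ 0) : Iab y a b ≠ ⊥ := by
  intro h0
  have : φ a ∈ Iab y a b := Ideal.subset_span (by simp)
  rw [h0, Ideal.mem_bot] at this
  exact h.phi_ne ha this

lemma QR.cl_eq (h : QR N E y K) {p : Fq[X] × Fq[X]} (ha : p.1 ≠ 0) :
    cl y p = ClassGroup.mk0 ⟨Iab y p.1 p.2, mem_nonZeroDivisors_iff_ne_zero.2 (h.Iab_ne ha)⟩ := by
  rw [cl, dif_pos (h.Iab_ne ha)]

lemma QR.cl_iff (h : QR N E y K) {p p' : Fq[X] × Fq[X]} (ha : p.1 ≠ 0) (ha' : p'.1 ≠ 0) :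
    cl y p = cl y p' ↔ ∃ x z : R, x ≠ 0 ∧ z ≠ 0 ∧
      Ideal.span {x} * Iab y p.1 p.2 = Ideal.span {z} * Iab y p'.1 p'.2 := by
  rw [h.cl_eq ha, h.cl_eq ha', ClassGroup.mk0_eq_mk0_iff]
  constructor
  · rintro ⟨x, z, hx, hz, he⟩; exact ⟨x, z, hx, hz, he⟩
  · rintro ⟨x, z, hx, hz, he⟩; exact ⟨x, z, hx, hz, he⟩

lemma QR.reduce (h : QR N E y K) {M : ℕ} (hN : N.natDegree ≤ M) (hE : E.natDegree ≤ 2 * M + 1) (n : ℕ) :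
    ∀ a b : Fq[X], a ≠ 0 → a.natDegree = n → a ∣ b ^ 2 + N * b + E →
    ∃ a0 b0 : Fq[X], a0.Monic ∧ a0.natDegree ≤ M ∧ b0 ∈ PLT Fq a0.natDegree ∧
      a0 ∣ b0 ^ 2 + N * b0 + E ∧ cl y (a, b) = cl y (a0, b0) := by
  induction n using Nat.strong_induction_on with
  | _ n ih =>
  intro a b ha han hab
  obtain ⟨a1, b1, hm, hdeg, hb1, hab1, he⟩ := h.normalize ha hab
  have hcl : cl y (a, b) = cl y (a1, b1) := by
    unfold cl; simp only [he]
  by_cases hnM : n ≤ M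
  · exact ⟨a1, b1, hm, by omega, hb1, hab1, hcl⟩
  · obtain ⟨a2, ha2⟩ := hab1
    have hne : b1 ^ 2 + N * b1 + E ≠ 0 := by
      have := h.nm_ne (z := b1) (w := 1) (Or.inr one_ne_zero)
      rwa [show nm N E b1 1 = b1 ^ 2 + N * b1 + E by unfold nm; ring] at this
    have ha20 : a2 ≠ 0 := by rintro rfl; rw [mul_zero] at ha2; exact hne ha2
    have hb1d : b1.natDegree ≤ n - 1 := by
      rw [mem_PLT, hdeg, han] at hb1
      by_cases hb0 : b1 = 0
      · simp [hb0]
      · rw [degree_eq_natDegree hb0] at hb1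
        have : b1.natDegree < n := by exact_mod_cast hb1
        omega
    have hlt : a2.natDegree < n := by
      have h1 : (b1 ^ 2 + N * b1 + E).natDegree ≤ 2 * n - 1 := by
        refine (natDegree_add_le _ _).trans (max_le ((natDegree_add_le _ _).trans (max_le ?_ ?_)) ?_)
        · rw [natDegree_pow]; omega
        · refine natDegree_mul_le.trans ?_; omega
        · omega
      rw [ha2, natDegree_mul hm.ne_zero ha20] at h1
      omega
    have hab2 : a2 ∣ (b1 + N) ^ 2 + N * (b1 + N) + E := by
      refine ⟨a1, ?_⟩
      linear_combination ha2 + (b1 * N + N ^ 2) * (two0 (Fq := Fq))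
    obtain ⟨a0, b0, r1, r2, r3, r4, r5⟩ := ih _ hlt a2 (b1 + N) ha20 rfl hab2
    refine ⟨a0, b0, r1, r2, r3, r4, ?_⟩
    rw [hcl, ← r5, h.cl_iff (by exact hm.ne_zero) (by exact ha20)]
    refine ⟨_, _, ?_, h.phi_ne hm.ne_zero, h.red ha2⟩
    have := h.elt_ne (s := b1 + N) (w := 1) one_ne_zero
    simpa using this

/-- reduced pairs with `deg a = m` -/
def Red (N E : Fq[X]) (m : ℕ) : Finset (Fq[X] × Fq[X]) :=
  (Mon Fq m ×ˢ PLT Fq m).filter (fun p => p.1 ∣ p.2 ^ 2 + N * p.2 + E)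

lemma mem_Red {N E : Fq[X]} {m : ℕ} {p : Fq[X] × Fq[X]} : p ∈ Red N E m ↔
    p.1.Monic ∧ p.1.natDegree = m ∧ p.2 ∈ PLT Fq m ∧ p.1 ∣ p.2 ^ 2 + N * p.2 + E := by
  simp only [Red, Finset.mem_filter, Finset.mem_product, mem_Mon]; tauto

lemma card_Red (N E : Fq[X]) (m : ℕ) : (Red N E m).card = ∑ a ∈ Mon Fq m, rho N E a := by
  rw [Red, Finset.card_filter, Finset.sum_product]
  refine Finset.sum_congr rfl fun a ha => ?_
  rw [mem_Mon] at ha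
  rw [rho, Finset.card_filter, ha.2]

def RedLE (N E : Fq[X]) (m : ℕ) : Finset (Fq[X] × Fq[X]) := (Finset.range (m + 1)).biUnion (Red N E)

lemma mem_RedLE {N E : Fq[X]} {m : ℕ} {p : Fq[X] × Fq[X]} : p ∈ RedLE N E m ↔
    p.1.Monic ∧ p.1.natDegree ≤ m ∧ p.2 ∈ PLT Fq p.1.natDegree ∧ p.1 ∣ p.2 ^ 2 + N * p.2 + E := by
  simp only [RedLE, Finset.mem_biUnion, Finset.mem_range, mem_Red]
  constructor
  · rintro ⟨k, hk, h1, h2, h3, h4⟩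
    exact ⟨h1, by omega, by rwa [h2], h4⟩
  · rintro ⟨h1, h2, h3, h4⟩
    exact ⟨_, by omega, h1, rfl, h3, h4⟩

lemma card_RedLE (N E : Fq[X]) (m : ℕ) :
    (RedLE N E m).card = ∑ k ∈ Finset.range (m + 1), ∑ a ∈ Mon Fq k, rho N E a := by
  rw [RedLE, Finset.card_biUnion]
  · simp_rw [card_Red]
  · intro i _ j _ hij
    simp only [Function.onFun]
    rw [Finset.disjoint_left]
    intro p hp hp'
    rw [mem_Red] at hp hp'
    exact hij (hp.2.1.symm.trans hp'.2.1)

lemma QR.cl_surj (h : QR N E y K) {M : ℕ} (hN : N.natDegree ≤ M) (hE : E.natDegree ≤ 2 * M + 1)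
    (c : ClassGroup R) : ∃ p ∈ RedLE N E M, cl y p = c := by
  obtain ⟨⟨J, hJ⟩, rfl⟩ := ClassGroup.mk0_surjective c
  have hJ0 : J ≠ ⊥ := mem_nonZeroDivisors_iff_ne_zero.1 hJ
  obtain ⟨c, a, b, hc, ha, hab, he⟩ := h.ideal_form J hJ0
  obtain ⟨a0, b0, r1, r2, r3, r4, r5⟩ := h.reduce hN hE _ a b ha rfl hab
  refine ⟨(a0, b0), mem_RedLE.2 ⟨r1, r2, r3, r4⟩, ?_⟩
  rw [← r5, h.cl_eq (by exact ha), ClassGroup.mk0_eq_mk0_iff]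
  refine ⟨φ c, 1, h.phi_ne hc, one_ne_zero, ?_⟩
  simp [he]

lemma QR.red_ext (h : QR N E y K) {p p' : Fq[X] × Fq[X]} {M : ℕ} (hp : p ∈ RedLE N E M)
    (hp' : p' ∈ RedLE N E M) (he : Iab y p.1 p.2 = Iab y p'.1 p'.2) : p = p' := by
  rw [mem_RedLE] at hp hp'
  obtain ⟨h1, h2⟩ := h.ext hp.2.2.2 hp'.2.2.2 hp.1 hp'.1 he
  apply Prod.ext h1
  by_contra hne
  have h3 : p.2 + p'.2 = p.2 - p'.2 := by linear_combination p'.2 * (two0 (Fq := Fq))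
  rw [h3] at h2
  have h4 := degree_le_of_dvd h2 (sub_ne_zero.2 hne)
  have h5 : (p.2 - p'.2).degree < p.1.degree := by
    refine (degree_sub_le _ _).trans_lt (max_lt ?_ ?_)
    · rw [degree_eq_natDegree hp.1.ne_zero]; exact mem_PLT.1 hp.2.2.1
    · rw [h1, degree_eq_natDegree hp'.1.ne_zero]; exact mem_PLT.1 hp'.2.2.1
  exact absurd h5 (not_lt.2 h4)

lemma QR.cl_inj (h : QR N E y K) {p p' : Fq[X] × Fq[X]} {M : ℕ} (hp : p ∈ RedLE N E M)
    (hp' : p' ∈ RedLE N E M) (hd : p.1.natDegree + p'.1.natDegree < K) (he : cl y p = cl y p') : p = p' := by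
  have hq := mem_RedLE.1 hp
  have hq' := mem_RedLE.1 hp'
  rw [h.cl_iff hq.1.ne_zero hq'.1.ne_zero] at he
  obtain ⟨x, z, hx, hz, he⟩ := he
  rcases h.inj hq.2.2.2 hq'.2.2.2 hq.1.ne_zero hq'.1.ne_zero hx hz he with h1 | ⟨s, t, s', t', ht, ht', -, hs, -⟩
  · exact h.red_ext hp hp' h1
  · have := (h.nd s t ht).1
    have := (h.nd s' t' ht').1
    omega

theorem QR.card_R {g : ℕ} (h : QR N E y (2 * g + 1)) (hN : N.natDegree ≤ g) (hE : E.natDegree ≤ 2 * g + 1) :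
    Nat.card (ClassGroup R) = ∑ k ∈ Finset.range (g + 1), ∑ a ∈ Mon Fq k, rho N E a := by
  rw [← card_RedLE, ← Nat.card_eq_finsetCard]
  symm
  refine Nat.card_eq_of_bijective (fun p : RedLE N E g => cl y p.1) ⟨?_, ?_⟩
  · intro p p' he
    apply Subtype.ext
    have := (mem_RedLE.1 p.2).2.1
    have := (mem_RedLE.1 p'.2).2.1
    exact h.cl_inj p.2 p'.2 (by omega) he
  · intro c
    obtain ⟨p, hp, hc⟩ := h.cl_surj hN hE c
    exact ⟨⟨p, hp⟩, hc⟩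

end Helpers3b
end EvenChar

set_option linter.unusedSectionVars false
set_option linter.unusedVariables false
set_option linter.overlappingInstances false
namespace EvenChar
section Helpers3c
open scoped Classical
variable {Fq : Type} [Field Fq] [Fintype Fq] [CharP Fq 2]
variable {R : Type*} [CommRing R] [Algebra Fq[X] R] {N E : Fq[X]} {y : R} {K : ℕ}
variable [IsDomain R] [IsDedekindDomain R]

local notation "φ" => algebraMap Fq[X] R

/-- `(b + v a + y) (a', b + v a + N + y) = (a') (a, b + y)` -/
lemma QR.neigh (h : QR N E y K) {a b a' : Fq[X]} (v : Fq[X]) (ha : a ≠ 0)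
    (ha' : (b + v * a) ^ 2 + N * (b + v * a) + E = a * a') :
    Ideal.span {φ (b + v * a) + y} * Iab y a' (b + v * a + N) = Ideal.span {φ a'} * Iab y a b := by
  have h1 := h.red ha'
  have h2 : Iab y a (b + v * a) = Iab y a b := Iab_congr h ⟨v, by linear_combination b * (two0 (Fq := Fq))⟩
  rw [h2] at h1
  have h3 : (φ (b + v * a) + y) * (φ (b + v * a + N) + y) = φ a * φ a' := by
    have := h.conj (b + v * a) 1
    rw [show nm N E (b + v * a) 1 = (b + v * a) ^ 2 + N * (b + v * a) + E by unfold nm; ring, ha'] at this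
    simp only [map_one, one_mul] at this
    rw [← map_mul, ← this]
  rw [← Ideal.span_singleton_mul_right_inj (h.phi_ne ha), mul_left_comm, ← h1, ← mul_assoc, ← mul_assoc,
    Ideal.span_singleton_mul_span_singleton, Ideal.span_singleton_mul_span_singleton, h3]

/-- the neighbours -/
def nb (N E a b : Fq[X]) (v : Fq) : Fq[X] := ((b + C v * a) ^ 2 + N * (b + C v * a) + E) /ₘ a

lemma nb_spec {a b : Fq[X]} (ha : a.Monic) (hab : a ∣ b ^ 2 + N * b + E) (v : Fq) :
    (b + C v * a) ^ 2 + N * (b + C v * a) + E = a * nb N E a b v := by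
  have : a ∣ (b + C v * a) ^ 2 + N * (b + C v * a) + E :=
    QR.sol_shift hab ⟨C v, by linear_combination b * (two0 (Fq := Fq))⟩
  have h1 := modByMonic_add_div ((b + C v * a) ^ 2 + N * (b + C v * a) + E) a
  rw [(modByMonic_eq_zero_iff_dvd ha).2 this, zero_add] at h1
  exact h1.symm

lemma nb_natDegree {g : ℕ} (h : QR N E y (2 * g + 2)) (hN : N.natDegree ≤ g + 1) (hE : E.natDegree ≤ 2 * g + 2)
    {a b : Fq[X]} (ha : a.Monic) (hag : a.natDegree = g + 1) (hb : b.natDegree ≤ g) 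
    (hab : a ∣ b ^ 2 + N * b + E) (v : Fq) : (nb N E a b v).natDegree = g + 1 ∧ nb N E a b v ≠ 0 := by
  have h1 := nb_spec ha hab v
  have h2 := h.nd (b + C v * a) 1 one_ne_zero
  have h3 := h.nm_ne (z := b + C v * a) (w := 1) (Or.inr one_ne_zero)
  rw [show nm N E (b + C v * a) 1 = (b + C v * a) ^ 2 + N * (b + C v * a) + E by unfold nm; ring] at h2 h3
  have h4 : (b + C v * a).natDegree ≤ g + 1 := by
    refine (natDegree_add_le _ _).trans (max_le (by omega) ?_)
    exact (natDegree_C_mul_le _ _).trans hag.le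
  have h5 : ((b + C v * a) ^ 2 + N * (b + C v * a) + E).natDegree ≤ 2 * g + 2 := by
    refine (natDegree_add_le _ _).trans (max_le ((natDegree_add_le _ _).trans (max_le ?_ ?_)) ?_)
    · rw [natDegree_pow]; omega
    · refine natDegree_mul_le.trans ?_; omega
    · omega
  rw [h1] at h2 h3 h5
  have h6 := right_ne_zero_of_mul h3
  rw [natDegree_mul ha.ne_zero h6] at h2 h5
  exact ⟨by omega, h6⟩

/-- class equality in the top layer -/
lemma QR.top_iff {g : ℕ} (h : QR N E y (2 * g + 2)) (hN : N.natDegree ≤ g + 1) (hE : E.natDegree ≤ 2 * g + 2)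
    {a b a1 b1 : Fq[X]} (ha : a.Monic) (hag : a.natDegree = g + 1) (hb : b.natDegree ≤ g) 
    (hab : a ∣ b ^ 2 + N * b + E) (ha1 : a1.Monic) (hag1 : a1.natDegree = g + 1) 
    (hab1 : a1 ∣ b1 ^ 2 + N * b1 + E) (he : cl y (a1, b1) = cl y (a, b)) :
    Iab y a1 b1 = Iab y a b ∨ ∃ v : Fq, Iab y a1 b1 = Iab y (nb N E a b v) (b + C v * a + N) := by
  rw [h.cl_iff (by exact ha1.ne_zero) (by exact ha.ne_zero)] at he
  obtain ⟨x, z, hx, hz, he⟩ := he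
  rcases h.inj hab1 hab ha1.ne_zero ha.ne_zero hx hz he with h1 | ⟨s, t, s', t', ht, ht', hst, hs, hI⟩
  · exact Or.inl h1
  · right
    have n1 := h.nd s t ht
    have n2 := (h.nd s' t' ht').1
    have htd : t.natDegree = 0 := by omega
    have hsd : s.natDegree ≤ g + 1 := by omega
    obtain ⟨w, rfl⟩ := natDegree_eq_zero.1 htd
    have hw : w ≠ 0 := by rintro rfl; simp at ht
    obtain ⟨k, hk⟩ := hst
    have hkd : k.natDegree = 0 := by
      by_cases hk0 : k = 0
      · simp [hk0]
      have : (s + C w * b).natDegree ≤ g + 1 := by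
        refine (natDegree_add_le _ _).trans (max_le hsd ?_)
        exact (natDegree_C_mul_le _ _).trans (by omega)
      rw [hk, natDegree_mul ha.ne_zero hk0] at this
      omega
    obtain ⟨v, rfl⟩ := natDegree_eq_zero.1 hkd
    refine ⟨v / w, ?_⟩
    set v' := v / w with hv'
    have hnb := nb_spec ha hab v'
    have hng := h.neigh (C v') ha.ne_zero hnb
    -- s + w y = w (b + v' a + y)
    have hCw : C w * C v' = C v := by rw [← C_mul, hv', mul_div_cancel₀ _ hw]
    have e1 : φ s + φ (C w) * y = φ (C w) * (φ (b + C v' * a) + y) := by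
      have : s = C w * (b + C v' * a) := by
        linear_combination hk - a * hCw - C w * b * (two0 (Fq := Fq))
      rw [this, map_mul]; ring
    rw [e1, ← Ideal.span_singleton_mul_span_singleton] at hI
    have hne : φ (b + C v' * a) + y ≠ 0 := by
      have := h.elt_ne (s := b + C v' * a) (w := 1) one_ne_zero
      simpa using this
    have hnd := nb_natDegree h hN hE ha hag hb hab v'
    have hCw0 : C w ≠ 0 := C_ne_zero.2 hw
    have hfin : Ideal.span {φ (nb N E a b v' * C w)} * Iab y a1 b1 =
        Ideal.span {φ a1} * Iab y (nb N E a b v') (b + C v' * a + N) := by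
      rw [← Ideal.span_singleton_mul_right_inj hne]
      rw [mul_left_comm, mul_left_comm (Ideal.span {φ (b + C v' * a) + y}) (Ideal.span {φ a1}), hng,
        mul_left_comm (Ideal.span {φ a1}), ← hI, map_mul, ← Ideal.span_singleton_mul_span_singleton]
      ring
    refine (h.eq_of_A hab1 ?_ (mul_ne_zero hnd.2 hCw0) hfin).2
    exact ⟨a, by linear_combination hnb + ((b + C v' * a) * N + N^2) * (two0 (Fq := Fq))⟩

lemma QR.nb_sol {a b : Fq[X]} (ha : a.Monic) (hab : a ∣ b ^ 2 + N * b + E) (v : Fq) :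
    nb N E a b v ∣ (b + C v * a + N) ^ 2 + N * (b + C v * a + N) + E :=
  ⟨a, by linear_combination nb_spec ha hab v + ((b + C v * a) * N + N^2) * (two0 (Fq := Fq))⟩

lemma QR.nb_ne {g : ℕ} (h : QR N E y (2 * g + 2)) (hN : N.natDegree ≤ g + 1) (hE : E.natDegree ≤ 2 * g + 2)
    {a b : Fq[X]} (ha : a.Monic) (hag : a.natDegree = g + 1) (hb : b.natDegree ≤ g) 
    (hab : a ∣ b ^ 2 + N * b + E) (v : Fq) :
    Iab y (nb N E a b v) (b + C v * a + N) ≠ Iab y a b := by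
  intro he
  have hng := h.neigh (C v) ha.ne_zero (nb_spec ha hab v)
  rw [he, mul_comm, mul_comm (Ideal.span _)] at hng
  have hne := h.Iab_ne (b := b) ha.ne_zero
  have h2 := mul_left_cancel₀ hne hng
  have h3 : φ (b + C v * a) + y ∈ Ideal.span {φ (nb N E a b v)} := by
    rw [← h2]; exact Ideal.mem_span_singleton_self _
  rw [Ideal.mem_span_singleton] at h3
  obtain ⟨r, hr⟩ := h3
  obtain ⟨z, w, rfl⟩ := h.rep r
  have := (h.inj2 (z := b + C v * a) (w := 1) (z' := nb N E a b v * z) (w' := nb N E a b v * w)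
    (by simp only [map_mul, map_one] at hr ⊢; linear_combination hr)).2
  have hu : IsUnit (nb N E a b v) := IsUnit.of_mul_eq_one _ this.symm
  have := natDegree_eq_zero_of_isUnit hu
  have := (nb_natDegree h hN hE ha hag hb hab v).1
  omega

lemma QR.nb_inj {g : ℕ} (h : QR N E y (2 * g + 2)) (hN : N.natDegree ≤ g + 1) (hE : E.natDegree ≤ 2 * g + 2)
    {a b : Fq[X]} (ha : a.Monic) (hag : a.natDegree = g + 1) (hb : b.natDegree ≤ g) 
    (hab : a ∣ b ^ 2 + N * b + E) (v v' : Fq)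
    (he : Iab y (nb N E a b v) (b + C v * a + N) = Iab y (nb N E a b v') (b + C v' * a + N)) : v = v' := by
  have hng := h.neigh (C v) ha.ne_zero (nb_spec ha hab v)
  have hng' := h.neigh (C v') ha.ne_zero (nb_spec ha hab v')
  have hd := nb_natDegree h hN hE ha hag hb hab v
  have hd' := nb_natDegree h hN hE ha hag hb hab v'
  have h1 : nb N E a b v ∣ nb N E a b v' := by
    rw [← h.mem0 (QR.nb_sol ha hab v), he, h.mem0 (QR.nb_sol ha hab v')]
  have h2 : nb N E a b v' ∣ nb N E a b v := by
    rw [← h.mem0 (QR.nb_sol ha hab v'), ← he, h.mem0 (QR.nb_sol ha hab v)]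
  have h3 : Ideal.span {φ (nb N E a b v)} = Ideal.span {φ (nb N E a b v')} := by
    rw [Ideal.span_singleton_eq_span_singleton]
    exact (associated_of_dvd_dvd h1 h2).map (algebraMap Fq[X] R)
  rw [he, h3, ← hng', mul_comm, mul_comm (Ideal.span _)] at hng
  have h4 := mul_left_cancel₀ (h.Iab_ne hd'.2) hng
  have h5 : φ (b + C v * a) + y ∈ Ideal.span {φ (b + C v' * a) + y} := by
    rw [← h4]; exact Ideal.mem_span_singleton_self _
  rw [Ideal.mem_span_singleton] at h5
  obtain ⟨r, hr⟩ := h5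
  obtain ⟨z, w, rfl⟩ := h.rep r
  have hm := h.mulf (b + C v' * a) 1 z w
  simp only [map_one, one_mul] at hm
  rw [hm] at hr
  have h6 := h.inj2 (z := b + C v * a) (w := 1) (z' := (b + C v' * a) * z + w * E)
    (w' := (b + C v' * a) * w + z * 1 + w * N) (by rw [map_one, one_mul]; exact hr)
  have h7 := nm_mul N E (b + C v' * a) 1 z w
  simp only [one_mul] at h7
  rw [← h6.1, ← h6.2] at h7
  have hn : ∀ v, nm N E (b + C v * a) 1 = a * nb N E a b v := by
    intro v; rw [← nb_spec ha hab v]; unfold nm; ring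
  rw [hn v, hn v'] at h7
  have hz : nm N E z w ≠ 0 := by
    intro h0; rw [h0, mul_zero] at h7; exact mul_ne_zero ha.ne_zero hd.2 h7
  have h8 := congrArg natDegree h7
  rw [natDegree_mul (mul_ne_zero ha.ne_zero hd'.2) hz, natDegree_mul ha.ne_zero hd.2,
    natDegree_mul ha.ne_zero hd'.2, hd.1, hd'.1] at h8
  have hw : w = 0 := by
    by_contra hw
    have := (h.nd z w hw).1
    omega
  subst hw
  simp at h6
  rw [← h6.2] at h6
  simpa [ha.ne_zero] using h6.1

lemma PLT_natDegree {b : Fq[X]} {g : ℕ} (hb : b ∈ PLT Fq (g + 1)) : b.natDegree ≤ g := by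
  rw [mem_PLT] at hb
  by_cases h : b = 0
  · simp [h]
  · rw [degree_eq_natDegree h] at hb
    have : b.natDegree < g + 1 := by exact_mod_cast hb
    omega

lemma Red_sub {m M : ℕ} (hm : m ≤ M) : Red N E m ⊆ RedLE N E M := by
  intro p hp
  rw [mem_Red] at hp
  rw [mem_RedLE]
  exact ⟨hp.1, by omega, by rw [hp.2.1]; exact hp.2.2.1, hp.2.2.2⟩

lemma QR.fiber {g : ℕ} (h : QR N E y (2 * g + 2)) (hN : N.natDegree ≤ g + 1) (hE : E.natDegree ≤ 2 * g + 2)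
    {p : Fq[X] × Fq[X]} (hp : p ∈ Red N E (g + 1)) :
    ((Red N E (g + 1)).filter (fun p' => cl y p' = cl y p)).card = Fintype.card Fq + 1 := by
  obtain ⟨a, b⟩ := p
  have hp0 := hp
  rw [mem_Red] at hp
  obtain ⟨ha, hag, hb, hab⟩ := hp
  dsimp only at ha hag hb hab
  have hb' := PLT_natDegree hb
  -- representatives
  have hrep : ∀ v : Fq, ∃ p' ∈ Red N E (g + 1), 
      Iab y p'.1 p'.2 = Iab y (nb N E a b v) (b + C v * a + N) := by
    intro v
    have hd := nb_natDegree h hN hE ha hag hb' hab v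
    obtain ⟨a1, b1, r1, r2, r3, r4, r5⟩ := h.normalize hd.2 (QR.nb_sol ha hab v)
    rw [hd.1] at r2
    exact ⟨(a1, b1), mem_Red.2 ⟨r1, r2, by rw [← r2]; exact r3, r4⟩, r5.symm⟩
  choose f hf hfI using hrep
  let F : Option Fq → Fq[X] × Fq[X] := fun o => o.elim (a, b) f
  have himg : (Red N E (g + 1)).filter (fun p' => cl y p' = cl y (a, b)) = Finset.univ.image F := by
    ext p'
    rw [Finset.mem_filter, Finset.mem_image]
    constructor
    · rintro ⟨hp', hc⟩
      have hq := mem_Red.1 hp'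
      rcases h.top_iff hN hE ha hag hb' hab hq.1 hq.2.1 hq.2.2.2 hc with h1 | ⟨v, h1⟩
      · exact ⟨none, Finset.mem_univ _, (h.red_ext (Red_sub le_rfl hp') (Red_sub le_rfl hp0) h1).symm⟩
      · refine ⟨some v, Finset.mem_univ _, ?_⟩
        exact h.red_ext (Red_sub le_rfl (hf v)) (Red_sub le_rfl hp') ((hfI v).trans h1.symm)
    · rintro ⟨o, -, rfl⟩
      cases o with
      | none => exact ⟨hp0, rfl⟩
      | some v =>
        refine ⟨hf v, ?_⟩
        have hd := nb_natDegree h hN hE ha hag hb' hab v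
        change cl y (f v) = _
        rw [h.cl_iff (mem_Red.1 (hf v)).1.ne_zero (by exact ha.ne_zero)]
        have hng := h.neigh (C v) ha.ne_zero (nb_spec ha hab v)
        rw [← hfI v] at hng
        refine ⟨_, _, ?_, h.phi_ne hd.2, hng⟩
        have := h.elt_ne (s := b + C v * a) (w := 1) one_ne_zero
        simpa using this
  rw [himg, Finset.card_image_of_injective, Finset.card_univ, Fintype.card_option]
  intro o o' ho
  cases o with
  | none =>
    cases o' with
    | none => rfl
    | some v' =>
      exfalso
      have h1 : (a, b) = f v' := ho
      have := hfI v'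
      rw [← h1] at this
      exact h.nb_ne hN hE ha hag hb' hab v' this.symm
  | some v =>
    cases o' with
    | none =>
      exfalso
      have h1 : f v = (a, b) := ho
      have := hfI v
      rw [h1] at this
      exact h.nb_ne hN hE ha hag hb' hab v this.symm
    | some v' =>
      have h1 : f v = f v' := ho
      congr 1
      apply h.nb_inj hN hE ha hag hb' hab
      rw [← hfI v, ← hfI v', h1]

theorem QR.card_I {g : ℕ} (h : QR N E y (2 * g + 2)) (hN : N.natDegree ≤ g + 1) (hE : E.natDegree ≤ 2 * g + 2) :
    (Fintype.card Fq + 1) * Nat.card (ClassGroup R) =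
      (Fintype.card Fq + 1) * ∑ k ∈ Finset.range (g + 1), ∑ a ∈ Mon Fq k, rho N E a +
      ∑ a ∈ Mon Fq (g + 1), rho N E a := by
  rw [← card_RedLE, ← card_Red]
  have hsur : ∀ c : ClassGroup R, ∃ p ∈ RedLE N E (g + 1), cl y p = c :=
    fun c => h.cl_surj hN (by omega) c
  have h1 : Nat.card (ClassGroup R) = ((RedLE N E g).image (cl y) ∪ (Red N E (g + 1)).image (cl y)).card := by
    have : ∀ c : ClassGroup R, c ∈ (RedLE N E g).image (cl y) ∪ (Red N E (g + 1)).image (cl y) := by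
      intro c
      obtain ⟨p, hp, rfl⟩ := hsur c
      have hp' := mem_RedLE.1 hp
      rw [Finset.mem_union]
      by_cases hd : p.1.natDegree ≤ g
      · exact Or.inl (Finset.mem_image_of_mem _ (mem_RedLE.2 ⟨hp'.1, hd, hp'.2.2⟩))
      · have hd' : p.1.natDegree = g + 1 := by omega
        exact Or.inr (Finset.mem_image_of_mem _ (mem_Red.2 ⟨hp'.1, hd', by rw [← hd']; exact hp'.2.2.1, hp'.2.2.2⟩))
    rw [← Nat.card_eq_finsetCard]
    exact Nat.card_congr (Equiv.subtypeUnivEquiv this).symm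
  have hdis : Disjoint ((RedLE N E g).image (cl y)) ((Red N E (g + 1)).image (cl y)) := by
    rw [Finset.disjoint_left]
    intro c hc hc'
    obtain ⟨p, hp, rfl⟩ := Finset.mem_image.1 hc
    obtain ⟨p', hp', he⟩ := Finset.mem_image.1 hc'
    have q1 := mem_RedLE.1 hp
    have q2 := mem_Red.1 hp'
    have : p = p' := by
      refine h.cl_inj (M := g + 1) (mem_RedLE.2 ⟨q1.1, by omega, q1.2.2⟩) (Red_sub le_rfl hp') (by omega) he.symm
    rw [this] at q1
    omega
  have hinj : ((RedLE N E g).image (cl y)).card = (RedLE N E g).card := by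
    apply Finset.card_image_of_injOn
    intro p hp p' hp' he
    have := (mem_RedLE.1 hp).2.1
    have := (mem_RedLE.1 hp').2.1
    exact h.cl_inj hp hp' (by omega) he
  have hfib : (Red N E (g + 1)).card = ((Red N E (g + 1)).image (cl y)).card * (Fintype.card Fq + 1) := by
    rw [Finset.card_eq_sum_card_image (cl y) (Red N E (g + 1)), ← smul_eq_mul, ← Finset.sum_const]
    refine Finset.sum_congr rfl fun c hc => ?_
    obtain ⟨p, hp, rfl⟩ := Finset.mem_image.1 hc
    exact h.fiber hN hE hp
  rw [h1, Finset.card_union_of_disjoint hdis, hinj, hfib]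
  ring

end Helpers3c
end EvenChar

set_option linter.unusedSectionVars false
set_option linter.unusedVariables false
set_option linter.overlappingInstances false
namespace EvenChar
section Helpers4
open scoped Classical
variable {Fq : Type} [Field Fq] [Fintype Fq] [CharP Fq 2]

lemma smooth_dvd {N E : Fq[X]} (hN : N ≠ 0) (hs : Smooth N E) (M : Fq[X]) :
    M ∣ N → ∀ s b : Fq[X], M ^ 2 ∣ s ^ 2 + N * b * s + b ^ 2 * E → M ∣ b ∧ M ∣ s := by
  induction M using UniqueFactorizationMonoid.induction_on_prime with
  | h₁ => intro h; exact absurd (zero_dvd_iff.1 h) hN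
  | h₂ x hx => intro _ s b _; exact ⟨hx.dvd, hx.dvd⟩
  | h₃ a p ha hp ih =>
    intro hM s b h
    obtain ⟨Q, hQ⟩ := exists_Pr hp.irreducible
    have hpN : p ∣ N := (dvd_mul_right p a).trans hM
    have hp2 : p ^ 2 ∣ s ^ 2 + N * b * s + b ^ 2 * E := (pow_dvd_pow_of_dvd (dvd_mul_right p a) 2).trans h
    have hpb : p ∣ b := by
      by_contra hpb
      have hc : IsCoprime b (p ^ 2) := ((hp.irreducible.coprime_iff_not_dvd).2 hpb).symm.pow_right
      obtain ⟨c, e, hce⟩ := hc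
      refine hs Q (hQ.symm.dvd.trans hpN) ⟨c * s, ?_⟩
      refine (hQ.symm.pow_pow (n := 2)).dvd.trans ?_
      obtain ⟨k, hk⟩ := hp2
      refine ⟨c ^ 2 * k + N * c * s * e + E * e * (2 - e * p ^ 2), ?_⟩
      linear_combination c ^ 2 * hk - (N * c * s + E * (c * b + 1 - e * p ^ 2)) * hce 
    have hps : p ∣ s := by
      have h1 : p ∣ s ^ 2 + N * b * s + b ^ 2 * E := (dvd_pow_self p (by norm_num)).trans hp2
      have h2 : p ∣ b ^ 2 * E := (hpb.trans (dvd_pow_self b (by norm_num))).mul_right _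
      have h3 : p ∣ N * b * s := (hpN.mul_right b).mul_right s
      have h4 : p ∣ s ^ 2 := by
        rw [dvd_add_left h2, dvd_add_left h3] at h1; exact h1
      exact hp.dvd_of_dvd_pow h4
    obtain ⟨b', rfl⟩ := hpb
    obtain ⟨s', rfl⟩ := hps
    have h5 : a ^ 2 ∣ s' ^ 2 + N * b' * s' + b' ^ 2 * E := by
      have : (p * a) ^ 2 ∣ p ^ 2 * (s' ^ 2 + N * b' * s' + b' ^ 2 * E) := by
        convert h using 1; ring
      rw [mul_pow] at this
      exact (mul_dvd_mul_iff_left (pow_ne_zero 2 hp.ne_zero)).1 this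
    obtain ⟨r1, r2⟩ := ih ((dvd_mul_left a p).trans hM) s' b' h5
    exact ⟨mul_dvd_mul_left p r1, mul_dvd_mul_left p r2⟩

/-- degree hypothesis -/
def ND (N E : Fq[X]) (K : ℕ) : Prop := 1 ≤ K ∧ ∀ z w : Fq[X], w ≠ 0 →
    K + 2 * w.natDegree ≤ (nm N E z w).natDegree ∧ 2 * z.natDegree ≤ (nm N E z w).natDegree

lemma irr_u {N E : Fq[X]} {K : ℕ} (hN : N ≠ 0) (hnd : ND N E K) (u : RatFunc Fq)
    (hu : algebraMap Fq[X] (RatFunc Fq) E = algebraMap Fq[X] (RatFunc Fq) N ^ 2 * u) :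
    Irreducible (X ^ 2 + X + C u : Polynomial (RatFunc Fq)) := by
  have hm : (X ^ 2 + X + C u : Polynomial (RatFunc Fq)).Monic := by monicity!
  have hdeg : (X ^ 2 + X + C u : Polynomial (RatFunc Fq)).natDegree = 2 := by compute_degree!
  rw [hm.irreducible_iff_roots_eq_zero_of_degree_le_three (by omega) (by omega)]
  rw [Multiset.eq_zero_iff_forall_notMem]
  intro x hx
  rw [mem_roots hm.ne_zero, IsRoot.def] at hx
  simp only [eval_add, eval_pow, eval_X, eval_C] at hx
  have hintg : IsIntegral Fq[X] (algebraMap Fq[X] (RatFunc Fq) N * x) := by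
    refine ⟨X ^ 2 + C N * X + C E, by monicity!, ?_⟩
    simp only [eval₂_add, eval₂_mul, eval₂_pow, eval₂_X, eval₂_C]
    rw [hu]
    linear_combination (algebraMap Fq[X] (RatFunc Fq) N ^ 2) * hx
  obtain ⟨s, hs⟩ := IsIntegrallyClosed.isIntegral_iff.1 hintg
  have h1 : nm N E s 1 = 0 := by
    apply FaithfulSMul.algebraMap_injective Fq[X] (RatFunc Fq)
    simp only [nm, map_add, map_mul, map_pow, map_one, map_zero, hs, hu]
    linear_combination (algebraMap Fq[X] (RatFunc Fq) N ^ 2) * hx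
  have := (hnd.2 s 1 one_ne_zero).1
  have := hnd.1
  rw [h1, natDegree_zero] at *
  omega

lemma ev_f {S : Type*} [CommRing S] (u : RatFunc Fq) (i : RatFunc Fq →+* S) (t : S) :
    eval₂ i t (X ^ 2 + X + C u) = t ^ 2 + t + i u := by simp

lemma QR_u {N E : Fq[X]} {K : ℕ} (hN : N ≠ 0) (hnd : ND N E K) (hsm : Smooth N E) (u : RatFunc Fq)
    (hu : algebraMap Fq[X] (RatFunc Fq) E = algebraMap Fq[X] (RatFunc Fq) N ^ 2 * u)
    [Fact (Irreducible (X ^ 2 + X + C u : Polynomial (RatFunc Fq)))] :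
    IsDedekindDomain (integralClosure (Polynomial Fq)
        (AdjoinRoot (X ^ 2 + X + C u : Polynomial (RatFunc Fq)))) ∧
    ∃ y : integralClosure (Polynomial Fq)
        (AdjoinRoot (X ^ 2 + X + C u : Polynomial (RatFunc Fq))), QR N E y K := by
  set f : Polynomial (RatFunc Fq) := X ^ 2 + X + C u with hf
  have hirr : Irreducible f := Fact.out
  have hm : f.Monic := by rw [hf]; monicity!
  have hdeg : f.natDegree = 2 := by rw [hf]; compute_degree!
  let L := AdjoinRoot f
  have h2k : (2 : RatFunc Fq) = 0 := by
    have := congrArg (algebraMap Fq[X] (RatFunc Fq)) (two0 (Fq := Fq))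
    rwa [map_ofNat, map_zero] at this
  have h2 : (2 : L) = 0 := by
    have := congrArg (algebraMap (RatFunc Fq) L) h2k
    rwa [map_ofNat, map_zero] at this
  let x : L := AdjoinRoot.root f
  have hx : x ^ 2 + x + algebraMap (RatFunc Fq) L u = 0 := by
    have h1 := AdjoinRoot.eval₂_root f
    have h3 : eval₂ (AdjoinRoot.of f) x f = _ := ev_f u (AdjoinRoot.of f) x
    exact h3.symm.trans h1
  have hfd : FiniteDimensional (RatFunc Fq) L := (AdjoinRoot.powerBasis hm.ne_zero).finite
  have hsep : Algebra.IsSeparable (RatFunc Fq) L := by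
    have h1 : IsSeparable (RatFunc Fq) x := by
      rw [IsSeparable]
      have hd : minpoly (RatFunc Fq) x ∣ f := minpoly.dvd _ _ (by
        have h3 : eval₂ (algebraMap (RatFunc Fq) L) x f = _ := ev_f u (algebraMap (RatFunc Fq) L) x
        exact h3.trans hx)
      refine Separable.of_dvd ?_ hd
      rw [Polynomial.Separable]
      have : derivative f = 1 := by
        rw [hf]
        simp only [derivative_add, derivative_X_pow, derivative_X, derivative_C]
        rw [Nat.cast_ofNat, h2k]; simp
      rw [this]; exact isCoprime_one_right
    have h3 := (IntermediateField.isSeparable_adjoin_simple_iff_isSeparable (RatFunc Fq) L).2 h1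
    have h4 : IntermediateField.adjoin (RatFunc Fq) {x} = ⊤ := IntermediateField.adjoin_root_eq_top f
    rw [h4] at h3
    exact AlgEquiv.Algebra.isSeparable (IntermediateField.topEquiv (F := RatFunc Fq) (E := L))
  refine ⟨integralClosure.isDedekindDomain Fq[X] (RatFunc Fq) L, ?_⟩
  have hrepL : ∀ r : L, ∃ a b : RatFunc Fq, r = algebraMap _ L a + algebraMap _ L b * x := by
    intro r
    obtain ⟨p, rfl⟩ := AdjoinRoot.mk_surjective r
    have h1 : (p %ₘ f).natDegree ≤ 1 := by
      have := natDegree_modByMonic_lt p hm (by intro h; rw [h] at hdeg; simp at hdeg)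
      omega
    have h3 : AdjoinRoot.mk f p = AdjoinRoot.mk f (p %ₘ f) := by
      rw [AdjoinRoot.mk_eq_mk]
      exact ⟨p /ₘ f, by linear_combination -(modByMonic_add_div p f)⟩
    obtain ⟨b, a, hab⟩ := exists_eq_X_add_C_of_natDegree_le_one h1
    refine ⟨a, b, ?_⟩
    rw [h3, hab, map_add, map_mul, AdjoinRoot.mk_X, AdjoinRoot.mk_C, AdjoinRoot.mk_C]
    exact add_comm _ _
  have huniqL : ∀ a b : RatFunc Fq, algebraMap _ L a + algebraMap _ L b * x = 0 → a = 0 ∧ b = 0 := by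
    intro a b h
    have h1 : AdjoinRoot.mk f (C b * X + C a) = 0 := by
      rw [map_add, map_mul, AdjoinRoot.mk_X, AdjoinRoot.mk_C, AdjoinRoot.mk_C, add_comm]
      exact h
    rw [AdjoinRoot.mk_eq_zero] at h1
    have h3 : C b * X + C a = 0 := by
      by_contra hne
      have h4 := natDegree_le_of_dvd h1 hne
      have h5 : (C b * X + C a).natDegree ≤ 1 := natDegree_linear_le
      omega
    have h6 := congrArg (fun p => coeff p 0) h3
    have h7 := congrArg (fun p => coeff p 1) h3
    simp at h6 h7
    exact ⟨h6, h7⟩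
  let σ : L →ₐ[RatFunc Fq] L := AdjoinRoot.liftAlgHom f (Algebra.ofId (RatFunc Fq) L) (x + 1) (by
    refine (ev_f u _ (x + 1)).trans ?_
    change (x + 1) ^ 2 + (x + 1) + algebraMap (RatFunc Fq) L u = 0
    linear_combination hx + (x + 1) * h2)
  have hσx : σ x = x + 1 := AdjoinRoot.liftAlgHom_root _ _ _ _
  let σA : L →ₐ[Fq[X]] L := σ.restrictScalars Fq[X]
  have htow : ∀ s : Fq[X], algebraMap Fq[X] L s = algebraMap (RatFunc Fq) L (algebraMap Fq[X] (RatFunc Fq) s) :=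
    fun s => IsScalarTower.algebraMap_apply _ _ _ _
  have hkL : Function.Injective (algebraMap (RatFunc Fq) L) := (algebraMap (RatFunc Fq) L).injective
  have hAk : Function.Injective (algebraMap Fq[X] (RatFunc Fq)) := FaithfulSMul.algebraMap_injective _ _
  have hdesc : ∀ a : RatFunc Fq, IsIntegral Fq[X] (algebraMap (RatFunc Fq) L a) →
      ∃ s : Fq[X], algebraMap Fq[X] (RatFunc Fq) s = a := by
    intro a ha
    exact IsIntegrallyClosed.isIntegral_iff.1 ((isIntegral_algebraMap_iff hkL).1 ha)
  have hyint : IsIntegral Fq[X] (algebraMap Fq[X] L N * x) := by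
    refine ⟨X ^ 2 + C N * X + C E, by monicity!, ?_⟩
    simp only [eval₂_add, eval₂_mul, eval₂_pow, eval₂_X, eval₂_C]
    rw [htow E, hu, htow N, map_mul, map_pow]
    linear_combination (algebraMap (RatFunc Fq) L (algebraMap Fq[X] (RatFunc Fq) N) ^ 2) * hx
  have hNk : algebraMap Fq[X] (RatFunc Fq) N ≠ 0 := by
    rw [Ne, map_eq_zero_iff _ hAk]; exact hN
  refine ⟨⟨algebraMap Fq[X] L N * x, hyint⟩, ?_, ?_, ?_, hnd.1, hnd.2⟩
  · apply Subtype.ext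
    change algebraMap Fq[X] L N * x * (algebraMap Fq[X] L N * x) = algebraMap Fq[X] L N * (algebraMap Fq[X] L N * x) + algebraMap Fq[X] L E
    rw [htow E, hu, htow N, map_mul, map_pow]
    set n := algebraMap (RatFunc Fq) L (algebraMap Fq[X] (RatFunc Fq) N)
    linear_combination n ^ 2 * hx - n ^ 2 * (x + algebraMap (RatFunc Fq) L u) * h2
  · rintro ⟨r, hr⟩
    obtain ⟨a, b, hab⟩ := hrepL r
    have hσr : IsIntegral Fq[X] (σ r) := by
      have := IsIntegral.map σA (show IsIntegral Fq[X] r from hr)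
      exact this
    have hσr' : σ r = algebraMap _ L a + algebraMap _ L b * (x + 1) := by
      rw [hab, map_add, map_mul, AlgHom.commutes, AlgHom.commutes, hσx]
    have htr : r + σ r = algebraMap _ L b := by
      rw [hσr', hab]; linear_combination (algebraMap _ L a + algebraMap _ L b * x) * h2
    have hnr : r * σ r = algebraMap _ L (a ^ 2 + a * b + b ^ 2 * u) := by
      rw [hσr', hab]
      simp only [map_add, map_mul, map_pow]
      linear_combination (algebraMap _ L b) ^ 2 * hx + (algebraMap _ L a * algebraMap _ L b * x - (algebraMap _ L b) ^ 2 * algebraMap _ L u) * h2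
    obtain ⟨b0, hb0⟩ := hdesc b (by rw [← htr]; exact IsIntegral.add hr hσr)
    obtain ⟨n0, hn0⟩ := hdesc _ (by rw [← hnr]; exact IsIntegral.mul hr hσr)
    have hNa : IsIntegral Fq[X] (algebraMap Fq[X] (RatFunc Fq) N * a) := by
      refine ⟨X ^ 2 + C (N * b0) * X + C (b0 ^ 2 * E + N ^ 2 * n0), by monicity!, ?_⟩
      simp only [eval₂_add, eval₂_mul, eval₂_pow, eval₂_X, eval₂_C, map_mul, map_add, map_pow]
      rw [hu, hb0, hn0]
      linear_combination (algebraMap Fq[X] (RatFunc Fq) N ^ 2 * (a ^ 2 + a * b + b ^ 2 * u)) * h2k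
    obtain ⟨s, hs⟩ := IsIntegrallyClosed.isIntegral_iff.1 hNa
    have hdv : N ^ 2 ∣ s ^ 2 + N * b0 * s + b0 ^ 2 * E := by
      refine ⟨n0, hAk ?_⟩
      simp only [map_add, map_mul, map_pow]
      rw [hs, hu, hb0, hn0]; ring
    obtain ⟨⟨w, rfl⟩, ⟨z, rfl⟩⟩ := smooth_dvd hN hsm N dvd_rfl s b0 hdv
    refine ⟨z, w, ?_⟩
    apply Subtype.ext
    change r = algebraMap Fq[X] L z + algebraMap Fq[X] L w * (algebraMap Fq[X] L N * x)
    have ha : a = algebraMap Fq[X] (RatFunc Fq) z := by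
      rw [map_mul] at hs
      exact (mul_left_cancel₀ hNk hs).symm
    rw [hab, ha, ← hb0, htow, htow, htow, map_mul, map_mul]; ring
  · intro z w h
    have h1 : algebraMap Fq[X] L z + algebraMap Fq[X] L w * (algebraMap Fq[X] L N * x) = 0 := congrArg Subtype.val h
    rw [htow, htow, htow, ← mul_assoc, ← map_mul] at h1
    obtain ⟨r1, r2⟩ := huniqL _ _ h1
    refine ⟨?_, ?_⟩
    · exact (map_eq_zero_iff _ hAk).1 r1
    · rcases mul_eq_zero.1 r2 with h0 | h0
      · exact (map_eq_zero_iff _ hAk).1 h0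
      · exact absurd h0 hNk

theorem hClass_R {N E : Fq[X]} {g : ℕ} (hN : N ≠ 0) (hnd : ND N E (2 * g + 1)) (hsm : Smooth N E) (u : RatFunc Fq)
    (hu : algebraMap Fq[X] (RatFunc Fq) E = algebraMap Fq[X] (RatFunc Fq) N ^ 2 * u)
    (hNd : N.natDegree ≤ g) (hE : E.natDegree ≤ 2 * g + 1) :
    hClass u = ∑ k ∈ Finset.range (g + 1), ∑ a ∈ Mon Fq k, rho N E a := by
  have hirr := irr_u hN hnd u hu
  have : Fact (Irreducible (X ^ 2 + X + C u : Polynomial (RatFunc Fq))) := ⟨hirr⟩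
  obtain ⟨hD, y, hy⟩ := QR_u hN hnd hsm u hu
  rw [hClass, dif_pos hirr]
  exact hy.card_R hNd hE

theorem hClass_I {N E : Fq[X]} {g : ℕ} (hN : N ≠ 0) (hnd : ND N E (2 * g + 2)) (hsm : Smooth N E) (u : RatFunc Fq)
    (hu : algebraMap Fq[X] (RatFunc Fq) E = algebraMap Fq[X] (RatFunc Fq) N ^ 2 * u)
    (hNd : N.natDegree ≤ g + 1) (hE : E.natDegree ≤ 2 * g + 2) :
    (Fintype.card Fq + 1) * hClass u = (Fintype.card Fq + 1) * ∑ k ∈ Finset.range (g + 1), ∑ a ∈ Mon Fq k, rho N E a +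
      ∑ a ∈ Mon Fq (g + 1), rho N E a := by
  have hirr := irr_u hN hnd u hu
  have : Fact (Irreducible (X ^ 2 + X + C u : Polynomial (RatFunc Fq))) := ⟨hirr⟩
  obtain ⟨hD, y, hy⟩ := QR_u hN hnd hsm u hu
  rw [hClass, dif_pos hirr]
  exact hy.card_I hNd hE

end Helpers4
end EvenChar

set_option linter.unusedSectionVars false
set_option linter.unusedVariables false
namespace EvenChar
section Helpers5
open scoped Classical
variable {Fq : Type} [Field Fq] [Fintype Fq] [CharP Fq 2]

lemma ND_R {N E : Fq[X]} {g : ℕ} (hN : N.natDegree ≤ g) (hE : E.natDegree = 2 * g + 1) :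
    ND N E (2 * g + 1) := by
  refine ⟨by omega, fun z w hw => ?_⟩
  have hE0 : E ≠ 0 := by rintro rfl; simp at hE
  have h1 : (w ^ 2 * E).natDegree = 2 * w.natDegree + (2 * g + 1) := by
    rw [natDegree_mul (pow_ne_zero _ hw) hE0, natDegree_pow, hE]
  have h2 : (z ^ 2).natDegree = 2 * z.natDegree := natDegree_pow _ _
  have h3 : (N * z * w).natDegree ≤ g + z.natDegree + w.natDegree :=
    natDegree_mul_le.trans (by have := natDegree_mul_le (p := N) (q := z); omega)
  by_cases hc : z.natDegree ≤ w.natDegree + g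
  · have h4 : (z ^ 2 + N * z * w).natDegree < (w ^ 2 * E).natDegree :=
      (natDegree_add_le _ _).trans_lt (max_lt (by omega) (by omega))
    have : (nm N E z w).natDegree = 2 * w.natDegree + (2 * g + 1) := by
      rw [nm, natDegree_add_eq_right_of_natDegree_lt h4, h1]
    omega
  · have h4 : (N * z * w + w ^ 2 * E).natDegree < (z ^ 2).natDegree :=
      (natDegree_add_le _ _).trans_lt (max_lt (by omega) (by omega))
    have : (nm N E z w).natDegree = 2 * z.natDegree := by
      rw [nm, add_assoc, natDegree_add_eq_left_of_natDegree_lt h4, h2]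
    omega

lemma ND_I {N E : Fq[X]} {g : ℕ} {ξ : Fq} (hξ : ∀ x : Fq, x ^ 2 + x ≠ ξ) (hNm : N.Monic) (hN : N.natDegree = g + 1)
    (hE : E.natDegree ≤ 2 * g + 2) (hEl : E.coeff (2 * g + 2) = ξ) :
    ND N E (2 * g + 2) := by
  refine ⟨by omega, fun z w hw => ?_⟩
  obtain ⟨n, hn1, hn2, hn3⟩ : ∃ n, w.natDegree ≤ n ∧ z.natDegree ≤ n + (g + 1) ∧ 
      (w.natDegree = n ∨ (z.natDegree = n + (g + 1) ∧ z ≠ 0)) := by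
    by_cases h : z.natDegree ≤ w.natDegree + (g + 1)
    · exact ⟨_, le_rfl, h, Or.inl rfl⟩
    · refine ⟨z.natDegree - (g + 1), by omega, by omega, Or.inr ⟨by omega, ?_⟩⟩
      rintro rfl; simp at h
  have c1 : (z ^ 2).coeff (2 * (n + (g + 1))) = z.coeff (n + (g + 1)) ^ 2 := by
    exact coeff_pow_of_natDegree_le hn2
  have c2 : (N * z * w).coeff (2 * (n + (g + 1))) = z.coeff (n + (g + 1)) * w.coeff n := by
    have e : 2 * (n + (g + 1)) = (g + 1) + (n + (g + 1)) + n := by ring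
    rw [e, coeff_mul_add_eq_of_natDegree_le _ hn1, coeff_mul_add_eq_of_natDegree_le hN.le hn2, ← hN, hNm.coeff_natDegree, one_mul]
    exact natDegree_mul_le.trans (by omega)
  have c3 : (w ^ 2 * E).coeff (2 * (n + (g + 1))) = w.coeff n ^ 2 * ξ := by
    have e : 2 * (n + (g + 1)) = (2 * n) + (2 * g + 2) := by ring
    rw [e, coeff_mul_add_eq_of_natDegree_le _ hE, coeff_pow_of_natDegree_le hn1, hEl]
    rw [natDegree_pow]; omega
  have h0 : (nm N E z w).coeff (2 * (n + (g + 1))) ≠ 0 := by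
    rw [nm, coeff_add, coeff_add, c1, c2, c3]
    intro h
    by_cases hwn : w.coeff n = 0
    · rw [hwn] at h
      simp at h
      rcases hn3 with h1 | ⟨h1, h2⟩
      · rw [← h1, coeff_natDegree, leadingCoeff_eq_zero] at hwn; exact hw hwn
      · rw [← h1, coeff_natDegree, leadingCoeff_eq_zero] at h; exact h2 h
    · have h2 : (2 : Fq) = 0 := CharTwo.two_eq_zero
      apply hξ (z.coeff (n + (g + 1)) / w.coeff n)
      field_simp
      linear_combination h - w.coeff n ^ 2 * ξ * h2
  have h1 := le_natDegree_of_ne_zero h0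
  constructor <;> omega

lemma rho_shift {N E a : Fq[X]} (ha : a.Monic) (t : Fq[X]) : rho N (E + (t ^ 2 + N * t)) a = rho N E a := by
  have hd : a.degree = a.natDegree := degree_eq_natDegree ha.ne_zero
  have hmod : ∀ b : Fq[X], a ∣ b + b %ₘ a := by
    intro b
    refine ⟨b /ₘ a, ?_⟩
    linear_combination -(modByMonic_add_div b a) + (b %ₘ a) * (two0 (Fq := Fq))
  have hdd : ∀ b b' : Fq[X], b ∈ PLT Fq a.natDegree → b' ∈ PLT Fq a.natDegree → a ∣ b + b' → b = b' := by
    intro b b' hb hb' h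
    by_contra hne
    have h1 : b + b' = b - b' := by linear_combination b' * (two0 (Fq := Fq))
    rw [h1] at h
    have h2 := degree_le_of_dvd h (sub_ne_zero.2 hne)
    have h3 := (degree_sub_le b b').trans_lt (max_lt (mem_PLT.1 hb) (mem_PLT.1 hb'))
    rw [hd] at h2
    exact absurd h3 (not_lt.2 h2)
  have hmem : ∀ b : Fq[X], b %ₘ a ∈ PLT Fq a.natDegree := by
    intro b; rw [mem_PLT, ← hd]; exact degree_modByMonic_lt _ ha
  have hinv : ∀ b ∈ PLT Fq a.natDegree, ((b + t) %ₘ a + t) %ₘ a = b := by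
    intro b hb
    apply hdd _ _ (hmem _) hb
    have h1 := hmod ((b + t) %ₘ a + t)
    have h2 := hmod (b + t)
    have : ((b + t) %ₘ a + t) %ₘ a + b = (((b + t) %ₘ a + t) + ((b + t) %ₘ a + t) %ₘ a) + ((b + t) + (b + t) %ₘ a) := by
      linear_combination -((b + t) %ₘ a + t) * (two0 (Fq := Fq))
    rw [this]; exact dvd_add h1 h2
  have hsol : ∀ E' b : Fq[X], a ∣ b ^ 2 + N * b + E' → a ∣ ((b + t) %ₘ a) ^ 2 + N * ((b + t) %ₘ a) + (E' + (t ^ 2 + N * t)) := by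
    intro E' b h
    refine QR.sol_shift ?_ (hmod (b + t))
    convert h using 1
    linear_combination (b * t + t ^ 2 + N * t) * (two0 (Fq := Fq))
  unfold rho
  symm
  refine Finset.card_bij' (fun b _ => (b + t) %ₘ a) (fun b _ => (b + t) %ₘ a) ?_ ?_ ?_ ?_
  · intro b hb
    rw [Finset.mem_filter] at hb ⊢
    exact ⟨hmem _, hsol _ _ hb.2⟩
  · intro b hb
    rw [Finset.mem_filter] at hb ⊢
    refine ⟨hmem _, ?_⟩
    have := hsol _ _ hb.2
    convert this using 1
    linear_combination -(t ^ 2 + N * t) * (two0 (Fq := Fq))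
  · intro b hb
    exact hinv b (Finset.mem_filter.1 hb).1
  · intro b hb
    exact hinv b (Finset.mem_filter.1 hb).1

lemma smooth_shift {N E : Fq[X]} (t : Fq[X]) : Smooth N (E + (t ^ 2 + N * t)) ↔ Smooth N E := by
  have key : ∀ E : Fq[X], Smooth N E → Smooth N (E + (t ^ 2 + N * t)) := by
    intro E h P hP ⟨t', ht'⟩
    refine h P hP ⟨t + t', ?_⟩
    convert ht' using 1
    linear_combination (t * t') * (two0 (Fq := Fq))
  refine ⟨fun h => ?_, key E⟩
  have := key _ h
  convert this using 1
  linear_combination -(t ^ 2 + N * t) * (two0 (Fq := Fq))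

lemma fiber_count {α β : Type*} (s : Finset α) (t : Finset β) (f : α → β) (hf : ∀ a ∈ s, f a ∈ t) (k : ℕ)
    (hfib0 : ∀ b ∈ t, ∀ u ⊆ s, (∀ a ∈ u, f a = b) → u.card ≤ k) (hcard : s.card = k * t.card) (F : β → ℕ) :
    ∑ a ∈ s, F (f a) = k * ∑ b ∈ t, F b := by
  have hfib : ∀ b ∈ t, (s.filter (fun a => f a = b)).card ≤ k := fun b hb =>
    hfib0 b hb _ (Finset.filter_subset _ _) (fun a ha => (Finset.mem_filter.1 ha).2)
  have h1 : ∑ b ∈ t, (s.filter (fun a => f a = b)).card = ∑ b ∈ t, k := by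
    rw [← Finset.card_eq_sum_card_fiberwise hf, hcard, Finset.sum_const, smul_eq_mul, mul_comm]
  have h2 := (Finset.sum_eq_sum_iff_of_le hfib).1 h1
  rw [← Finset.sum_fiberwise_of_maps_to hf, Finset.mul_sum]
  refine Finset.sum_congr rfl fun b hb => ?_
  rw [Finset.sum_congr rfl (g := fun _ => F b) (by intro a ha; rw [(Finset.mem_filter.1 ha).2]), Finset.sum_const,
    h2 b hb, smul_eq_mul]

/-- index set -/
def TT (N : Fq[X]) : Finset (Pr Fq × ℕ) :=
  (pf N ×ˢ Finset.range (N.natDegree + 1)).filter (fun i => i.1.1 ^ (i.2 + 1) ∣ N)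

lemma mem_TT {N : Fq[X]} (hN : N ≠ 0) {i : Pr Fq × ℕ} : i ∈ TT N ↔ i.1.1 ^ (i.2 + 1) ∣ N := by
  rw [TT, Finset.mem_filter, Finset.mem_product, mem_pf hN, Finset.mem_range]
  constructor
  · exact fun h => h.2
  · intro h
    refine ⟨⟨(dvd_pow_self _ (by omega)).trans h, ?_⟩, h⟩
    have h1 := natDegree_le_of_dvd h hN
    rw [natDegree_pow] at h1
    have := Pr_pos i.1
    nlinarith

lemma sum_TT (N : Fq[X]) : N ≠ 0 → ∑ i ∈ TT N, i.1.1.natDegree = N.natDegree := by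
  induction N using UniqueFactorizationMonoid.induction_on_prime with
  | h₁ => intro h; exact absurd rfl h
  | h₂ x hx =>
    intro h0
    have : TT x = ∅ := by
      rw [Finset.eq_empty_iff_forall_notMem]
      intro i hi
      rw [mem_TT h0] at hi
      exact i.1.2.2.not_isUnit (isUnit_of_dvd_unit ((dvd_pow_self _ (by omega)).trans hi) hx)
    rw [this, natDegree_eq_zero_of_isUnit hx, Finset.sum_empty]
  | h₃ a p ha hp ih =>
    intro h0
    obtain ⟨Q, hQ⟩ := exists_Pr hp.irreducible
    obtain ⟨e, he⟩ := FiniteMultiplicity.exists_eq_pow_mul_and_not_dvd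
      (FiniteMultiplicity.of_prime_left Q.2.2.prime ha)
    set e := multiplicity Q.1 a
    have hQp : Q.1.natDegree = p.natDegree := natDegree_eq_of_degree_eq (degree_eq_degree_of_associated hQ.symm)
    have hins : TT (p * a) = insert (Q, e) (TT a) := by
      ext ⟨P, j⟩
      rw [Finset.mem_insert, mem_TT h0, mem_TT ha]
      dsimp only
      have hassoc : P.1 ^ (j + 1) ∣ p * a ↔ P.1 ^ (j + 1) ∣ Q.1 * a := (hQ.mul_right a).dvd_iff_dvd_right
      rw [hassoc]
      by_cases hPQ : P = Q
      · subst hPQ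
        rw [pow_succ', mul_dvd_mul_iff_left P.2.2.ne_zero, ← pow_succ']
        have hk : ∀ k, P.1 ^ k ∣ a ↔ k ≤ e := fun k => 
          (FiniteMultiplicity.of_prime_left P.2.2.prime ha).pow_dvd_iff_le_multiplicity
        rw [hk, hk]
        simp only [Prod.mk.injEq, true_and]
        omega
      · have hcop : IsCoprime (P.1 ^ (j + 1)) Q.1 := (Pr_coprime hPQ).pow_left
        have : (P, j) ≠ (Q, e) := fun h => hPQ (Prod.ext_iff.1 h).1
        simp only [this, false_or]
        exact ⟨fun h => hcop.dvd_of_dvd_mul_left h, fun h => h.mul_left _⟩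
    have hnot : (Q, e) ∉ TT a := by
      rw [mem_TT ha]
      dsimp only
      rw [(FiniteMultiplicity.of_prime_left Q.2.2.prime ha).pow_dvd_iff_le_multiplicity]
      omega
    rw [hins, Finset.sum_insert hnot, ih ha, natDegree_mul hp.ne_zero ha, hQp]

/-- coefficient data supported on divisors of `N` -/
def DD (N : Fq[X]) : Finset ((Pr Fq × ℕ) →₀ Fq[X]) := (TT N).finsupp (fun i => PLT Fq i.1.1.natDegree)

lemma card_DD {N : Fq[X]} (hN : N ≠ 0) : (DD N).card = Fintype.card Fq ^ N.natDegree := by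
  rw [DD, Finset.card_finsupp]
  simp_rw [card_PLT]
  rw [Finset.prod_pow_eq_pow_sum, sum_TT N hN]

lemma mem_DD {N : Fq[X]} (hN : N ≠ 0) {c : (Pr Fq × ℕ) →₀ Fq[X]} : c ∈ DD N ↔
    (∀ i, c i ≠ 0 → i.1.1 ^ (i.2 + 1) ∣ N) ∧ ∀ i, (c i).degree < i.1.1.natDegree := by
  rw [DD, Finset.mem_finsupp_iff]
  constructor
  · rintro ⟨h1, h2⟩
    have h3 : ∀ i, c i ≠ 0 → i.1.1 ^ (i.2 + 1) ∣ N := by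
      intro i hi
      rw [← mem_TT hN]
      exact h1 (Finsupp.mem_support_iff.2 hi)
    refine ⟨h3, fun i => ?_⟩
    by_cases hi : c i = 0
    · rw [hi, degree_zero]; exact WithBot.bot_lt_coe _
    · exact mem_PLT.1 (h2 i ((mem_TT hN).2 (h3 i hi)))
  · rintro ⟨h1, h2⟩
    refine ⟨fun i hi => (mem_TT hN).2 (h1 i (Finsupp.mem_support_iff.1 hi)), fun i _ => mem_PLT.2 (h2 i)⟩

lemma DD_mono {N M : Fq[X]} (hN : N ≠ 0) (hM : M ≠ 0) (h : N ∣ M) : DD N ⊆ DD M := by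
  intro c hc
  rw [mem_DD hN] at hc
  rw [mem_DD hM]
  exact ⟨fun i hi => (hc.1 i hi).trans h, hc.2⟩

lemma DD_sub {N : Fq[X]} (hN : N ≠ 0) {c c' : (Pr Fq × ℕ) →₀ Fq[X]} (hc : c ∈ DD N) (hc' : c' ∈ DD N) : c - c' ∈ DD N := by
  rw [mem_DD hN] at *
  refine ⟨fun i hi => ?_, fun i => ?_⟩
  · by_cases h : c i = 0
    · refine hc'.1 i ?_
      intro h'; apply hi; simp [h, h']
    · exact hc.1 i h
  · rw [Finsupp.sub_apply]
    exact (degree_sub_le _ _).trans_lt (max_lt (hc.2 i) (hc'.2 i))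

end Helpers5
end EvenChar

set_option linter.unusedSectionVars false
set_option linter.unusedVariables false
namespace EvenChar
section Helpers5b
open scoped Classical
variable {Fq : Type} [Field Fq] [Fintype Fq] [CharP Fq 2]

/-- cofactor -/
def cof (N : Fq[X]) (i : Pr Fq × ℕ) : Fq[X] := N ^ 2 / i.1.1 ^ (2 * i.2 + 1)

lemma cof_spec {N : Fq[X]} {i : Pr Fq × ℕ} (h : i.1.1 ^ (i.2 + 1) ∣ N) : i.1.1 ^ (2 * i.2 + 1) * cof N i = N ^ 2 := by
  apply EuclideanDomain.mul_div_cancel' (pow_ne_zero _ i.1.2.2.ne_zero)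
  have := pow_dvd_pow_of_dvd h 2
  rw [← pow_mul] at this
  exact (pow_dvd_pow _ (by omega)).trans this

/-- numerator -/
def WW (N : Fq[X]) (c : (Pr Fq × ℕ) →₀ Fq[X]) : Fq[X] := ∑ i ∈ TT N, c i * cof N i

/-- the associated rational function -/
def vv (c : (Pr Fq × ℕ) →₀ Fq[X]) : RatFunc Fq :=
  c.sum fun i a => algebraMap Fq[X] (RatFunc Fq) a / algebraMap Fq[X] (RatFunc Fq) i.1.1 ^ (2 * i.2 + 1)

lemma WW_sub (N : Fq[X]) (c c' : (Pr Fq × ℕ) →₀ Fq[X]) : WW N (c - c') = WW N c - WW N c' := by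
  simp [WW, sub_mul, Finset.sum_sub_distrib]

lemma algPr_ne (P : Pr Fq) : algebraMap Fq[X] (RatFunc Fq) P.1 ≠ 0 := by
  have := P.2.2.ne_zero
  simpa using this

lemma WW_vv {N : Fq[X]} (hN : N ≠ 0) {c : (Pr Fq × ℕ) →₀ Fq[X]} (hc : c ∈ DD N) :
    algebraMap Fq[X] (RatFunc Fq) (WW N c) = algebraMap Fq[X] (RatFunc Fq) N ^ 2 * vv c := by
  have hsub : c.support ⊆ TT N := fun i hi => (mem_TT hN).2 (((mem_DD hN).1 hc).1 i (Finsupp.mem_support_iff.1 hi))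
  rw [vv, Finsupp.sum_of_support_subset _ hsub _ (by simp), WW, map_sum, Finset.mul_sum]
  refine Finset.sum_congr rfl fun i hi => ?_
  have h := cof_spec ((mem_TT hN).1 hi)
  rw [map_mul, ← map_pow _ N, ← h, map_mul, map_pow]
  have := algPr_ne i.1
  field_simp

lemma vv_sub (c c' : (Pr Fq × ℕ) →₀ Fq[X]) : vv (c - c') = vv c - vv c' := by
  unfold vv
  apply Finsupp.sum_sub_index
  intros
  rw [map_sub, sub_div]

lemma WW_degree {N : Fq[X]} (hN : N ≠ 0) {c : (Pr Fq × ℕ) →₀ Fq[X]} (hc : c ∈ DD N) :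
    (WW N c).degree < (2 * N.natDegree : ℕ) := by
  rw [← mem_PLT, WW]
  have : ∀ s ⊆ TT N, ∑ i ∈ s, c i * cof N i ∈ PLT Fq (2 * N.natDegree) := by
    intro s hs
    rw [mem_PLT]
    refine (degree_sum_le _ _).trans_lt ?_
    rw [Finset.sup_lt_iff (WithBot.bot_lt_coe _)]
    intro i hi
    by_cases h0 : c i = 0
    · rw [h0, zero_mul, degree_zero]; exact WithBot.bot_lt_coe _
    have h := cof_spec ((mem_TT hN).1 (hs hi))
    have h1 := congrArg natDegree h
    have hc0 : cof N i ≠ 0 := by rintro h'; rw [h', mul_zero] at h; exact pow_ne_zero 2 hN h.symm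
    rw [natDegree_mul (pow_ne_zero _ i.1.2.2.ne_zero) hc0, natDegree_pow, natDegree_pow] at h1
    have h2 := ((mem_DD hN).1 hc).2 i
    rw [degree_eq_natDegree h0] at h2
    have h2' : (c i).natDegree < i.1.1.natDegree := by exact_mod_cast h2
    rw [degree_eq_natDegree (mul_ne_zero h0 hc0), natDegree_mul h0 hc0]
    have : (c i).natDegree + (cof N i).natDegree < 2 * N.natDegree := by
      have : i.1.1.natDegree ≤ (2 * i.2 + 1) * i.1.1.natDegree := Nat.le_mul_of_pos_left _ (by omega)
      omega
    exact_mod_cast this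
  exact this _ subset_rfl

lemma L1 {P : Pr Fq} {N t : Fq[X]} {m : ℕ} (hN : P.1 ^ m ∣ N) (h : P.1 ^ (2 * m - 1) ∣ t ^ 2 + N * t) : P.1 ^ m ∣ t := by
  have : ∀ k, k ≤ m → P.1 ^ k ∣ t := by
    intro k
    induction k with
    | zero => intro _; simp
    | succ k ih =>
      intro hk
      obtain ⟨s, rfl⟩ := ih (by omega)
      have h1 : P.1 ^ (2 * k + 1) ∣ (P.1 ^ k * s) ^ 2 + N * (P.1 ^ k * s) := (pow_dvd_pow _ (by omega)).trans h
      have h2 : P.1 ^ (2 * k + 1) ∣ N * (P.1 ^ k * s) := by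
        obtain ⟨N', hN'⟩ := (pow_dvd_pow P.1 (show k + 1 ≤ m by omega)).trans hN
        exact ⟨N' * s, by rw [hN']; ring⟩
      have h3 : P.1 ^ (2 * k + 1) ∣ (P.1 ^ k * s) ^ 2 := (dvd_add_left h2).1 h1
      have h4 : P.1 ^ (2 * k) * P.1 ∣ P.1 ^ (2 * k) * s ^ 2 := by
        have e1 : P.1 ^ (2 * k) * s ^ 2 = (P.1 ^ k * s) ^ 2 := by rw [mul_pow, ← pow_mul, mul_comm k 2]
        rw [e1, ← pow_succ]; exact h3
      have h5 := (mul_dvd_mul_iff_left (pow_ne_zero _ P.2.2.ne_zero)).1 h4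
      rw [pow_succ]
      exact mul_dvd_mul_left _ (P.2.2.prime.dvd_of_dvd_pow h5)
  exact this m le_rfl

lemma Lloc {P : Pr Fq} {N N' : Fq[X]} (hN : N ≠ 0) {j0 m : ℕ} (hm : 1 ≤ m) (he : N = P.1 ^ (j0 + m) * N')
    {c : (Pr Fq × ℕ) →₀ Fq[X]} (hc : ∀ j, j0 < j → c (P, j) = 0) :
    P.1 ^ (2 * m) ∣ WW N c - c (P, j0) * N' ^ 2 * P.1 ^ (2 * m - 1) := by
  have hmem : (P, j0) ∈ TT N := by
    rw [mem_TT hN, he]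
    exact (pow_dvd_pow _ (by dsimp only; omega)).mul_right _
  have hc1 : cof N (P, j0) = N' ^ 2 * P.1 ^ (2 * m - 1) := by
    have h := cof_spec ((mem_TT hN).1 hmem)
    apply mul_left_cancel₀ (pow_ne_zero (2 * j0 + 1) P.2.2.ne_zero)
    rw [show P.1 ^ (2 * j0 + 1) * cof N (P, j0) = N ^ 2 from h, he]
    obtain ⟨n, rfl⟩ : ∃ n, m = n + 1 := ⟨m - 1, by omega⟩
    rw [show 2 * (n + 1) - 1 = 2 * n + 1 by omega]
    ring
  rw [WW, ← Finset.add_sum_erase _ _ hmem, hc1, mul_assoc, add_sub_cancel_left]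
  apply Finset.dvd_sum
  rintro ⟨Q, l⟩ hi
  rw [Finset.mem_erase] at hi
  obtain ⟨hne, hi⟩ := hi
  have h := cof_spec ((mem_TT hN).1 hi)
  dsimp only at h
  by_cases hQ : Q = P
  · subst hQ
    rcases lt_trichotomy l j0 with hl | hl | hl
    · apply Dvd.dvd.mul_left
      rw [← mul_dvd_mul_iff_left (pow_ne_zero (2 * l + 1) Q.2.2.ne_zero), h, ← pow_add, he, mul_pow, ← pow_mul]
      exact (pow_dvd_pow _ (by omega)).mul_right _
    · subst hl; exact absurd rfl hne
    · rw [hc _ hl, zero_mul]; exact dvd_zero _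
  · apply Dvd.dvd.mul_left
    have hcop : IsCoprime (P.1 ^ (2 * m)) (Q.1 ^ (2 * l + 1)) := (Pr_coprime (Ne.symm hQ)).pow
    apply hcop.dvd_of_dvd_mul_left
    rw [h, he, mul_pow, ← pow_mul]
    exact (pow_dvd_pow _ (by omega)).mul_right _

lemma exists_mult (P : Pr Fq) {N : Fq[X]} (hN : N ≠ 0) : ∃ e N', N = P.1 ^ e * N' ∧ ¬ P.1 ∣ N' ∧ ∀ k, P.1 ^ k ∣ N ↔ k ≤ e := by
  obtain ⟨N', h1, h2⟩ := FiniteMultiplicity.exists_eq_pow_mul_and_not_dvd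
    (FiniteMultiplicity.of_prime_left P.2.2.prime hN)
  exact ⟨_, N', h1, h2, fun k => (FiniteMultiplicity.of_prime_left P.2.2.prime hN).pow_dvd_iff_le_multiplicity⟩

lemma Lzero {P : Pr Fq} {a N' : Fq[X]} {k : ℕ} (hN' : ¬ P.1 ∣ N') (ha : a.degree < P.1.natDegree)
    (h : P.1 ^ (k + 1) ∣ a * N' ^ 2 * P.1 ^ k) : a = 0 := by
  rw [pow_succ', mul_dvd_mul_iff_right (pow_ne_zero _ P.2.2.ne_zero)] at h
  have h1 : P.1 ∣ a := by
    rcases P.2.2.prime.dvd_or_dvd h with h | h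
    · exact h
    · exact absurd (P.2.2.prime.dvd_of_dvd_pow h) hN'
  exact eq_zero_of_dvd_of_degree_lt h1 (by rwa [degree_eq_natDegree P.2.2.ne_zero])

lemma KV {N G t : Fq[X]} (hN : N ≠ 0) {c : (Pr Fq × ℕ) →₀ Fq[X]} (hc : c ∈ DD N)
    (h : WW N c = N ^ 2 * G + (t ^ 2 + N * t)) : c = 0 := by
  by_contra hne
  obtain ⟨⟨P, j⟩, hj⟩ := Finsupp.ne_iff.1 hne
  have hD := (mem_DD hN).1 hc
  set T := c.support.filter (fun i => i.1 = P) with hT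
  have hjT : (P, j) ∈ T := by simp [hT]; simpa using hj
  obtain ⟨⟨P', j0⟩, hi0, hmax⟩ := Finset.exists_max_image T (fun i => i.2) ⟨_, hjT⟩
  simp only [hT, Finset.mem_filter, Finsupp.mem_support_iff] at hi0
  obtain ⟨hi0, rfl⟩ := hi0
  have hvan : ∀ j, j0 < j → c (P', j) = 0 := by
    intro j hj
    by_contra h0
    have := hmax (P', j) (by simp only [hT, Finset.mem_filter, Finsupp.mem_support_iff]; exact ⟨h0, trivial⟩)
    dsimp only at this
    omega
  obtain ⟨e, N', he, hN', hdv⟩ := exists_mult P' hN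
  have h7 : P'.1 ^ (j0 + 1) ∣ N := hD.1 (P', j0) hi0
  have hje : j0 + 1 ≤ e := (hdv _).1 h7
  obtain ⟨m, rfl⟩ : ∃ m, e = j0 + (m + 1) := ⟨e - j0 - 1, by omega⟩
  have hl := Lloc (P := P') (N := N) (N' := N') (j0 := j0) (m := m + 1) (c := c) hN (by omega) he hvan
  have hk : 2 * (m + 1) - 1 = 2 * m + 1 := by omega
  rw [hk] at hl
  have hPm : P'.1 ^ (m + 1) ∣ N := (hdv _).2 (by omega)
  have hN2 : P'.1 ^ (2 * (m + 1)) ∣ N ^ 2 := by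
    have := pow_dvd_pow_of_dvd hPm 2
    rwa [← pow_mul, mul_comm] at this
  have hW1 : P'.1 ^ (2 * m + 1) ∣ WW N c := by
    have h1 := (pow_dvd_pow P'.1 (show 2 * m + 1 ≤ 2 * (m + 1) by omega)).trans hl
    exact (dvd_sub_left (dvd_mul_left _ _)).1 h1
  have ht : P'.1 ^ (2 * (m + 1) - 1) ∣ t ^ 2 + N * t := by
    rw [hk]
    rw [h] at hW1
    exact (dvd_add_right (((pow_dvd_pow P'.1 (show 2 * m + 1 ≤ 2 * (m + 1) by omega)).trans hN2).mul_right _)).1 hW1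
  have ht' := L1 hPm ht
  have ht2 : P'.1 ^ (2 * (m + 1)) ∣ t ^ 2 + N * t := by
    rw [show 2 * (m + 1) = (m + 1) + (m + 1) by ring, pow_add]
    apply dvd_add
    · rw [sq]; exact mul_dvd_mul ht' ht'
    · exact mul_dvd_mul hPm ht'
  have hW2 : P'.1 ^ (2 * (m + 1)) ∣ WW N c := by
    rw [h]; exact dvd_add (hN2.mul_right _) ht2
  have h3 := (dvd_sub_right hW2).1 hl
  have hd : (c (P', j0)).degree < P'.1.natDegree := hD.2 (P', j0)
  rw [show 2 * (m + 1) = (2 * m + 1) + 1 by ring] at h3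
  exact hi0 (Lzero (k := 2 * m + 1) hN' hd h3)

/-- the leading coefficients are all nonzero -/
def Full (N : Fq[X]) (c : (Pr Fq × ℕ) →₀ Fq[X]) : Prop :=
  ∀ (P : Pr Fq) (j : ℕ), P.1 ^ (j + 1) ∣ N → ¬ P.1 ^ (j + 2) ∣ N → c (P, j) ≠ 0

lemma smooth_iff_full {N G t : Fq[X]} (hN : N ≠ 0) {c : (Pr Fq × ℕ) →₀ Fq[X]} (hc : c ∈ DD N) :
    Smooth N (WW N c + N ^ 2 * G + (t ^ 2 + N * t)) ↔ Full N c := by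
  rw [smooth_shift]
  have hD := (mem_DD hN).1 hc
  have key : ∀ (P : Pr Fq) (j : ℕ), P.1 ^ (j + 1) ∣ N → ¬ P.1 ^ (j + 2) ∣ N → 
      (bad N (WW N c + N ^ 2 * G) P.1 ↔ c (P, j) = 0) := by
    intro P j h1 h2
    obtain ⟨e, N', he, hN', hdv⟩ := exists_mult P hN
    rw [hdv] at h1 h2
    obtain rfl : e = j + 1 := by omega
    have hl := Lloc (P := P) (N := N) (N' := N') (j0 := j) (m := 1) (c := c) hN le_rfl he (by
      intro k hk
      by_contra h0
      have h7 : P.1 ^ (k + 1) ∣ N := hD.1 (P, k) h0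
      have := (hdv _).1 h7
      omega)
    simp only [mul_one, Nat.add_one_sub_one, Nat.reduceSub, pow_one] at hl
    have hP : P.1 ∣ N := by simpa using (hdv 1).2 (by omega)
    have hN2 : P.1 ^ 2 ∣ N ^ 2 := pow_dvd_pow_of_dvd hP 2
    constructor
    · rintro ⟨t, ht⟩
      have hPW : P.1 ∣ WW N c := 
        (dvd_sub_left (dvd_mul_left _ _)).1 ((dvd_pow_self P.1 (by norm_num)).trans hl)
      have hPt : P.1 ∣ t := by
        have h3 : P.1 ∣ WW N c + N ^ 2 * G + t ^ 2 + N * t := (dvd_pow_self P.1 (by norm_num)).trans ht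
        have h4 : P.1 ∣ WW N c + N ^ 2 * G + N * t :=
          dvd_add (dvd_add hPW (((dvd_pow_self P.1 (by norm_num)).trans hN2).mul_right _)) (hP.mul_right _)
        have h5 : P.1 ∣ t ^ 2 := by
          have := dvd_sub h3 h4
          convert this using 1; ring
        exact P.2.2.prime.dvd_of_dvd_pow h5
      have hW2 : P.1 ^ 2 ∣ WW N c := by
        have h6 : P.1 ^ 2 ∣ N ^ 2 * G + t ^ 2 + N * t := by
          refine dvd_add (dvd_add (hN2.mul_right _) (pow_dvd_pow_of_dvd hPt 2)) ?_
          rw [sq]; exact mul_dvd_mul hP hPt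
        have := dvd_sub ht h6
        convert this using 1; ring
      have h3 := (dvd_sub_right hW2).1 hl
      have hd : (c (P, j)).degree < P.1.natDegree := hD.2 (P, j)
      apply Lzero (k := 1) hN' hd
      rw [pow_one]; exact h3
    · intro h0
      rw [h0] at hl
      refine ⟨0, ?_⟩
      simp only [zero_mul, sub_zero] at hl
      have := dvd_add hl (hN2.mul_right G)
      convert this using 1; ring
  constructor
  · intro h P j h1 h2 h0
    exact h P ((dvd_pow_self _ (by omega)).trans h1) ((key P j h1 h2).2 h0)
  · intro h P hP hb
    obtain ⟨e, N', he, hN', hdv⟩ := exists_mult P hN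
    have h1 : 1 ≤ e := (hdv 1).1 (by simpa using hP)
    have h2 : P.1 ^ (e - 1 + 1) ∣ N := (hdv _).2 (by omega)
    have h3 : ¬ P.1 ^ (e - 1 + 2) ∣ N := fun h => by have := (hdv _).1 h; omega
    exact h P _ h2 h3 ((key P _ h2 h3).1 hb)

/-- `N` is determined by a full coefficient vector. -/
lemma Full_unique {N N' : Fq[X]} (hN : N.Monic) (hN' : N'.Monic) {c : (Pr Fq × ℕ) →₀ Fq[X]}
    (hc : c ∈ DD N) (hc' : c ∈ DD N') (hf : Full N c) (hf' : Full N' c) : N = N' := by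
  have key : ∀ N N' : Fq[X], N.Monic → N'.Monic → c ∈ DD N → c ∈ DD N' → Full N c → 
      ∀ P : Pr Fq, ∀ k, P.1 ^ k ∣ N → P.1 ^ k ∣ N' := by
    intro N N' hN hN' hc hc' hf P k hk
    obtain ⟨e, N1, he, _, hdv⟩ := exists_mult P hN.ne_zero
    have hke := (hdv _).1 hk
    rcases Nat.eq_zero_or_pos e with rfl | he0
    · have : k = 0 := by omega
      subst this; simp
    · have h := hf P (e - 1) ((hdv _).2 (by omega)) (fun h => by have := (hdv _).1 h; omega)
      have := ((mem_DD hN'.ne_zero).1 hc').1 _ h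
      exact (pow_dvd_pow _ (by dsimp only; omega)).trans this
  have dvd_of : ∀ N N' : Fq[X], N ≠ 0 → N' ≠ 0 → (∀ P : Pr Fq, ∀ k, P.1 ^ k ∣ N → P.1 ^ k ∣ N') → N ∣ N' := by
    intro N N' hN hN' h
    rw [UniqueFactorizationMonoid.dvd_iff_emultiplicity_le hN]
    intro p hp
    obtain ⟨Q, hQ⟩ := exists_Pr hp.irreducible
    rw [emultiplicity_eq_of_associated_left hQ.symm, emultiplicity_eq_of_associated_left hQ.symm]
    rw [emultiplicity_le_emultiplicity_iff]
    exact fun n => h Q n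
  exact eq_of_monic_of_associated hN hN' (associated_of_dvd_dvd
    (dvd_of _ _ hN.ne_zero hN'.ne_zero (key _ _ hN hN' hc hc' hf)) (dvd_of _ _ hN'.ne_zero hN.ne_zero (key _ _ hN' hN hc' hc hf')))

end Helpers5b
end EvenChar

set_option linter.unusedSectionVars false
set_option linter.unusedVariables false
namespace EvenChar
section Helpers5c
open scoped Classical
variable {Fq : Type} [Field Fq] [Fintype Fq] [CharP Fq 2]

lemma sum_Icc_range {M : Type*} [AddCommMonoid M] (n : ℕ) (f : ℕ → M) : ∑ i ∈ Finset.Icc 1 n, f i = ∑ j ∈ Finset.range n, f (j + 1) := by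
  induction n with
  | zero => simp
  | succ n ih => rw [Finset.sum_Icc_succ_top (by omega), ih, Finset.sum_range_succ]

lemma pow_dvd_prod {S : Finset (Pr Fq)} {e : Pr Fq → ℕ} {P : Pr Fq} {k : ℕ} :
    P.1 ^ (k + 1) ∣ ∏ Q ∈ S, Q.1 ^ (e Q) ↔ P ∈ S ∧ k < e P := by
  by_cases hP : P ∈ S
  · have hcop : ¬ P.1 ∣ ∏ Q ∈ S.erase P, Q.1 ^ (e Q) := by
      rw [← P.2.2.coprime_iff_not_dvd]
      apply IsCoprime.prod_right
      intro Q hQ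
      exact (Pr_coprime (Finset.ne_of_mem_erase hQ).symm).pow_right
    rw [← Finset.mul_prod_erase _ _ hP]
    simp only [hP, true_and]
    constructor
    · intro h
      by_contra hk
      have h1 : P.1 ^ (e P) * P.1 ∣ P.1 ^ (e P) * ∏ Q ∈ S.erase P, Q.1 ^ (e Q) := by
        rw [← pow_succ]
        exact (pow_dvd_pow _ (by omega)).trans h
      exact hcop ((mul_dvd_mul_iff_left (pow_ne_zero _ P.2.2.ne_zero)).1 h1)
    · intro h
      exact (pow_dvd_pow _ (by omega)).mul_right _
  · simp only [hP, false_and, iff_false]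
    intro h
    have h1 : P.1 ∣ ∏ Q ∈ S, Q.1 ^ (e Q) := (dvd_pow_self _ (by omega)).trans h
    have hcop : IsCoprime P.1 (∏ Q ∈ S, Q.1 ^ (e Q)) := by
      apply IsCoprime.prod_right
      intro Q hQ
      refine (Pr_coprime ?_).pow_right
      rintro rfl
      exact hP hQ
    exact (P.2.2.coprime_iff_not_dvd.1 hcop) h1

lemma vv_TT {N : Fq[X]} (hN : N ≠ 0) {c : (Pr Fq × ℕ) →₀ Fq[X]} (hc : c ∈ DD N) :
    vv c = ∑ i ∈ TT N, algebraMap Fq[X] (RatFunc Fq) (c i) / algebraMap Fq[X] (RatFunc Fq) i.1.1 ^ (2 * i.2 + 1) := by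
  have hsub : c.support ⊆ TT N := fun i hi => (mem_TT hN).2 (((mem_DD hN).1 hc).1 i (Finsupp.mem_support_iff.1 hi))
  rw [vv, Finsupp.sum_of_support_subset _ hsub _ (by simp)]

lemma Ffam_iff (n : ℕ) (u : RatFunc Fq) : u ∈ Ffam Fq n ↔ ∃ N ∈ Mon Fq n, ∃ c ∈ DD N, Full N c ∧ u = vv c := by
  constructor
  · rintro ⟨S, e, a, hS, he, ha, ha0, hn, rfl⟩
    set S' : Finset (Pr Fq) := S.subtype (fun P => P.Monic ∧ Irreducible P) with hS'
    have hmS : ∀ P : Pr Fq, P ∈ S' ↔ P.1 ∈ S := fun P => by rw [hS', Finset.mem_subtype]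
    have hsum : ∀ {M : Type} [AddCommMonoid M] (f : Fq[X] → M), ∑ P ∈ S, f P = ∑ P ∈ S', f P.1 := by
      intro M _ f
      exact (Finset.sum_subtype_of_mem f hS).symm
    set N : Fq[X] := ∏ P ∈ S', P.1 ^ (e P.1) with hN
    have hNm : N.Monic := monic_prod_of_monic _ _ fun P _ => P.2.1.pow _
    have hTT : ∀ i : Pr Fq × ℕ, i ∈ TT N ↔ i.1 ∈ S' ∧ i.2 ∈ Finset.range (e i.1.1) := by
      intro i
      rw [mem_TT hNm.ne_zero, hN, pow_dvd_prod (e := fun P => e P.1), Finset.mem_range]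
    set c : (Pr Fq × ℕ) →₀ Fq[X] := Finsupp.onFinset (TT N) (fun i => if i ∈ TT N then a i.1.1 (i.2 + 1) else 0)
      (fun i hi => by by_contra h; simp [h] at hi) with hc
    have hcv : ∀ i ∈ TT N, c i = a i.1.1 (i.2 + 1) := by
      intro i hi; rw [hc, Finsupp.onFinset_apply, if_pos hi]
    have hcv0 : ∀ i, i ∉ TT N → c i = 0 := by
      intro i hi; rw [hc, Finsupp.onFinset_apply, if_neg hi]
    have hcD : c ∈ DD N := by
      rw [mem_DD hNm.ne_zero]
      refine ⟨fun i hi => ?_, fun i => ?_⟩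
      · rw [← mem_TT hNm.ne_zero]; by_contra h; exact hi (hcv0 i h)
      · by_cases hi : i ∈ TT N
        · rw [hcv i hi, ← degree_eq_natDegree i.1.2.2.ne_zero]
          have := (hTT i).1 hi
          rw [Finset.mem_range] at this
          exact ha _ ((hmS _).1 this.1) _ (by omega) (by omega)
        · rw [hcv0 i hi, degree_zero]; exact WithBot.bot_lt_coe _
    refine ⟨N, ?_, c, hcD, ?_, ?_⟩
    · rw [mem_Mon]
      refine ⟨hNm, ?_⟩
      rw [hN, natDegree_prod_of_monic _ _ (fun P _ => P.2.1.pow _), ← hn, hsum]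
      refine Finset.sum_congr rfl fun P _ => ?_
      rw [natDegree_pow]
    · intro P j h1 h2
      have hi : (P, j) ∈ TT N := (mem_TT hNm.ne_zero).2 h1
      rw [hcv _ hi]
      rw [hN, pow_dvd_prod (e := fun P => e P.1)] at h1 h2
      have : j + 1 = e P.1 := by
        have := h1.1
        simp only [this, true_and] at h2
        omega
      dsimp only
      rw [this]
      exact ha0 _ ((hmS _).1 h1.1)
    · rw [vv_TT hNm.ne_zero hcD, Finset.sum_finset_product (TT N) S' (fun P => Finset.range (e P.1)) hTT, hsum]
      refine Finset.sum_congr rfl fun P hP => ?_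
      rw [sum_Icc_range]
      refine Finset.sum_congr rfl fun j hj => ?_
      rw [hcv (P, j) ((hTT _).2 ⟨hP, hj⟩)]
      congr 2
  · rintro ⟨N, hNM, c, hc, hf, rfl⟩
    obtain ⟨hNm, hn⟩ := mem_Mon.1 hNM
    choose! e N' hN' hcop hdv using fun P : Pr Fq => exists_mult P hNm.ne_zero
    set e' : Fq[X] → ℕ := fun P => if h : P.Monic ∧ Irreducible P then e ⟨P, h⟩ else 0 with he'
    have hee : ∀ P : Pr Fq, e' P.1 = e P := fun P => by rw [he']; exact dif_pos P.2
    set a : Fq[X] → ℕ → Fq[X] := fun P i => if h : P.Monic ∧ Irreducible P then c (⟨P, h⟩, i - 1) else 0 with ha'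
    have hae : ∀ (P : Pr Fq) i, a P.1 i = c (P, i - 1) := fun P i => by rw [ha']; exact dif_pos P.2
    have hTT : ∀ i : Pr Fq × ℕ, i ∈ TT N ↔ i.1 ∈ pf N ∧ i.2 ∈ Finset.range (e i.1) := by
      intro i
      rw [mem_TT hNm.ne_zero, hdv, Finset.mem_range, mem_pf hNm.ne_zero]
      constructor
      · intro h
        refine ⟨?_, h⟩
        have := (hdv i.1 1).2 (by omega)
        simpa using this
      · exact fun h => h.2
    have hpos : ∀ P ∈ pf N, 1 ≤ e P := by
      intro P hP
      rw [mem_pf hNm.ne_zero] at hP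
      exact (hdv P 1).1 (by simpa using hP)
    have hinj : Set.InjOn (Subtype.val : Pr Fq → Fq[X]) (pf N) := Subtype.val_injective.injOn
    refine ⟨(pf N).image Subtype.val, e', a, ?_, ?_, ?_, ?_, ?_, ?_⟩
    · simp only [Finset.mem_image]
      rintro _ ⟨P, _, rfl⟩
      exact P.2
    · simp only [Finset.mem_image]
      rintro _ ⟨P, hP, rfl⟩
      rw [hee]; exact hpos P hP
    · simp only [Finset.mem_image]
      rintro _ ⟨P, hP, rfl⟩ i _ _
      rw [hae, degree_eq_natDegree P.2.2.ne_zero]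
      exact ((mem_DD hNm.ne_zero).1 hc).2 (P, i - 1)
    · simp only [Finset.mem_image]
      rintro _ ⟨P, hP, rfl⟩
      rw [hae, hee]
      have := hpos P hP
      refine hf P _ ((hdv _ _).2 (by omega)) (fun h => ?_)
      have := (hdv _ _).1 h
      omega
    · rw [Finset.sum_image hinj, ← hn, ← sum_TT N hNm.ne_zero, Finset.sum_finset_product (TT N) (pf N) (fun P => Finset.range (e P)) hTT]
      refine Finset.sum_congr rfl fun P _ => ?_
      dsimp only
      rw [hee, Finset.sum_const, Finset.card_range, smul_eq_mul]
    · rw [Finset.sum_image hinj, vv_TT hNm.ne_zero hc, Finset.sum_finset_product (TT N) (pf N) (fun P => Finset.range (e P)) hTT]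
      refine Finset.sum_congr rfl fun P _ => ?_
      rw [sum_Icc_range, hee]
      refine Finset.sum_congr rfl fun j _ => ?_
      rw [hae]
      congr 2

/-- polynomial part -/
def GG (α : Fq) (p : Fq[X]) : Fq[X] := C α + X * expand Fq 2 p

lemma Gfam_iff (ξ : Fq) (s : ℕ) (G : Fq[X]) : G ∈ Gfam ξ (s + 1) ↔
    ∃ α ∈ ({0, ξ} : Finset Fq), ∃ p ∈ LD (Finset.univ \ {0}) s, G = GG α p := by
  have key : ∀ c : ℕ → Fq, ∑ i ∈ Finset.Icc 1 (s + 1), Polynomial.C (c i) * Polynomial.X ^ (2 * i - 1) = 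
      X * expand Fq 2 (∑ i ∈ Finset.range (s + 1), C (c (i + 1)) * X ^ i) := by
    intro c
    rw [sum_Icc_range, map_sum, Finset.mul_sum]
    refine Finset.sum_congr rfl fun i _ => ?_
    rw [map_mul, expand_C, map_pow, expand_X, show 2 * (i + 1) - 1 = 2 * i + 1 by omega]
    ring
  constructor
  · rintro ⟨α, c, hα, hc, rfl⟩
    refine ⟨α, by simpa using hα, ∑ i ∈ Finset.range (s + 1), C (c (i + 1)) * X ^ i, ?_, ?_⟩
    · rw [mem_LD]
      refine ⟨?_, ?_⟩
      · rw [← Polynomial.mem_degreeLT]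
        refine Submodule.sum_mem _ fun i hi => ?_
        rw [Polynomial.mem_degreeLT]
        refine (degree_C_mul_X_pow_le _ _).trans_lt ?_
        exact_mod_cast Finset.mem_range.1 hi
      · rw [finsetSum_coeff]
        simp only [coeff_C_mul, coeff_X_pow]
        simpa using hc
    · rw [key]; rfl
  · rintro ⟨α, hα, p, hp, rfl⟩
    rw [mem_LD] at hp
    refine ⟨α, fun i => p.coeff (i - 1), by simpa using hα, by simpa using hp.2, ?_⟩
    rw [key]
    unfold GG
    congr 3
    simp only [Nat.add_sub_cancel]
    by_cases hp0 : p = 0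
    · rw [hp0]; simp
    · exact as_sum_range_C_mul_X_pow' p (by
        have := hp.1
        rw [degree_eq_natDegree hp0] at this
        exact_mod_cast this)

lemma GG_inj {α α' : Fq} {p p' : Fq[X]} (h : GG α p = GG α' p') : α = α' ∧ p = p' := by
  have h0 : α = α' := by
    have := congrArg (fun f => coeff f 0) h
    simpa [GG] using this
  subst h0
  refine ⟨rfl, ?_⟩
  unfold GG at h
  have h1 := mul_left_cancel₀ X_ne_zero (add_left_cancel h)
  exact expand_injective (by norm_num) h1

lemma GG_sub (α α' : Fq) (p p' : Fq[X]) : GG (α - α') (p - p') = GG α p - GG α' p' := by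
  unfold GG; simp only [map_sub]; ring

lemma u_inj {N N' G G' : Fq[X]} (hN : N.Monic) (hN' : N'.Monic) {c c' : (Pr Fq × ℕ) →₀ Fq[X]}
    (hc : c ∈ DD N) (hc' : c' ∈ DD N') (hf : Full N c) (hf' : Full N' c')
    (h : vv c + algebraMap Fq[X] (RatFunc Fq) G = vv c' + algebraMap Fq[X] (RatFunc Fq) G') :
    N = N' ∧ c = c' ∧ G = G' := by
  have hM : N * N' ≠ 0 := (hN.mul hN').ne_zero
  have h1 := DD_mono hN.ne_zero hM (dvd_mul_right N N') hc
  have h2 := DD_mono hN'.ne_zero hM (dvd_mul_left N' N) hc'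
  have h3 := DD_sub hM h1 h2
  have h4 := WW_vv hM h3
  have h5 : c - c' = 0 := by
    apply KV (G := G' - G) (t := 0) hM h3
    apply RatFunc.algebraMap_injective Fq
    rw [h4, vv_sub]
    simp only [map_add, map_mul, map_sub, map_pow, map_zero]
    linear_combination (algebraMap Fq[X] (RatFunc Fq) N * algebraMap Fq[X] (RatFunc Fq) N') ^ 2 * h
  have h6 : c = c' := sub_eq_zero.1 h5
  subst h6
  exact ⟨Full_unique hN hN' hc hc' hf hf', rfl, RatFunc.algebraMap_injective Fq (add_left_cancel h)⟩

end Helpers5c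
end EvenChar

set_option linter.unusedSectionVars false
set_option linter.unusedVariables false
namespace EvenChar
section Helpers5d
open scoped Classical
variable {Fq : Type} [Field Fq] [Fintype Fq] [CharP Fq 2]

lemma dvd_of_sq_dvd {N t : Fq[X]} (hN : N ≠ 0) (h : N ^ 2 ∣ t ^ 2 + N * t) : N ∣ t := by
  rw [UniqueFactorizationMonoid.dvd_iff_emultiplicity_le hN]
  intro p hp
  obtain ⟨Q, hQ⟩ := exists_Pr hp.irreducible
  rw [emultiplicity_eq_of_associated_left hQ.symm, emultiplicity_eq_of_associated_left hQ.symm]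
  rw [emultiplicity_le_emultiplicity_iff]
  intro n hn
  refine L1 hn (Dvd.dvd.trans ?_ h)
  have := pow_dvd_pow_of_dvd hn 2
  rw [← pow_mul] at this
  exact (pow_dvd_pow _ (by omega)).trans this

lemma nd_le {f : Fq[X]} {n : ℕ} (h : f.degree < (n + 1 : ℕ)) : f.natDegree ≤ n := by
  by_cases h0 : f = 0
  · rw [h0]; simp
  · rw [degree_eq_natDegree h0] at h
    have h' : f.natDegree < n + 1 := by exact_mod_cast h
    omega

lemma neg_eq2 (x : Fq[X]) : -x = x := by linear_combination -x * (two0 (Fq := Fq))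
lemma sub_eq2 (x y : Fq[X]) : x - y = x + y := by linear_combination -y * (two0 (Fq := Fq))

/-- the Artin-Schreier parametrised equation -/
def EE (N : Fq[X]) (c : (Pr Fq × ℕ) →₀ Fq[X]) (G t : Fq[X]) : Fq[X] := WW N c + N ^ 2 * G + (t ^ 2 + N * t)

lemma EE_eq {N G G' t t' : Fq[X]} (hN : N ≠ 0) {c c' : (Pr Fq × ℕ) →₀ Fq[X]} (hc : c ∈ DD N) (hc' : c' ∈ DD N)
    (h : EE N c G t = EE N c' G' t') : c = c' ∧ ∃ σ, t' = t + N * σ ∧ G - G' = σ ^ 2 + σ := by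
  unfold EE at h
  have h1 : c - c' = 0 := by
    apply KV (G := G - G') (t := t - t') hN (DD_sub hN hc hc')
    rw [WW_sub]
    linear_combination h + (- N ^ 2 * (G - G') - N * (t - t') - t ^ 2 + t * t') * (two0 (Fq := Fq))
  have h1 := sub_eq_zero.1 h1
  subst h1
  refine ⟨rfl, ?_⟩
  have h2 : (t' - t) ^ 2 + N * (t' - t) = N ^ 2 * (G - G') := by
    linear_combination -h + (t ^ 2 - t * t' ) * (two0 (Fq := Fq))
  obtain ⟨σ, hσ⟩ := dvd_of_sq_dvd hN (Dvd.intro _ h2.symm)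
  refine ⟨σ, by rw [← hσ]; ring, ?_⟩
  rw [hσ] at h2
  apply mul_left_cancel₀ (pow_ne_zero 2 hN)
  rw [← h2]; ring

lemma GG_AS {α : Fq} {p σ : Fq[X]} (h : GG α p = σ ^ 2 + σ) : ∃ x : Fq, σ = C x ∧ α = x ^ 2 + x ∧ p = 0 := by
  have hd : σ.natDegree = 0 := by
    by_contra hd
    obtain ⟨d, hd⟩ : ∃ d, σ.natDegree = d + 1 := ⟨σ.natDegree - 1, by omega⟩
    have h1 := congrArg (fun f => coeff f (2 * (d + 1))) h
    simp only [GG, coeff_add] at h1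
    rw [coeff_pow_of_natDegree_le hd.le, coeff_C, if_neg (by omega), show 2 * (d + 1) = (2 * d + 1) + 1 by ring,
      coeff_X_mul, coeff_expand (by norm_num), if_neg (by omega), coeff_eq_zero_of_natDegree_lt (p := σ) (n := 2 * d + 1 + 1) (by omega), ← hd,
      coeff_natDegree] at h1
    have h2 : σ.leadingCoeff = 0 := by
      have : σ.leadingCoeff ^ 2 = 0 := by simpa using h1.symm
      exact pow_eq_zero_iff (by norm_num) |>.1 this
    rw [leadingCoeff_eq_zero] at h2
    rw [h2] at hd; simp at hd
  obtain ⟨x, hx⟩ := natDegree_eq_zero.1 hd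
  refine ⟨x, hx.symm, ?_⟩
  subst hx
  have h3 : GG α p = GG (x ^ 2 + x) 0 := by rw [h]; simp [GG]
  exact GG_inj h3

lemma EE_mem_R {g : ℕ} {N : Fq[X]} (hN : N.Monic) (hr : N.natDegree ≤ g) {c : (Pr Fq × ℕ) →₀ Fq[X]} (hc : c ∈ DD N)
    (α : Fq) {p t : Fq[X]} (hp : p ∈ PLT Fq (g - N.natDegree + 1)) (ht : t ∈ PLT Fq (g + 1)) :
    EE N c (GG α p) t ∈ PLT Fq (2 * g + 2) ∧ (EE N c (GG α p) t).coeff (2 * g + 1) = p.coeff (g - N.natDegree) := by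
  rw [mem_PLT] at hp ht
  have nd : ∀ {f : Fq[X]} {n : ℕ}, f.degree < (n + 1 : ℕ) → f.natDegree ≤ n := by
    intro f n h
    exact nd_le h
  have hp' : p.natDegree ≤ g - N.natDegree := nd hp
  have ht' : t.natDegree ≤ g := nd ht
  have e : EE N c (GG α p) t = (WW N c + N ^ 2 * C α + (t ^ 2 + N * t)) + N ^ 2 * X * expand Fq 2 p := by
    unfold EE GG; ring
  have h1 : (WW N c).natDegree ≤ 2 * g := by
    have := (WW_degree hN.ne_zero hc).le
    exact (natDegree_le_of_degree_le this).trans (by omega)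
  have h2 : (N ^ 2 * C α).natDegree ≤ 2 * g := (natDegree_mul_C_le _ _).trans (by rw [natDegree_pow]; omega)
  have h3 : (t ^ 2).natDegree ≤ 2 * g := by rw [natDegree_pow]; omega
  have h4 : (N * t).natDegree ≤ 2 * g := natDegree_mul_le.trans (by omega)
  have h5 : (WW N c + N ^ 2 * C α + (t ^ 2 + N * t)).natDegree ≤ 2 * g :=
    natDegree_add_le_of_degree_le (natDegree_add_le_of_degree_le h1 h2) (natDegree_add_le_of_degree_le h3 h4)
  have h6 : (N ^ 2 * X).natDegree ≤ 2 * N.natDegree + 1 := by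
    refine natDegree_mul_le.trans ?_
    rw [natDegree_pow, natDegree_X]
  have h7 : (expand Fq 2 p).natDegree ≤ 2 * (g - N.natDegree) := by
    rw [natDegree_expand]; omega
  have e2 : 2 * g + 1 = (2 * N.natDegree + 1) + 2 * (g - N.natDegree) := by omega
  have h8 : (N ^ 2 * X * expand Fq 2 p).natDegree ≤ 2 * g + 1 := natDegree_mul_le.trans (by omega)
  constructor
  · rw [mem_PLT, e]
    have h9 : (WW N c + N ^ 2 * C α + (t ^ 2 + N * t) + N ^ 2 * X * expand Fq 2 p).natDegree ≤ 2 * g + 1 :=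
      natDegree_add_le_of_degree_le (by omega) h8
    refine (degree_le_of_natDegree_le h9).trans_lt ?_
    exact_mod_cast Nat.lt_succ_self _
  · rw [e, coeff_add, coeff_eq_zero_of_natDegree_lt (by omega), zero_add, e2, coeff_mul_add_eq_of_natDegree_le h6 h7,
      coeff_mul_X, mul_comm 2 (g - N.natDegree), coeff_expand_mul (by norm_num)]
    have : (N ^ 2).coeff (2 * N.natDegree) = 1 := by
      rw [coeff_pow_of_natDegree_le le_rfl, hN.coeff_natDegree, one_pow]
    rw [this, one_mul]

lemma count_R {g : ℕ} {ξ : Fq} (hξ : ∀ x : Fq, x ^ 2 + x ≠ ξ) {N : Fq[X]} (hN : N.Monic) (hr : N.natDegree ≤ g) (F : Fq[X] → ℕ) :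
    ∑ x ∈ DD N ×ˢ (({0, ξ} : Finset Fq) ×ˢ (PLT Fq (g - N.natDegree + 1) ×ˢ PLT Fq (g + 1))), F (EE N x.1 (GG x.2.1 x.2.2.1) x.2.2.2)
      = 2 * ∑ E ∈ PLT Fq (2 * g + 2), F E := by
  have hξ0 : (0 : Fq) ≠ ξ := by have := hξ 0; simpa using this
  apply fiber_count _ _ (fun x : ((Pr Fq × ℕ) →₀ Fq[X]) × Fq × Fq[X] × Fq[X] => EE N x.1 (GG x.2.1 x.2.2.1) x.2.2.2)
  · intro x hx
    simp only [Finset.mem_product] at hx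
    exact (EE_mem_R hN hr hx.1 _ hx.2.2.1 hx.2.2.2).1
  · intro b hb u hus hub
    by_cases hne : u.Nonempty
    · obtain ⟨x, hx⟩ := hne
      have hxb := hub x hx
      replace hx := hus hx
      simp only [Finset.mem_product] at hx
      refine (Finset.card_le_card (t := {x, (x.1, x.2.1, x.2.2.1, x.2.2.2 + N)}) ?_).trans Finset.card_le_two
      intro y hy
      have hyb := hub y hy
      replace hy := hus hy
      simp only [Finset.mem_product] at hy
      obtain ⟨h1, σ, h2, h3⟩ := EE_eq hN.ne_zero hx.1 hy.1 (hxb.trans hyb.symm)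
      rw [← GG_sub] at h3
      obtain ⟨z, h4, h5, h6⟩ := GG_AS h3
      have h7 : x.2.1 = y.2.1 := by
        have ha := hx.2.1
        have hb := hy.2.1
        simp only [Finset.mem_insert, Finset.mem_singleton] at ha hb
        rcases ha with ha | ha <;> rcases hb with hb | hb <;> rw [ha, hb] at h5 ⊢
        · exfalso; apply hξ z; rw [← h5]; 
          have h2 : (2 : Fq) = 0 := CharTwo.two_eq_zero
          linear_combination -ξ * h2
        · exfalso; apply hξ z; rw [← h5]; ring
      rw [h7, sub_self] at h5
      have h8 : z = 0 ∨ z = 1 := by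
        have h2 : (2 : Fq) = 0 := CharTwo.two_eq_zero
        have : z * (z - 1) = 0 := by linear_combination -h5 - z * h2
        rcases mul_eq_zero.1 this with h | h
        · exact Or.inl h
        · exact Or.inr (sub_eq_zero.1 h)
      have h9 := sub_eq_zero.1 h6
      rw [Finset.mem_insert, Finset.mem_singleton]
      rcases h8 with rfl | rfl
      · left
        rw [h4, C_0, mul_zero, add_zero] at h2
        exact Prod.ext h1.symm (Prod.ext h7.symm (Prod.ext h9.symm h2))
      · right
        rw [h4, C_1, mul_one] at h2
        exact Prod.ext h1.symm (Prod.ext h7.symm (Prod.ext h9.symm h2))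
    · rw [Finset.not_nonempty_iff_eq_empty.1 hne]; simp
  · rw [Finset.card_product, Finset.card_product, Finset.card_product, card_DD hN.ne_zero, card_PLT, card_PLT, card_PLT, Finset.card_pair hξ0]
    have : 2 * g + 2 = N.natDegree + (g - N.natDegree + 1) + (g + 1) := by omega
    rw [this, pow_add, pow_add]; ring

lemma EE_mem_I {g : ℕ} {ξ : Fq} {N : Fq[X]} (hN : N.Monic) (hr : N.natDegree = g + 1) {c : (Pr Fq × ℕ) →₀ Fq[X]} (hc : c ∈ DD N)
    {t : Fq[X]} (ht : t ∈ PLT Fq (g + 1)) : EE N c (C ξ) t ∈ LD {ξ} (2 * g + 2) := by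
  rw [mem_PLT] at ht
  have ht' : t.natDegree ≤ g :=
    nd_le ht
  have e : EE N c (C ξ) t = (WW N c + (t ^ 2 + N * t)) + C ξ * N ^ 2 := by unfold EE; ring
  have h1 : (WW N c).degree < (2 * g + 2 : ℕ) := by
    have := (WW_degree hN.ne_zero hc); rw [hr] at this; exact this
  have h3 : (t ^ 2 + N * t).natDegree ≤ 2 * g + 1 := 
    natDegree_add_le_of_degree_le (by rw [natDegree_pow]; omega) (natDegree_mul_le.trans (by omega))
  have h4 : (t ^ 2 + N * t).degree < (2 * g + 2 : ℕ) := by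
    refine (degree_le_of_natDegree_le h3).trans_lt ?_
    exact_mod_cast Nat.lt_succ_self _
  have h5 := (degree_add_le (WW N c) (t ^ 2 + N * t)).trans_lt (max_lt h1 h4)
  have h6 : (C ξ * N ^ 2).natDegree ≤ 2 * g + 2 := (natDegree_C_mul_le _ _).trans (by rw [natDegree_pow]; omega)
  rw [mem_LD, e]
  constructor
  · refine (degree_add_le _ _).trans_lt (max_lt (h5.trans ?_) ((degree_le_of_natDegree_le h6).trans_lt ?_))
    · exact_mod_cast Nat.lt_succ_self _
    · exact_mod_cast Nat.lt_succ_self _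
  · rw [coeff_add, coeff_eq_zero_of_degree_lt h5, zero_add, coeff_C_mul, show 2 * g + 2 = 2 * (g + 1) by ring, ← hr,
      coeff_pow_of_natDegree_le le_rfl, hN.coeff_natDegree]
    simp

lemma count_I {g : ℕ} {ξ : Fq} {N : Fq[X]} (hN : N.Monic) (hr : N.natDegree = g + 1) (F : Fq[X] → ℕ) :
    ∑ x ∈ DD N ×ˢ PLT Fq (g + 1), F (EE N x.1 (C ξ) x.2) = 1 * ∑ E ∈ LD {ξ} (2 * g + 2), F E := by
  apply fiber_count _ _ (fun x : ((Pr Fq × ℕ) →₀ Fq[X]) × Fq[X] => EE N x.1 (C ξ) x.2)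
  · intro x hx
    simp only [Finset.mem_product] at hx
    exact (EE_mem_I hN hr hx.1 hx.2)
  · intro b hb u hus hub
    rw [Finset.card_le_one]
    intro x hx y hy
    have hxb := hub x hx
    have hyb := hub y hy
    replace hx := hus hx
    replace hy := hus hy
    simp only [Finset.mem_product] at hx hy
    obtain ⟨h1, σ, h2, h3⟩ := EE_eq hN.ne_zero hx.1 hy.1 (hxb.trans hyb.symm)
    refine Prod.ext h1 ?_
    have h4 : N ∣ y.2 - x.2 := ⟨σ, by rw [h2]; ring⟩
    have h5 : (y.2 - x.2).degree < N.degree := by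
      rw [degree_eq_natDegree hN.ne_zero, hr]
      exact (degree_sub_le _ _).trans_lt (max_lt (mem_PLT.1 hy.2) (mem_PLT.1 hx.2))
    exact (sub_eq_zero.1 (eq_zero_of_dvd_of_degree_lt h4 h5)).symm
  · rw [Finset.card_product, card_DD hN.ne_zero, card_PLT, card_LD, hr]
    simp; ring

end Helpers5d
end EvenChar

set_option linter.unusedSectionVars false
set_option linter.unusedVariables false
namespace EvenChar
section Helpers5e
open scoped Classical
variable {Fq : Type} [Field Fq] [Fintype Fq] [CharP Fq 2]

/-- partial sum of solution counts -/
def RR (g : ℕ) (N E : Fq[X]) : ℕ := ∑ k ∈ Finset.range (g + 1), ∑ a ∈ Mon Fq k, rho N E a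

lemma rho_EE {N : Fq[X]} {c : (Pr Fq × ℕ) →₀ Fq[X]} {G t a : Fq[X]} (ha : a.Monic) :
    rho N (EE N c G t) a = rho N (EE N c G 0) a := by
  unfold EE
  rw [rho_shift ha, rho_shift ha]

lemma RR_EE {g : ℕ} {N : Fq[X]} {c : (Pr Fq × ℕ) →₀ Fq[X]} {G t : Fq[X]} :
    RR g N (EE N c G t) = RR g N (EE N c G 0) := by
  unfold RR
  refine Finset.sum_congr rfl fun k _ => Finset.sum_congr rfl fun a ha => rho_EE (mem_Mon.1 ha).1

lemma EE_u {N : Fq[X]} (hN : N ≠ 0) {c : (Pr Fq × ℕ) →₀ Fq[X]} (hc : c ∈ DD N) (G : Fq[X]) :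
    algebraMap Fq[X] (RatFunc Fq) (EE N c G 0) = algebraMap Fq[X] (RatFunc Fq) N ^ 2 * (vv c + algebraMap Fq[X] (RatFunc Fq) G) := by
  unfold EE
  rw [map_add, map_add, WW_vv hN hc]
  simp; ring

lemma zero_mem_PLT (n : ℕ) : (0 : Fq[X]) ∈ PLT Fq n := by
  rw [mem_PLT, degree_zero]; exact WithBot.bot_lt_coe _

lemma sum_N_R {g : ℕ} {ξ : Fq} (hξ : ∀ x : Fq, x ^ 2 + x ≠ ξ) {N : Fq[X]} (hN : N.Monic) (hr : N.natDegree ≤ g) :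
    Fintype.card Fq ^ (g + 1) * ∑ x ∈ (DD N).filter (Full N) ×ˢ (({0, ξ} : Finset Fq) ×ˢ LD (Finset.univ \ {0}) (g - N.natDegree)),
      hClass (vv x.1 + algebraMap Fq[X] (RatFunc Fq) (GG x.2.1 x.2.2)) =
    2 * ∑ E ∈ (LD (Finset.univ \ {0}) (2 * g + 1)).filter (Smooth N), RR g N E := by
  have h := count_R hξ hN hr (fun E => if E.coeff (2 * g + 1) ∈ ((Finset.univ \ {0}) : Finset Fq) then (if Smooth N E then RR g N E else 0) else 0)
  have e2 : ∑ E ∈ (LD (Finset.univ \ {0}) (2 * g + 1)).filter (Smooth N), RR g N E = ∑ E ∈ PLT Fq (2 * g + 2), 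
      (if E.coeff (2 * g + 1) ∈ ((Finset.univ \ {0}) : Finset Fq) then (if Smooth N E then RR g N E else 0) else 0) := by
    rw [Finset.sum_filter, LD, Finset.sum_filter]
  rw [e2, ← h]
  have key : ∀ c ∈ DD N, ∀ α : Fq, ∀ p ∈ PLT Fq (g - N.natDegree + 1), ∀ t ∈ PLT Fq (g + 1),
      (if (EE N c (GG α p) t).coeff (2 * g + 1) ∈ ((Finset.univ \ {0}) : Finset Fq) then (if Smooth N (EE N c (GG α p) t) then RR g N (EE N c (GG α p) t) else 0) else 0)
      = if Full N c then (if p.coeff (g - N.natDegree) ∈ ((Finset.univ \ {0}) : Finset Fq) then hClass (vv c + algebraMap Fq[X] (RatFunc Fq) (GG α p)) else 0) else 0 := by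
    intro c hc α p hp t ht
    rw [(EE_mem_R hN hr hc α hp ht).2]
    have hsm : ∀ t, Smooth N (EE N c (GG α p) t) ↔ Full N c := fun t => smooth_iff_full hN.ne_zero hc
    by_cases hf : Full N c
    · rw [if_pos hf]
      by_cases hp0 : p.coeff (g - N.natDegree) ∈ ((Finset.univ \ {0}) : Finset Fq)
      swap
      · rw [if_neg hp0, if_neg hp0]
      rw [if_pos hp0, if_pos hp0, if_pos ((hsm t).2 hf), RR_EE]
      have h1 := EE_mem_R hN hr hc α hp (zero_mem_PLT (Fq := Fq) (g + 1))
      have hnd : (EE N c (GG α p) 0).natDegree = 2 * g + 1 := by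
        apply le_antisymm (nd_le (mem_PLT.1 h1.1))
        apply le_natDegree_of_ne_zero
        rw [h1.2]
        simpa using hp0
      exact (hClass_R hN.ne_zero (ND_R hr hnd) ((hsm 0).2 hf) _ (EE_u hN.ne_zero hc _) hr hnd.le).symm
    · rw [if_neg hf, if_neg (fun h => hf ((hsm t).1 h))]
      simp
  have e3 : ∑ x ∈ DD N ×ˢ (({0, ξ} : Finset Fq) ×ˢ (PLT Fq (g - N.natDegree + 1) ×ˢ PLT Fq (g + 1))), 
      (if (EE N x.1 (GG x.2.1 x.2.2.1) x.2.2.2).coeff (2 * g + 1) ∈ ((Finset.univ \ {0}) : Finset Fq) then (if Smooth N (EE N x.1 (GG x.2.1 x.2.2.1) x.2.2.2) then RR g N (EE N x.1 (GG x.2.1 x.2.2.1) x.2.2.2) else 0) else 0)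
      = ∑ x ∈ DD N ×ˢ (({0, ξ} : Finset Fq) ×ˢ (PLT Fq (g - N.natDegree + 1) ×ˢ PLT Fq (g + 1))), 
      (if Full N x.1 then (if x.2.2.1.coeff (g - N.natDegree) ∈ ((Finset.univ \ {0}) : Finset Fq) then hClass (vv x.1 + algebraMap Fq[X] (RatFunc Fq) (GG x.2.1 x.2.2.1)) else 0) else 0) := by
    refine Finset.sum_congr rfl fun x hx => ?_
    simp only [Finset.mem_product] at hx
    exact key _ hx.1 _ _ hx.2.2.1 _ hx.2.2.2
  rw [e3]
  simp only [Finset.sum_product, Finset.sum_const, card_PLT, LD, Finset.sum_filter, smul_eq_mul, ← Finset.mul_sum]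
  congr 1
  refine Finset.sum_congr rfl fun c _ => ?_
  split_ifs with hf
  · rfl
  · simp

lemma sum_N_I {g : ℕ} {ξ : Fq} (hξ : ∀ x : Fq, x ^ 2 + x ≠ ξ) {N : Fq[X]} (hN : N.Monic) (hr : N.natDegree = g + 1) :
    Fintype.card Fq ^ (g + 1) * ((Fintype.card Fq + 1) * ∑ c ∈ (DD N).filter (Full N),
      hClass (vv c + algebraMap Fq[X] (RatFunc Fq) (C ξ))) =
    ∑ E ∈ (LD {ξ} (2 * g + 2)).filter (Smooth N), ((Fintype.card Fq + 1) * RR g N E + ∑ a ∈ Mon Fq (g + 1), rho N E a) := by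
  have h := count_I (ξ := ξ) hN hr (fun E => if Smooth N E then ((Fintype.card Fq + 1) * RR g N E + ∑ a ∈ Mon Fq (g + 1), rho N E a) else 0)
  rw [one_mul] at h
  rw [Finset.sum_filter (s := LD {ξ} (2 * g + 2)), ← h]
  have e3 : ∑ x ∈ DD N ×ˢ PLT Fq (g + 1), 
      (if Smooth N (EE N x.1 (C ξ) x.2) then ((Fintype.card Fq + 1) * RR g N (EE N x.1 (C ξ) x.2) + ∑ a ∈ Mon Fq (g + 1), rho N (EE N x.1 (C ξ) x.2) a) else 0)
      = ∑ x ∈ DD N ×ˢ PLT Fq (g + 1), 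
      (if Full N x.1 then (Fintype.card Fq + 1) * hClass (vv x.1 + algebraMap Fq[X] (RatFunc Fq) (C ξ)) else 0) := by
    refine Finset.sum_congr rfl fun x hx => ?_
    simp only [Finset.mem_product] at hx
    have hsm : ∀ t, Smooth N (EE N x.1 (C ξ) t) ↔ Full N x.1 := fun t => smooth_iff_full hN.ne_zero hx.1
    by_cases hf : Full N x.1
    · rw [if_pos hf, if_pos ((hsm _).2 hf), RR_EE]
      have h1 := EE_mem_I (ξ := ξ) hN hr hx.1 (zero_mem_PLT (Fq := Fq) (g + 1))
      rw [mem_LD] at h1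
      have hnd : (EE N x.1 (C ξ) 0).natDegree ≤ 2 * g + 2 := nd_le h1.1
      have hco : (EE N x.1 (C ξ) 0).coeff (2 * g + 2) = ξ := Finset.mem_singleton.1 h1.2
      have hND := ND_I hξ hN hr hnd hco
      have hu := EE_u hN.ne_zero hx.1 (C ξ)
      have H := hClass_I hN.ne_zero hND ((hsm 0).2 hf) _ hu hr.le hnd
      rw [H]
      refine congrArg₂ (· + ·) rfl ?_
      exact Finset.sum_congr rfl fun a ha => rho_EE (mem_Mon.1 ha).1
    · rw [if_neg hf, if_neg (fun h => hf ((hsm _).1 h))]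
  rw [e3]
  simp only [Finset.sum_product, Finset.sum_const, card_PLT, Finset.sum_filter, smul_eq_mul, ← Finset.mul_sum]
  congr 1
  rw [Finset.mul_sum]
  refine Finset.sum_congr rfl fun c _ => ?_
  split_ifs with hf
  · rfl
  · simp

theorem sum_R (g : ℕ) {ξ : Fq} (hξ : ∀ x : Fq, x ^ 2 + x ≠ ξ) :
    (Fintype.card Fq : ℝ) ^ (g + 1) * ∑' u : (Ifam ξ (g + 1) : Set (RatFunc Fq)), (hClass u.1 : ℝ) =
    2 * ∑ r ∈ Finset.range (g + 1), ∑ N ∈ Mon Fq r, 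
      ∑ E ∈ (LD (Finset.univ \ {0}) (2 * g + 1)).filter (Smooth N), (RR g N E : ℝ) := by
  set J : Finset (Σ _ : Fq[X], ((Pr Fq × ℕ) →₀ Fq[X]) × Fq × Fq[X]) := ((Finset.range (g + 1)).biUnion (Mon Fq)).sigma
    (fun N => (DD N).filter (Full N) ×ˢ (({0, ξ} : Finset Fq) ×ˢ LD (Finset.univ \ {0}) (g - N.natDegree))) with hJ
  set f : (Σ _ : Fq[X], ((Pr Fq × ℕ) →₀ Fq[X]) × Fq × Fq[X]) → RatFunc Fq := 
    fun x => vv x.2.1 + algebraMap Fq[X] (RatFunc Fq) (GG x.2.2.1 x.2.2.2) with hf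
  have hmem : ∀ x, x ∈ J ↔ (x.1.Monic ∧ x.1.natDegree ≤ g) ∧ (x.2.1 ∈ DD x.1 ∧ Full x.1 x.2.1) ∧ x.2.2.1 ∈ ({0, ξ} : Finset Fq) ∧ x.2.2.2 ∈ LD (Finset.univ \ {0}) (g - x.1.natDegree) := by
    intro x
    rw [hJ, Finset.mem_sigma, Finset.mem_product, Finset.mem_product, Finset.mem_filter, Finset.mem_biUnion]
    simp only [Finset.mem_range, mem_Mon]
    constructor
    · rintro ⟨⟨r, h1, h2, h3⟩, h4⟩
      exact ⟨⟨h2, by omega⟩, h4⟩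
    · rintro ⟨⟨h2, h1⟩, h4⟩
      exact ⟨⟨_, by omega, h2, rfl⟩, h4⟩
  have hI : Ifam ξ (g + 1) = ((J.image f : Finset (RatFunc Fq)) : Set (RatFunc Fq)) := by
    ext u
    simp only [Ifam, Irs, Set.mem_iUnion, Set.mem_ofPred_eq, Finset.coe_image, Set.mem_image, Finset.mem_coe]
    constructor
    · rintro ⟨r, s, hs, hrs, v, hv, G, hG, rfl⟩
      obtain ⟨N, hN, c, hc, hfull, rfl⟩ := (Ffam_iff r v).1 hv
      obtain ⟨s, rfl⟩ : ∃ s', s = s' + 1 := ⟨s - 1, by omega⟩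
      obtain ⟨α, hα, p, hp, rfl⟩ := (Gfam_iff ξ s G).1 hG
      rw [mem_Mon] at hN
      refine ⟨⟨N, c, α, p⟩, (hmem _).2 ⟨⟨hN.1, ?_⟩, ⟨hc, hfull⟩, hα, ?_⟩, rfl⟩
      · dsimp only; omega
      · dsimp only
        rwa [show g - N.natDegree = s by omega]
    · rintro ⟨x, hx, rfl⟩
      obtain ⟨⟨h1, h2⟩, ⟨h3, h4⟩, h5, h6⟩ := (hmem x).1 hx
      refine ⟨x.1.natDegree, g - x.1.natDegree + 1, by omega, by omega, vv x.2.1, (Ffam_iff _ _).2 ⟨x.1, mem_Mon.2 ⟨h1, rfl⟩, x.2.1, h3, h4, rfl⟩,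
        GG x.2.2.1 x.2.2.2, (Gfam_iff _ _ _).2 ⟨_, h5, _, h6, rfl⟩, rfl⟩
  have hinj : Set.InjOn f J := by
    intro x hx y hy hxy
    obtain ⟨⟨h1, h2⟩, ⟨h3, h4⟩, h5, h6⟩ := (hmem x).1 hx
    obtain ⟨⟨k1, k2⟩, ⟨k3, k4⟩, k5, k6⟩ := (hmem y).1 hy
    obtain ⟨e1, e2, e3⟩ := u_inj h1 k1 h3 k3 h4 k4 hxy
    obtain ⟨e4, e5⟩ := GG_inj e3
    rcases x with ⟨x1, x2, x3, x4⟩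
    rcases y with ⟨y1, y2, y3, y4⟩
    dsimp only at e1 e2 e4 e5
    subst e1 e2 e4 e5
    rfl
  rw [hI, Finset.tsum_subtype' (J.image f) (fun u => (hClass u : ℝ)), Finset.sum_image hinj, hJ, Finset.sum_sigma, 
    Finset.sum_biUnion, Finset.mul_sum, Finset.mul_sum]
  · refine Finset.sum_congr rfl fun r hr => ?_
    rw [Finset.mul_sum, Finset.mul_sum]
    refine Finset.sum_congr rfl fun N hN => ?_
    rw [mem_Mon] at hN
    rw [Finset.mem_range] at hr
    have := sum_N_R (g := g) hξ hN.1 (by omega)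
    exact_mod_cast this
  · intro r _ r' _ hne
    rw [Function.onFun, Finset.disjoint_left]
    intro N h1 h2
    rw [mem_Mon] at h1 h2
    exact hne (h1.2.symm.trans h2.2)

theorem sum_I (g : ℕ) {ξ : Fq} (hξ : ∀ x : Fq, x ^ 2 + x ≠ ξ) :
    (Fintype.card Fq : ℝ) ^ (g + 1) * (((Fintype.card Fq : ℝ) + 1) * ∑' u : (F'fam ξ (g + 1) : Set (RatFunc Fq)), (hClass u.1 : ℝ)) =
    ∑ N ∈ Mon Fq (g + 1), ∑ E ∈ (LD {ξ} (2 * g + 2)).filter (Smooth N), 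
      (((Fintype.card Fq : ℝ) + 1) * (RR g N E : ℝ) + ∑ a ∈ Mon Fq (g + 1), (rho N E a : ℝ)) := by
  set J : Finset (Σ _ : Fq[X], ((Pr Fq × ℕ) →₀ Fq[X])) := (Mon Fq (g + 1)).sigma (fun N => (DD N).filter (Full N)) with hJ
  set f : (Σ _ : Fq[X], ((Pr Fq × ℕ) →₀ Fq[X])) → RatFunc Fq := 
    fun x => vv x.2 + algebraMap Fq[X] (RatFunc Fq) (C ξ) with hf
  have hmem : ∀ x, x ∈ J ↔ (x.1.Monic ∧ x.1.natDegree = g + 1) ∧ (x.2 ∈ DD x.1 ∧ Full x.1 x.2) := by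
    intro x
    rw [hJ, Finset.mem_sigma, Finset.mem_filter, mem_Mon]
  have hI : F'fam ξ (g + 1) = ((J.image f : Finset (RatFunc Fq)) : Set (RatFunc Fq)) := by
    ext u
    simp only [F'fam, Finset.coe_image, Set.mem_image, Finset.mem_coe]
    constructor
    · rintro ⟨v, hv, rfl⟩
      obtain ⟨N, hN, c, hc, hfull, rfl⟩ := (Ffam_iff _ v).1 hv
      rw [mem_Mon] at hN
      refine ⟨⟨N, c⟩, (hmem _).2 ⟨hN, ⟨hc, hfull⟩⟩, ?_⟩
      rw [hf, RatFunc.algebraMap_C]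
    · rintro ⟨x, hx, rfl⟩
      obtain ⟨h1, h3, h4⟩ := (hmem x).1 hx
      refine ⟨vv x.2, (Ffam_iff _ _).2 ⟨x.1, mem_Mon.2 h1, x.2, h3, h4, rfl⟩, ?_⟩
      rw [hf, RatFunc.algebraMap_C]
  have hinj : Set.InjOn f J := by
    intro x hx y hy hxy
    obtain ⟨⟨h1, h2⟩, ⟨h3, h4⟩⟩ := (hmem x).1 hx
    obtain ⟨⟨k1, k2⟩, ⟨k3, k4⟩⟩ := (hmem y).1 hy
    obtain ⟨e1, e2, e3⟩ := u_inj h1 k1 h3 k3 h4 k4 hxy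
    rcases x with ⟨x1, x2⟩
    rcases y with ⟨y1, y2⟩
    dsimp only at e1 e2
    subst e1 e2
    rfl
  rw [hI, Finset.tsum_subtype' (J.image f) (fun u => (hClass u : ℝ)), Finset.sum_image hinj, hJ, Finset.sum_sigma, 
    Finset.mul_sum, Finset.mul_sum]
  refine Finset.sum_congr rfl fun N hN => ?_
  rw [mem_Mon] at hN
  have := sum_N_I (g := g) hξ hN.1 hN.2
  exact_mod_cast this

end Helpers5e
end EvenChar

set_option linter.unusedSectionVars false
set_option linter.unusedVariables false
namespace EvenChar
section Helpers6a
open scoped Classical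
variable {Fq : Type} [Field Fq] [Fintype Fq] [CharP Fq 2]

/-- monic divisors -/
def mdiv (a : Fq[X]) : Finset Fq[X] := ((Finset.range (a.natDegree + 1)).biUnion (Mon Fq)).filter (fun d => d ∣ a)

lemma mem_mdiv {a d : Fq[X]} (ha : a ≠ 0) : d ∈ mdiv a ↔ d.Monic ∧ d ∣ a := by
  simp only [mdiv, Finset.mem_filter, Finset.mem_biUnion, Finset.mem_range, mem_Mon]
  constructor
  · rintro ⟨⟨k, _, h, _⟩, h2⟩; exact ⟨h, h2⟩
  · rintro ⟨h1, h2⟩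
    exact ⟨⟨_, Nat.lt_succ_of_le (natDegree_le_of_dvd h2 ha), h1, rfl⟩, h2⟩

lemma sum_mdiv (m : ℕ) : ∑ a ∈ Mon Fq m, (mdiv a).card = (m + 1) * Fintype.card Fq ^ m := by
  have h1 : ∀ a ∈ Mon Fq m, (mdiv a).card = ∑ k ∈ Finset.range (m + 1), ∑ d ∈ Mon Fq k, if d ∣ a then 1 else 0 := by
    intro a ha
    rw [mem_Mon] at ha
    rw [Finset.card_eq_sum_ones, mdiv, Finset.sum_filter, Finset.sum_biUnion, ha.2]
    intro r _ r' _ hne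
    rw [Function.onFun, Finset.disjoint_left]
    intro N h1 h2
    rw [mem_Mon] at h1 h2
    exact hne (h1.2.symm.trans h2.2)
  rw [Finset.sum_congr rfl h1, Finset.sum_comm]
  have h2 : ∀ k ∈ Finset.range (m + 1), ∑ a ∈ Mon Fq m, ∑ d ∈ Mon Fq k, (if d ∣ a then 1 else 0) = Fintype.card Fq ^ m := by
    intro k hk
    rw [Finset.mem_range] at hk
    rw [Finset.sum_comm]
    have h3 : ∀ d ∈ Mon Fq k, ∑ a ∈ Mon Fq m, (if d ∣ a then 1 else 0) = Fintype.card Fq ^ (m - k) := by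
      intro d hd
      rw [mem_Mon] at hd
      rw [← Finset.sum_filter]
      unfold Mon
      rw [sum_LD_dvd {1} hd.1 hd.2 (by omega)]
      rw [← Finset.card_eq_sum_ones, ← Mon, card_Mon]
    rw [Finset.sum_congr rfl h3, Finset.sum_const, card_Mon, smul_eq_mul, ← pow_add]
    congr 1; omega
  rw [Finset.sum_congr rfl h2]
  simp

lemma rho_le {N E a : Fq[X]} (ha : a.Monic) (hs : sqc N a) : rho N E a ≤ (mdiv a).card := by
  unfold rho
  rcases Finset.eq_empty_or_nonempty ((PLT Fq a.natDegree).filter (fun b => a ∣ b ^ 2 + N * b + E)) with h | ⟨b0, hb0⟩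
  · rw [h]; simp
  rw [Finset.mem_filter] at hb0
  have hg0 : ∀ x, gcd a x ≠ 0 := fun x h => ha.ne_zero ((gcd_eq_zero_iff _ _).1 h).1
  -- structure for one solution
  have key : ∀ b, a ∣ b ^ 2 + N * b + E → ∃ k, a = gcd a (b + b0) * k ∧ k ∣ b + b0 + N ∧ IsCoprime (gcd a (b + b0)) k := by
    intro b hb
    set x := b + b0 with hx
    have hax : a ∣ x * (x + N) := by
      have := dvd_add hb hb0.2
      convert this using 1
      rw [hx]; linear_combination (b * b0 - E) * (two0 (Fq := Fq))
    obtain ⟨k, hk⟩ := gcd_dvd_left a x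
    obtain ⟨y, hy⟩ := gcd_dvd_right a x
    have hd0 := hg0 x
    have hky : IsCoprime k y := by
      obtain ⟨u, v, huv⟩ := exists_gcd_eq_mul_add_mul a x
      refine ⟨u, v, ?_⟩
      apply mul_left_cancel₀ hd0
      calc gcd a x * (u * k + v * y) = (gcd a x * k) * u + (gcd a x * y) * v := by ring
        _ = a * u + x * v := by rw [← hk, ← hy]
        _ = gcd a x * 1 := by rw [mul_one, ← huv]
    have hkx : k ∣ x + N := by
      have h1 : gcd a x * k ∣ gcd a x * (y * (x + N)) := by
        rw [← hk, ← mul_assoc, ← hy]; exact hax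
      exact hky.dvd_of_dvd_mul_left ((mul_dvd_mul_iff_left hd0).1 h1)
    refine ⟨k, hk, hkx, ?_⟩
    apply isCoprime_of_prime_dvd
    · rintro ⟨h1, h2⟩; exact hd0 h1
    · intro p hp hpd hpk
      obtain ⟨Q, hQ⟩ := exists_Pr hp.irreducible
      have hQd := hQ.symm.dvd.trans hpd
      have hQk := hQ.symm.dvd.trans hpk
      have hQx : Q.1 ∣ x := hQd.trans (gcd_dvd_right a x)
      have hQN : Q.1 ∣ N := (dvd_add_right hQx).1 (hQk.trans hkx)
      apply hs Q hQN
      rw [hk, sq]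
      exact mul_dvd_mul hQd hQk
  apply Finset.card_le_card_of_injOn (fun b => normalize (gcd a (b + b0)))
  · intro b hb
    rw [Finset.mem_coe, mem_mdiv ha.ne_zero]
    refine ⟨monic_normalize (hg0 _), ?_⟩
    rw [normalize_dvd_iff]
    exact gcd_dvd_left _ _
  · intro b hb b' hb' heq
    rw [Finset.mem_coe, Finset.mem_filter] at hb hb'
    obtain ⟨k, h1, h2, h3⟩ := key b hb.2
    obtain ⟨k', h1', h2', h3'⟩ := key b' hb'.2
    have hassoc : Associated (gcd a (b + b0)) (gcd a (b' + b0)) := normalize_eq_normalize_iff_associated.1 heq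
    have hkk : k ∣ k' := by
      obtain ⟨u, hu⟩ := hassoc
      rw [← hu] at h1'
      have : k = u * k' := by
        apply mul_left_cancel₀ (hg0 (b + b0))
        rw [← mul_assoc]
        exact h1.symm.trans h1'
      rw [this]
      exact (Units.mul_left_dvd).2 dvd_rfl
    have hd1 : gcd a (b + b0) ∣ b - b' := by
      have e : b - b' = (b + b0) - (b' + b0) := by ring
      rw [e]
      exact dvd_sub (gcd_dvd_right _ _) (hassoc.dvd.trans (gcd_dvd_right _ _))
    have hd2 : k ∣ b - b' := by
      have e : b - b' = (b + b0 + N) - (b' + b0 + N) := by ring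
      rw [e]
      exact dvd_sub h2 (hkk.trans h2')
    have hd3 : a ∣ b - b' := by
      rw [h1]; exact h3.mul_dvd hd1 hd2
    have h5 : (b - b').degree < a.degree := by
      rw [degree_eq_natDegree ha.ne_zero]
      exact (degree_sub_le _ _).trans_lt (max_lt (mem_PLT.1 hb.1) (mem_PLT.1 hb'.1))
    exact sub_eq_zero.1 (eq_zero_of_dvd_of_degree_lt hd3 h5)

end Helpers6a
end EvenChar

set_option linter.unusedSectionVars false
set_option linter.unusedVariables false
namespace EvenChar
section Helpers6b
open scoped Classical
variable {Fq : Type} [Field Fq] [Fintype Fq] [CharP Fq 2]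

lemma incl_excl {ι : Type*} (A : Finset ι) (p : ι → Prop) :
    (if ∀ i ∈ A, ¬ p i then (1:ℝ) else 0) = ∑ S ∈ A.powerset, if ∀ i ∈ S, p i then (-1:ℝ)^S.card else 0 := by
  rw [← Finset.sum_filter]
  have h1 : A.powerset.filter (fun S => ∀ i ∈ S, p i) = (A.filter p).powerset := by
    ext S
    simp only [Finset.mem_filter, Finset.mem_powerset, Finset.subset_iff]
    exact ⟨fun h x hx => ⟨h.1 hx, h.2 x hx⟩, fun h => ⟨fun x hx => (h hx).1, fun x hx => (h hx).2⟩⟩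
  rw [h1]
  have h2 := Finset.sum_powerset_neg_one_pow_card (x := A.filter p)
  have h3 : (∑ S ∈ (A.filter p).powerset, (-1:ℝ)^S.card) = ((if A.filter p = ∅ then (1:ℤ) else 0 : ℤ) : ℝ) := by
    rw [← h2]; push_cast; rfl
  rw [h3]
  have h4 : (∀ i ∈ A, ¬ p i) ↔ A.filter p = ∅ := Finset.filter_eq_empty_iff.symm
  by_cases h : A.filter p = ∅
  · rw [if_pos h, if_pos (h4.2 h)]; simp
  · rw [if_neg h, if_neg (fun h' => h (h4.1 h'))]; simp

/-- local densities -/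
def Phi (j : ℕ) (N : Fq[X]) : ℝ := ∏ P ∈ pf N, (1 - ((Fintype.card Fq : ℝ)^(j * P.1.natDegree))⁻¹)

lemma Phi_eq (j : ℕ) (N : Fq[X]) : Phi j N =
    ∑ S ∈ (pf N).powerset, (-1:ℝ)^S.card * ((Fintype.card Fq : ℝ)^(j * dl S))⁻¹ := by
  unfold Phi
  simp_rw [sub_eq_add_neg]
  rw [Finset.prod_one_add]
  apply Finset.sum_congr rfl
  intro S _
  rw [Finset.prod_neg, Finset.prod_inv_distrib, Finset.prod_pow_eq_pow_sum, dl, Finset.mul_sum]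

lemma q_pos : (0:ℝ) < Fintype.card Fq := by exact_mod_cast Fintype.card_pos
lemma q_ge2 : (2:ℝ) ≤ Fintype.card Fq := by exact_mod_cast two_le_q

lemma Phi_bd (j : ℕ) (N : Fq[X]) : |Phi j N| ≤ 1 := by
  unfold Phi
  have h : ∀ P : Pr Fq, ((Fintype.card Fq : ℝ)^(j * P.1.natDegree))⁻¹ ≤ 1 := fun P =>
    inv_le_one_of_one_le₀ (one_le_pow₀ (by linarith [q_ge2 (Fq := Fq)]))
  have h' : ∀ P : Pr Fq, 0 ≤ ((Fintype.card Fq : ℝ)^(j * P.1.natDegree))⁻¹ := fun P => by positivity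
  rw [abs_of_nonneg (Finset.prod_nonneg fun P _ => by linarith [h P])]
  exact Finset.prod_le_one (fun P _ => by linarith [h P]) (fun P _ => by linarith [h' P])

lemma dl_le_of_subset {N : Fq[X]} (hN : N.Monic) {S : Finset (Pr Fq)} (h : S ⊆ pf N) : dl S ≤ N.natDegree := by
  rw [← pr_natDegree]
  exact natDegree_le_of_dvd ((pr_dvd_iff_subset hN.ne_zero).2 h) hN.ne_zero

lemma bad_shift {N E P : Fq[X]} (b : Fq[X]) : bad N (E + (b ^ 2 + N * b)) P ↔ bad N E P := by
  have h : ∀ E, bad N E P → bad N (E + (b ^ 2 + N * b)) P := by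
    rintro E ⟨t, ht⟩
    refine ⟨t + b, ?_⟩
    convert ht using 1
    linear_combination (b^2+N*b+t*b) * (two0 (Fq := Fq))
  refine ⟨fun h1 => ?_, h E⟩
  have := h _ h1
  convert this using 1
  linear_combination (-(b^2+N*b)) * (two0 (Fq := Fq))

lemma shift_mem {L : Finset Fq} {K : ℕ} {E w : Fq[X]} (hw : w.degree < (K:ℕ)) (hE : E ∈ LD L K) : E + w ∈ LD L K := by
  rw [mem_LD] at hE ⊢
  refine ⟨(degree_add_le _ _).trans_lt (max_lt hE.1 (hw.trans_le (by exact_mod_cast Nat.le_succ K))), ?_⟩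
  rw [coeff_add, coeff_eq_zero_of_degree_lt hw, add_zero]
  exact hE.2

lemma w_deg {N b : Fq[X]} {r m K : ℕ} (hN : N.natDegree = r) (hb : b.degree < (m:ℕ)) (h1 : 2 * m ≤ K + 1) (h2 : r + m ≤ K) :
    (b ^ 2 + N * b).degree < (K:ℕ) := by
  by_cases hb0 : b = 0
  · rw [hb0]; simp
  have hbm : b.natDegree < m := (natDegree_lt_iff_degree_lt hb0).2 hb
  apply (degree_add_le _ _).trans_lt
  refine max_lt ?_ ?_
  · apply degree_le_natDegree.trans_lt
    have := natDegree_pow_le (p := b) (n := 2)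
    exact_mod_cast (by omega)
  · apply degree_le_natDegree.trans_lt
    have := natDegree_mul_le (p := N) (q := b)
    exact_mod_cast (by omega)

/-- U(S) exact for small S -/
lemma U_exact (L : Finset Fq) {S : Finset (Pr Fq)} {N a : Fq[X]} {r m K : ℕ} (hN : N.natDegree = r)
    (ha : a ∈ Mon Fq m) (hS : pr S ∣ N) (has : ∀ P ∈ S, ¬ P.1 ^ 2 ∣ a)
    (h1 : 2 * m ≤ K + 1) (h2 : r + m ≤ K) (h3 : m + 2 * dl S ≤ K) :
    ∑ E ∈ (LD L K).filter (fun E => ∀ P ∈ S, bad N E P.1), rho N E a = L.card * Fintype.card Fq ^ (K - dl S) := by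
  rw [mem_Mon] at ha
  have e1 : ∀ E, rho N E a = ∑ b ∈ PLT Fq m, if a ∣ b ^ 2 + N * b + E then 1 else 0 := by
    intro E
    rw [rho, Finset.card_eq_sum_ones, Finset.sum_filter, ha.2]
  simp_rw [e1]
  rw [Finset.sum_comm]
  have e2 : ∀ b ∈ PLT Fq m, ∑ E ∈ (LD L K).filter (fun E => ∀ P ∈ S, bad N E P.1), (if a ∣ b ^ 2 + N * b + E then 1 else 0)
      = L.card * Fintype.card Fq ^ (K - m - dl S) := by
    intro b hb
    have hw := w_deg hN (mem_PLT.1 hb) h1 h2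
    rw [← ha.2, ← card_bad_LD L ha.1 hS has (by rw [ha.2]; exact h3), ← Finset.sum_filter, ← Finset.card_eq_sum_ones, Finset.filter_filter]
    refine Finset.card_bij' (fun E _ => E + (b ^ 2 + N * b)) (fun E _ => E + (b ^ 2 + N * b)) ?_ ?_ ?_ ?_
    · intro E hE
      rw [Finset.mem_filter] at hE ⊢
      refine ⟨shift_mem hw hE.1, by rw [add_comm]; exact hE.2.2, fun P hP => (bad_shift b).2 (hE.2.1 P hP)⟩
    · intro E hE
      rw [Finset.mem_filter] at hE ⊢
      refine ⟨shift_mem hw hE.1, fun P hP => (bad_shift b).2 (hE.2.2 P hP), ?_⟩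
      convert hE.2.1 using 1
      linear_combination (b^2+N*b) * (two0 (Fq := Fq))
    · intro E hE
      linear_combination (b^2+N*b) * (two0 (Fq := Fq))
    · intro E hE
      linear_combination (b^2+N*b) * (two0 (Fq := Fq))
  rw [Finset.sum_congr rfl e2, Finset.sum_const, card_PLT, smul_eq_mul]
  rw [mul_left_comm, ← pow_add]
  congr 2
  omega

lemma U_le (L : Finset Fq) {S : Finset (Pr Fq)} {N a : Fq[X]} {r m K : ℕ} 
    (ha : a.Monic) (hS : pr S ∣ N) (has : sqc N a) (h3 : 2 * dl S ≤ K) :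
    ∑ E ∈ (LD L K).filter (fun E => ∀ P ∈ S, bad N E P.1), rho N E a ≤ (mdiv a).card * (L.card * Fintype.card Fq ^ (K - dl S)) := by
  refine (Finset.sum_le_card_nsmul _ _ (mdiv a).card (fun E _ => rho_le ha has)).trans ?_
  rw [smul_eq_mul, mul_comm]
  apply Nat.mul_le_mul_left
  have := card_bad_LD (a := 1) (K := K) L monic_one hS (fun P hP h => ?_) (by simpa using h3)
  · simp only [natDegree_one, Nat.sub_zero, one_dvd, true_and] at this
    rw [this]
  · exact P.2.2.not_isUnit (isUnit_of_dvd_one ((dvd_pow_self _ two_ne_zero).trans h))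

lemma mdiv_pos {a : Fq[X]} (ha : a.Monic) : 1 ≤ (mdiv a).card :=
  Finset.card_pos.2 ⟨1, (mem_mdiv ha.ne_zero).2 ⟨monic_one, one_dvd _⟩⟩

/-- T -/
def TT' (L : Finset Fq) (K : ℕ) (N a : Fq[X]) : ℝ := ∑ E ∈ (LD L K).filter (Smooth N), (rho N E a : ℝ)

lemma T_zero (L : Finset Fq) (K : ℕ) {N a : Fq[X]} (h : ¬ sqc N a) : TT' L K N a = 0 := by
  unfold TT'
  apply Finset.sum_eq_zero
  intro E hE
  rw [Finset.mem_filter] at hE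
  unfold sqc at h
  push Not at h
  obtain ⟨P, hP, hPa⟩ := h
  rw [rho, Nat.cast_eq_zero, Finset.card_eq_zero, Finset.filter_eq_empty_iff]
  intro b _ hb
  apply hE.2 P hP
  refine ⟨b, ?_⟩
  have := hPa.trans hb
  convert this using 1
  ring

lemma T_est (L : Finset Fq) {N a : Fq[X]} {r m K : ℕ} (hN : N ∈ Mon Fq r)
    (ha : a ∈ Mon Fq m) (has : sqc N a)
    (h1 : 2 * m ≤ K + 1) (h2 : r + m ≤ K) (h3 : 2 * r ≤ K) :
    |TT' L K N a - L.card * (Fintype.card Fq : ℝ)^K * Phi 1 N| ≤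
      (mdiv a).card * (L.card * (Fintype.card Fq : ℝ)^K * ∑ S ∈ (pf N).powerset.filter (fun S => K < m + 2 * dl S), ((Fintype.card Fq : ℝ)^(dl S))⁻¹) := by
  rw [mem_Mon] at hN
  have hq := q_pos (Fq := Fq)
  set q : ℝ := (Fintype.card Fq : ℝ) with hqd
  have e1 : TT' L K N a = ∑ S ∈ (pf N).powerset, (-1:ℝ)^S.card * ((∑ E ∈ (LD L K).filter (fun E => ∀ P ∈ S, bad N E P.1), rho N E a : ℕ) : ℝ) := by
    unfold TT'
    rw [Finset.sum_filter]
    have : ∀ E, (if Smooth N E then (rho N E a : ℝ) else 0) = ∑ S ∈ (pf N).powerset, (if ∀ P ∈ S, bad N E P.1 then (-1:ℝ)^S.card else 0) * rho N E a := by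
      intro E
      rw [← Finset.sum_mul, ← incl_excl (pf N) (fun P => bad N E P.1)]
      have hs : Smooth N E ↔ ∀ P ∈ pf N, ¬ bad N E P.1 := by
        unfold Smooth
        simp_rw [mem_pf hN.1.ne_zero]
      simp only [hs]
      split_ifs <;> simp
    simp_rw [this]
    rw [Finset.sum_comm]
    apply Finset.sum_congr rfl
    intro S _
    rw [Nat.cast_sum, Finset.sum_filter, Finset.mul_sum]
    apply Finset.sum_congr rfl
    intro E _
    split_ifs <;> simp
  rw [e1, Phi_eq, Finset.mul_sum, ← Finset.sum_sub_distrib, Finset.mul_sum, Finset.mul_sum, Finset.sum_filter]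
  refine (Finset.abs_sum_le_sum_abs _ _).trans (Finset.sum_le_sum fun S hS => ?_)
  rw [Finset.mem_powerset] at hS
  have hSN := (pr_dvd_iff_subset hN.1.ne_zero).2 hS
  have hdl := dl_le_of_subset hN.1 hS
  rw [hN.2] at hdl
  have hK : q ^ (K - dl S) = q ^ K * (q ^ dl S)⁻¹ := pow_sub₀ _ hq.ne' (by omega)
  rw [mul_left_comm _ ((-1:ℝ)^_), ← mul_sub, abs_mul, abs_pow, abs_neg, abs_one, one_pow, one_mul, one_mul]
  split_ifs with hc
  · have hu := U_le (r := r) (m := m) L (K := K) (mem_Mon.1 ha).1 hSN has (by omega)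
    have hu' : ((∑ E ∈ (LD L K).filter (fun E => ∀ P ∈ S, bad N E P.1), rho N E a : ℕ) : ℝ) ≤ (mdiv a).card * (L.card * q ^ (K - dl S)) := by
      rw [hqd]; exact_mod_cast hu
    rw [hK] at hu'
    have hm : (1:ℝ) ≤ (mdiv a).card := by exact_mod_cast mdiv_pos (mem_Mon.1 ha).1
    have h0 : 0 ≤ L.card * (q ^ K * (q ^ dl S)⁻¹) := by positivity
    have h0' : (0:ℝ) ≤ ((∑ E ∈ (LD L K).filter (fun E => ∀ P ∈ S, bad N E P.1), rho N E a : ℕ) : ℝ) := by positivity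
    rw [abs_le, mul_assoc (L.card:ℝ)]
    constructor <;> nlinarith
  · have hu := U_exact L hN.2 ha hSN (fun P hP => has P ((mem_pf hN.1.ne_zero).1 (hS hP))) h1 h2 (by omega)
    rw [hu]
    push_cast
    rw [← hqd, hK, mul_assoc, sub_self, abs_zero]

lemma sqc_count {N : Fq[X]} {r : ℕ} (m : ℕ) (hN : N ∈ Mon Fq r) :
    |(((Mon Fq m).filter (sqc N)).card : ℝ) - (Fintype.card Fq : ℝ)^m * Phi 2 N| ≤
     (Fintype.card Fq : ℝ)^m * ∑ S ∈ (pf N).powerset.filter (fun S => m < 2 * dl S), ((Fintype.card Fq : ℝ)^(2 * dl S))⁻¹ := by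
  rw [mem_Mon] at hN
  have hq := q_pos (Fq := Fq)
  have hs : ∀ a, sqc N a ↔ ∀ P ∈ pf N, ¬ P.1 ^ 2 ∣ a := by
    intro a
    unfold sqc
    simp_rw [mem_pf hN.1.ne_zero]
  have e1 : (((Mon Fq m).filter (sqc N)).card : ℝ) = ∑ S ∈ (pf N).powerset, (-1:ℝ)^S.card * (((Mon Fq m).filter (fun a => pr S ^ 2 ∣ a)).card : ℝ) := by
    rw [Finset.card_eq_sum_ones, Nat.cast_sum, Finset.sum_filter]
    have : ∀ a, (if sqc N a then ((1:ℕ) : ℝ) else 0) = ∑ S ∈ (pf N).powerset, (if ∀ P ∈ S, P.1 ^ 2 ∣ a then (-1:ℝ)^S.card else 0) := by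
      intro a
      rw [← incl_excl (pf N) (fun P => P.1 ^ 2 ∣ a)]
      simp only [hs]
      split_ifs <;> simp
    simp_rw [this]
    rw [Finset.sum_comm]
    apply Finset.sum_congr rfl
    intro S _
    rw [← Finset.sum_filter, Finset.sum_const, nsmul_eq_mul, mul_comm]
    simp_rw [pr_sq_dvd]
  set q : ℝ := (Fintype.card Fq : ℝ) with hqd
  rw [e1, Phi_eq, Finset.mul_sum, ← Finset.sum_sub_distrib, Finset.mul_sum, Finset.sum_filter]
  refine (Finset.abs_sum_le_sum_abs _ _).trans (Finset.sum_le_sum fun S hS => ?_)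
  have hd2 : (pr S ^ 2).natDegree = 2 * dl S := by rw [(pr_monic S).natDegree_pow, pr_natDegree]
  rw [mul_left_comm _ ((-1:ℝ)^_), ← mul_sub, abs_mul, abs_pow, abs_neg, abs_one, one_pow, one_mul]
  split_ifs with hc
  · have : (Mon Fq m).filter (fun a => pr S ^ 2 ∣ a) = ∅ := by
      rw [Finset.filter_eq_empty_iff]
      intro a ha h
      rw [mem_Mon] at ha
      have := natDegree_le_of_dvd h ha.1.ne_zero
      omega
    rw [this, Finset.card_empty, Nat.cast_zero, zero_sub, abs_neg, abs_of_nonneg (by positivity)]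
  · have : ((Mon Fq m).filter (fun a => pr S ^ 2 ∣ a)).card = Fintype.card Fq ^ (m - 2 * dl S) := by
      rw [Finset.card_eq_sum_ones]
      unfold Mon
      rw [sum_LD_dvd {1} ((pr_monic S).pow 2) hd2 (by omega), ← Finset.card_eq_sum_ones, ← Mon, card_Mon]
    rw [this]
    push_cast
    rw [← hqd, pow_sub₀ _ hq.ne' (by omega), sub_self, abs_zero]

end Helpers6b
end EvenChar

set_option linter.unusedSectionVars false
set_option linter.unusedVariables false
namespace EvenChar
section Helpers6c
open scoped Classical
variable {Fq : Type} [Field Fq] [Fintype Fq] [CharP Fq 2]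

lemma tail_sum (r D j : ℕ) (hj : 1 ≤ j) :
    ∑ N ∈ Mon Fq r, ∑ S ∈ (pf N).powerset.filter (fun S => D ≤ dl S), ((Fintype.card Fq : ℝ)^(j * dl S))⁻¹
     ≤ 2 * ((Fintype.card Fq : ℝ)^r * ((Fintype.card Fq : ℝ)^(j * D))⁻¹) := by
  have hq := q_pos (Fq := Fq)
  have hq2 := q_ge2 (Fq := Fq)
  simp_rw [Finset.sum_filter]
  rw [sum_pf]
  have e : ∀ S ∈ SS Fq r, (Fintype.card Fq ^ (r - dl S)) • (if D ≤ dl S then ((Fintype.card Fq : ℝ)^(j * dl S))⁻¹ else 0)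
      = if D ≤ dl S then (Fintype.card Fq : ℝ)^r * ((Fintype.card Fq : ℝ)^((j+1) * dl S))⁻¹ else 0 := by
    intro S hS
    rw [mem_SS] at hS
    rw [nsmul_eq_mul]
    push_cast
    rw [pow_sub₀ _ hq.ne' hS]
    split_ifs
    · rw [mul_assoc, ← mul_inv, ← pow_add]; ring_nf
    · simp
  rw [Finset.sum_congr rfl e, ← Finset.sum_filter]
  apply sum_SS_tail r D _ (by positivity) (fun k => (Fintype.card Fq : ℝ)^r * ((Fintype.card Fq : ℝ)^((j+1) * k))⁻¹)
  · intro k; positivity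
  · intro k hk
    have e2 : (Fintype.card Fq : ℝ)^k * ((Fintype.card Fq : ℝ)^r * ((Fintype.card Fq : ℝ)^((j+1) * k))⁻¹) =
        (Fintype.card Fq : ℝ)^r * ((Fintype.card Fq : ℝ)^(j * D))⁻¹ * ((Fintype.card Fq : ℝ)^(j * (k - D)))⁻¹ := by
      obtain ⟨c, rfl⟩ := Nat.exists_eq_add_of_le hk
      rw [Nat.add_sub_cancel_left]
      field_simp
      ring
    rw [e2]
    apply mul_le_mul_of_nonneg_left _ (by positivity)
    rw [one_div, inv_pow]
    apply inv_anti₀ (by positivity)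
    calc (2:ℝ)^(k-D) ≤ (Fintype.card Fq : ℝ)^(k-D) := by gcongr
      _ ≤ _ := by
        apply pow_le_pow_right₀ (by linarith)
        nlinarith [Nat.zero_le (k - D)]

lemma main_sieve (L : Finset Fq) {r m K : ℕ} {s : ℝ} (hs : 1 ≤ s) (hsq : s ^ 2 = (Fintype.card Fq : ℝ))
    (h1 : 2 * m ≤ K + 1) (h2 : r + m ≤ K) (h3 : 2 * r ≤ K) :
    |∑ N ∈ Mon Fq r, ∑ a ∈ Mon Fq m, TT' L K N a -
      L.card * (Fintype.card Fq : ℝ)^(K + m) * ∑ N ∈ Mon Fq r, Phi 1 N * Phi 2 N| ≤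
      L.card * (2 * (m + 1) * s ^ (K + 3 * m + 2 * r) + 2 * s ^ (2 * K + 2 * r)) := by
  have hq := q_pos (Fq := Fq)
  set q : ℝ := (Fintype.card Fq : ℝ) with hqd
  have hN : ∀ N ∈ Mon Fq r, |∑ a ∈ Mon Fq m, TT' L K N a - L.card * q^(K + m) * (Phi 1 N * Phi 2 N)| ≤
     L.card * q ^ K * ((m+1) * q ^ m) * (∑ S ∈ (pf N).powerset.filter (fun S => (K-m)/2+1 ≤ dl S), (q^(1 * dl S))⁻¹)
     + L.card * q ^ K * (q ^ m * ∑ S ∈ (pf N).powerset.filter (fun S => m/2+1 ≤ dl S), (q^(2 * dl S))⁻¹) := by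
    intro N hN
    have c1 : ∀ S : Finset (Pr Fq), ((K-m)/2+1 ≤ dl S ↔ K < m + 2 * dl S) := fun S => by omega
    have c2 : ∀ S : Finset (Pr Fq), (m/2+1 ≤ dl S ↔ m < 2 * dl S) := fun S => by omega
    simp_rw [c1, c2, one_mul]
    have hsum : ∑ a ∈ Mon Fq m, TT' L K N a = ∑ a ∈ (Mon Fq m).filter (sqc N), TT' L K N a := by
      rw [Finset.sum_filter]
      apply Finset.sum_congr rfl
      intro a _
      split_ifs with h
      · rfl
      · exact T_zero L K h
    have hc := sqc_count m hN
    rw [← hqd] at hc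
    have A1 : |∑ a ∈ (Mon Fq m).filter (sqc N), (TT' L K N a - L.card * q ^ K * Phi 1 N)| ≤
       ∑ a ∈ Mon Fq m, ((mdiv a).card : ℝ) * (L.card * q^K * ∑ S ∈ (pf N).powerset.filter (fun S => K < m + 2 * dl S), (q^(dl S))⁻¹) := by
      refine (Finset.abs_sum_le_sum_abs _ _).trans ?_
      refine (Finset.sum_le_sum (g := fun a => ((mdiv a).card : ℝ) * (L.card * q^K * ∑ S ∈ (pf N).powerset.filter (fun S => K < m + 2 * dl S), (q^(dl S))⁻¹)) fun a ha => ?_).trans ?_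
      · rw [Finset.mem_filter] at ha
        exact T_est L hN ha.1 ha.2 h1 h2 h3
      · apply Finset.sum_le_sum_of_subset_of_nonneg (Finset.filter_subset _ _)
        intro a _ _
        positivity
    have hmd : ∑ a ∈ Mon Fq m, ((mdiv a).card : ℝ) = (m+1) * q ^ m := by
      have := sum_mdiv (Fq := Fq) m
      rw [hqd]; exact_mod_cast this
    rw [← Finset.sum_mul, hmd, Finset.sum_sub_distrib, Finset.sum_const, nsmul_eq_mul] at A1
    rw [hsum]
    have A2 : |L.card * q ^ K * Phi 1 N * ((((Mon Fq m).filter (sqc N)).card : ℝ) - q^m * Phi 2 N)| ≤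
       L.card * q ^ K * (q^m * ∑ S ∈ (pf N).powerset.filter (fun S => m < 2 * dl S), (q^(2 * dl S))⁻¹) := by
      rw [abs_mul, abs_mul, abs_of_nonneg (show (0:ℝ) ≤ L.card * q ^ K by positivity)]
      apply mul_le_mul _ hc (abs_nonneg _) (by positivity)
      exact mul_le_of_le_one_right (by positivity) (Phi_bd 1 N)
    have A3 := (abs_add_le _ _).trans (add_le_add A1 A2)
    refine le_trans (le_of_eq ?_) (A3.trans (le_of_eq ?_))
    · congr 1; rw [pow_add]; ring
    · ring
  rw [Finset.mul_sum, ← Finset.sum_sub_distrib]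
  refine (Finset.abs_sum_le_sum_abs _ _).trans ((Finset.sum_le_sum hN).trans ?_)
  rw [Finset.sum_add_distrib, ← Finset.mul_sum]
  simp_rw [← mul_assoc]
  rw [← Finset.mul_sum]
  have t1 := tail_sum (Fq := Fq) r ((K-m)/2+1) 1 le_rfl
  have t2 := tail_sum (Fq := Fq) r (m/2+1) 2 (by norm_num)
  rw [← hqd] at t1 t2
  have b1 : (q ^ (1 * ((K-m)/2+1)))⁻¹ ≤ s ^ m * (s ^ K)⁻¹ := by
    rw [← hsq, ← pow_mul, inv_le_comm₀ (by positivity) (by positivity), mul_inv, inv_inv, mul_comm, ← pow_sub₀ _ (by positivity) (by omega)]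
    exact pow_le_pow_right₀ hs (by omega)
  have b2 : (q ^ (2 * (m/2+1)))⁻¹ ≤ (q ^ m)⁻¹ := by
    apply inv_anti₀ (by positivity)
    apply pow_le_pow_right₀ (by rw [← hsq]; exact one_le_pow₀ hs) (by omega)
  have hs0 : 0 < s := by linarith
  have T1 := mul_le_mul_of_nonneg_left (t1.trans (mul_le_mul_of_nonneg_left (mul_le_mul_of_nonneg_left b1 (show 0 ≤ q ^ r by positivity)) (show (0:ℝ) ≤ 2 by norm_num))) (show 0 ≤ L.card * q ^ K * (m+1) * q ^ m by positivity)
  have T2 := mul_le_mul_of_nonneg_left (t2.trans (mul_le_mul_of_nonneg_left (mul_le_mul_of_nonneg_left b2 (show 0 ≤ q ^ r by positivity)) (show (0:ℝ) ≤ 2 by norm_num))) (show 0 ≤ L.card * q ^ K * q ^ m by positivity)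
  refine (add_le_add T1 T2).trans (le_of_eq ?_)
  rw [← hsq]
  field_simp
  ring

end Helpers6c
end EvenChar

set_option linter.unusedSectionVars false
set_option linter.unusedVariables false
namespace EvenChar
section Helpers7
open scoped Classical
variable {Fq : Type} [Field Fq] [Fintype Fq] [CharP Fq 2]

/-- inverse norm -/
def xP (P : Pr Fq) : ℝ := ((Fintype.card Fq : ℝ) ^ P.1.natDegree)⁻¹

lemma xP_pos (P : Pr Fq) : 0 < xP P := by
  have := q_pos (Fq := Fq)
  unfold xP; positivity

lemma xP_le (P : Pr Fq) : xP P ≤ 1 :=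
  inv_le_one_of_one_le₀ (one_le_pow₀ (by linarith [q_ge2 (Fq := Fq)]))

lemma prod_xP (S : Finset (Pr Fq)) : ∏ P ∈ S, xP P = ((Fintype.card Fq : ℝ) ^ dl S)⁻¹ := by
  unfold xP
  rw [Finset.prod_inv_distrib, Finset.prod_pow_eq_pow_sum, dl]

lemma summable_Pr (F : ℕ → ℝ) (h0 : ∀ k, 0 ≤ F k) (hs : Summable (fun k => (Fintype.card Fq : ℝ) ^ k * F k)) :
    Summable (fun P : Pr Fq => F P.1.natDegree) := by
  have hq := q_pos (Fq := Fq)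
  apply summable_of_sum_le (c := ∑' k, (Fintype.card Fq : ℝ) ^ k * F k) (fun P => h0 _)
  intro u
  rw [← Finset.sum_fiberwise_of_maps_to (t := u.image (fun P => P.1.natDegree)) (g := fun P : Pr Fq => P.1.natDegree)
    (fun P hP => Finset.mem_image_of_mem _ hP)]
  refine le_trans (Finset.sum_le_sum fun k _ => ?_) (hs.sum_le_tsum _ (fun k _ => by have := h0 k; positivity))
  have e : ∀ P ∈ u.filter (fun P => P.1.natDegree = k), F P.1.natDegree = F k := by
    intro P hP
    rw [(Finset.mem_filter.1 hP).2]
  rw [Finset.sum_congr rfl e, Finset.sum_const, nsmul_eq_mul]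
  apply mul_le_mul_of_nonneg_right _ (h0 k)
  have : (u.filter (fun P => P.1.natDegree = k)).card ≤ (Mon Fq k).card := by
    apply Finset.card_le_card_of_injOn (fun P => P.1)
    · intro P hP
      rw [Finset.mem_coe, Finset.mem_filter] at hP
      rw [Finset.mem_coe, mem_Mon]
      exact ⟨P.2.1, hP.2⟩
    · intro P _ Q _ h
      exact Subtype.ext h
  rw [card_Mon] at this
  exact_mod_cast this

lemma summable_xP_sq : Summable (fun P : Pr Fq => xP P ^ 2) := by
  have hq := q_pos (Fq := Fq)
  have hq2 := q_ge2 (Fq := Fq)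
  apply summable_Pr (fun k => (((Fintype.card Fq : ℝ) ^ k)⁻¹) ^ 2) (fun k => by positivity)
  have : Summable (fun k : ℕ => ((Fintype.card Fq : ℝ)⁻¹) ^ k) :=
    summable_geometric_of_lt_one (by positivity) (inv_lt_one_of_one_lt₀ (by linarith))
  apply this.congr
  intro k
  rw [inv_pow]; field_simp

lemma moebius_sum (r : ℕ) : ∑ S ∈ SS Fq (r+1), (-1:ℝ)^S.card * ((Fintype.card Fq : ℝ)^(dl S))⁻¹ = 0 := by
  have hq := q_pos (Fq := Fq)
  have h := sum_pf (Fq := Fq) (r+1) (fun S => (-1:ℝ)^S.card)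
  have h0 : ∀ N ∈ Mon Fq (r+1), ∑ S ∈ (pf N).powerset, (-1:ℝ)^S.card = 0 := by
    intro N hN
    rw [mem_Mon] at hN
    have hne : (pf N).Nonempty := by
      have : ¬ IsUnit N := fun h => by
        have := natDegree_eq_zero_of_isUnit h
        omega
      obtain ⟨p, hp, hpN⟩ := WfDvdMonoid.exists_irreducible_factor this hN.1.ne_zero
      obtain ⟨Q, hQ⟩ := exists_Pr hp
      exact ⟨Q, (mem_pf hN.1.ne_zero).2 (hQ.symm.dvd.trans hpN)⟩
    have h2 := Finset.sum_powerset_neg_one_pow_card_of_nonempty hne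
    have h3 : (∑ S ∈ (pf N).powerset, (-1:ℝ)^S.card) = ((∑ S ∈ (pf N).powerset, (-1:ℤ)^S.card : ℤ) : ℝ) := by
      push_cast; rfl
    rw [h3, h2]; simp
  rw [Finset.sum_eq_zero h0] at h
  have h1 : (Fintype.card Fq : ℝ)^(r+1) * ∑ S ∈ SS Fq (r+1), (-1:ℝ)^S.card * ((Fintype.card Fq : ℝ)^(dl S))⁻¹ = 0 := by
    rw [h, Finset.mul_sum]
    apply Finset.sum_congr rfl
    intro S hS
    rw [mem_SS] at hS
    rw [nsmul_eq_mul]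
    push_cast
    rw [pow_sub₀ _ hq.ne' hS]; ring
  exact (mul_eq_zero.1 h1).resolve_left (by positivity)

lemma SS_succ {M : Type*} [AddCommMonoid M] (r : ℕ) (F : Finset (Pr Fq) → M) :
    ∑ S ∈ SS Fq (r+1), F S = ∑ S ∈ SS Fq r, F S + ∑ S ∈ (SS Fq (r+1)).filter (fun S => dl S = r+1), F S := by
  rw [← Finset.sum_filter_add_sum_filter_not (SS Fq (r+1)) (fun S => dl S ≠ r+1)]
  congr 1
  · apply Finset.sum_congr _ (fun _ _ => rfl)
    ext S
    simp only [Finset.mem_filter, mem_SS]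
    omega
  · apply Finset.sum_congr _ (fun _ _ => rfl)
    ext S
    simp only [Finset.mem_filter, mem_SS]
    omega

lemma SS_zero {M : Type*} [AddCommMonoid M] (F : Finset (Pr Fq) → M) : ∑ S ∈ SS Fq 0, F S = F ∅ := by
  have : SS Fq 0 = {∅} := by
    ext S
    rw [mem_SS, Finset.mem_singleton]
    constructor
    · intro h
      rw [Finset.eq_empty_iff_forall_notMem]
      intro P hP
      have h1 : P.1.natDegree ≤ dl S := Finset.single_le_sum (f := fun P : Pr Fq => P.1.natDegree) (fun _ _ => Nat.zero_le _) hP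
      have := Pr_pos P
      omega
    · rintro rfl; simp [dl]
  rw [this, Finset.sum_singleton]

lemma moebius_slice (r : ℕ) (j : ℕ) : ∑ S ∈ (SS Fq r).filter (fun S => dl S = r), (-1:ℝ)^S.card * ((Fintype.card Fq : ℝ)^(j * dl S))⁻¹
    = (∑ S ∈ (SS Fq r).filter (fun S => dl S = r), (-1:ℝ)^S.card) * ((Fintype.card Fq : ℝ)^(j * r))⁻¹ := by
  rw [Finset.sum_mul]
  apply Finset.sum_congr rfl
  intro S hS
  rw [(Finset.mem_filter.1 hS).2]

lemma moebius_one : ∑ S ∈ (SS Fq 1).filter (fun S => dl S = 1), (-1:ℝ)^S.card = -(Fintype.card Fq : ℝ) := by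
  have hq := q_pos (Fq := Fq)
  have h := moebius_sum (Fq := Fq) 0
  rw [SS_succ, SS_zero] at h
  have h2 := moebius_slice (Fq := Fq) 1 1
  simp only [one_mul, zero_add] at h2 h
  rw [h2] at h
  set Y := ∑ S ∈ (SS Fq 1).filter (fun S => dl S = 1), (-1:ℝ)^S.card with hY
  have hd : dl (∅ : Finset (Pr Fq)) = 0 := by simp [dl]
  rw [hd, Finset.card_empty, pow_zero, pow_zero, pow_one] at h
  field_simp at h
  linarith

lemma moebius_big (r : ℕ) : ∑ S ∈ (SS Fq (r+2)).filter (fun S => dl S = r+2), (-1:ℝ)^S.card = 0 := by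
  have hq := q_pos (Fq := Fq)
  have h := moebius_sum (Fq := Fq) (r+1)
  rw [SS_succ, moebius_sum] at h
  have h2 := moebius_slice (Fq := Fq) (r+2) 1
  simp only [one_mul] at h2
  rw [zero_add, h2] at h
  exact (mul_eq_zero.1 h).resolve_right (by positivity)

lemma moebius_two (r : ℕ) : ∑ S ∈ SS Fq (r+1), (-1:ℝ)^S.card * ((Fintype.card Fq : ℝ)^(2 * dl S))⁻¹ = 1 - (Fintype.card Fq : ℝ)⁻¹ := by
  have hq := q_pos (Fq := Fq)
  induction r with
  | zero =>
    rw [SS_succ, SS_zero]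
    have h2 := moebius_slice (Fq := Fq) 1 2
    simp only [zero_add]
    rw [h2, moebius_one]
    simp [dl]
    field_simp
    ring
  | succ r ih =>
    rw [SS_succ, ih, moebius_slice, moebius_big]; ring

lemma tprod_sq : ∏' P : Pr Fq, (1 + -(xP P ^ 2)) = 1 - (Fintype.card Fq : ℝ)⁻¹ := by
  have hsum : Summable (fun S : Finset (Pr Fq) => ∏ P ∈ S, -(xP P ^ 2)) := by
    apply summable_finsetProd_of_summable_norm
    apply (summable_xP_sq (Fq := Fq)).congr
    intro P
    rw [norm_neg, Real.norm_eq_abs, abs_of_nonneg (by positivity)]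
  rw [tprod_one_add hsum]
  have ht := hsum.hasSum.comp (Filter.tendsto_atTop_finset_of_monotone (f := SS Fq)
    (fun a b h S hS => by rw [mem_SS] at hS ⊢; omega) (fun S => ⟨dl S, by rw [mem_SS]⟩))
  have ht2 := ht.comp (Filter.tendsto_add_atTop_nat 1)
  refine tendsto_nhds_unique ht2 ?_
  refine tendsto_const_nhds.congr fun r => ?_
  simp only [Function.comp]
  rw [← moebius_two r]
  apply Finset.sum_congr rfl
  intro S _
  rw [Finset.prod_neg, Finset.prod_pow, prod_xP, inv_pow, ← pow_mul, mul_comm 2]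

lemma euler_sum {s : ℝ} (hs : 1 < s) (hsq : s ^ 2 = (Fintype.card Fq : ℝ)) :
    ∃ C : ℝ, 0 ≤ C ∧ ∀ r : ℕ, |∑ N ∈ Mon Fq r, Phi 1 N * Phi 2 N - (Fintype.card Fq : ℝ)^r * ((1 - (Fintype.card Fq : ℝ)⁻¹) * eulerPR Fq 2)|
      ≤ C * s ^ r := by
  have hq := q_pos (Fq := Fq)
  have hs0 : 0 < s := by linarith
  set q : ℝ := (Fintype.card Fq : ℝ) with hqd
  let f : Pr Fq → ℝ := fun P => -xP P - xP P ^ 2 + xP P ^ 3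
  let c : Pr Fq → ℝ := fun P => f P * xP P
  let b : Pr Fq → ℝ := fun P => 2 * (s ^ (3 * P.1.natDegree))⁻¹
  have hxs : ∀ P : Pr Fq, xP P = (s ^ (2 * P.1.natDegree))⁻¹ := by
    intro P; rw [xP, ← hqd, ← hsq, ← pow_mul]
  have hcb : ∀ P, |c P| ≤ b P * (s ^ P.1.natDegree)⁻¹ := by
    intro P
    have h1 := xP_pos P
    have h2 := xP_le P
    have e : b P * (s ^ P.1.natDegree)⁻¹ = 2 * xP P ^ 2 := by
      simp only [b]
      rw [hxs, inv_pow, ← pow_mul, mul_assoc, ← mul_inv, ← pow_add]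
      congr 3; ring
    rw [e]
    simp only [c, f]
    rw [abs_le]
    have h3 : 0 ≤ xP P ^ 2 * (1 - xP P) := mul_nonneg (by positivity) (by linarith)
    have h4 : 0 ≤ xP P ^ 3 := by positivity
    have h5 : 0 ≤ xP P ^ 3 * (1 - xP P) := mul_nonneg (by positivity) (by linarith)
    have h6 : 0 ≤ xP P ^ 4 := by positivity
    constructor <;> nlinarith
  have hb0 : ∀ P, 0 ≤ b P := fun P => by simp only [b]; positivity
  have hbs : Summable b := by
    apply Summable.mul_left
    apply summable_Pr (fun k => (s ^ (3 * k))⁻¹) (fun k => by positivity)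
    have : Summable (fun k : ℕ => (s⁻¹) ^ k) :=
      summable_geometric_of_lt_one (by positivity) (inv_lt_one_of_one_lt₀ hs)
    apply this.congr
    intro k
    rw [← hqd, ← hsq, inv_pow, ← pow_mul]
    field_simp
    rw [← pow_add]; congr 1; ring
  have hB : Summable (fun S : Finset (Pr Fq) => ∏ P ∈ S, b P) := by
    apply summable_finsetProd_of_summable_norm
    apply hbs.congr
    intro P; rw [Real.norm_eq_abs, abs_of_nonneg (hb0 P)]
  have hcn : Summable (fun P => ‖c P‖) := by
    apply Summable.of_nonneg_of_le (fun P => norm_nonneg _) _ hbs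
    intro P
    refine (hcb P).trans (mul_le_of_le_one_right (hb0 P) (inv_le_one_of_one_le₀ (one_le_pow₀ hs.le)))
  have hC : Summable (fun S : Finset (Pr Fq) => ∏ P ∈ S, c P) := summable_finsetProd_of_summable_norm hcn
  have hprod : ∏' P, (1 + c P) = (1 - q⁻¹) * eulerPR Fq 2 := by
    rw [← tprod_sq]
    unfold eulerPR
    rw [← Multipliable.tprod_mul]
    · apply tprod_congr
      intro P
      have h1 := xP_pos P
      rw [Real.rpow_two, Real.rpow_natCast]
      have hx : (Fintype.card Fq : ℝ) ^ P.1.natDegree = (xP P)⁻¹ := by rw [xP, inv_inv]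
      rw [hx]
      simp only [c, f]
      field_simp
      ring
    · apply multipliable_one_add_of_summable
      apply (summable_xP_sq (Fq := Fq)).congr
      intro P
      rw [norm_neg, Real.norm_eq_abs, abs_of_nonneg (by positivity)]
    · simp_rw [sub_eq_add_neg]
      apply multipliable_one_add_of_summable
      apply Summable.of_nonneg_of_le (fun P => norm_nonneg _) _ (summable_xP_sq (Fq := Fq))
      intro P
      have h1 := xP_pos P
      rw [Real.rpow_two, Real.rpow_natCast, norm_neg, Real.norm_eq_abs, abs_of_nonneg (by positivity), xP, inv_pow]
      apply inv_anti₀ (by positivity)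
      have : 0 ≤ (Fintype.card Fq : ℝ) ^ P.1.natDegree := by positivity
      nlinarith [mul_nonneg this (sq_nonneg ((Fintype.card Fq : ℝ) ^ P.1.natDegree))]
  rw [tprod_one_add hC] at hprod
  refine ⟨∑' S : Finset (Pr Fq), ∏ P ∈ S, b P, tsum_nonneg fun S => Finset.prod_nonneg fun P _ => hb0 P, fun r => ?_⟩
  have hN : ∑ N ∈ Mon Fq r, Phi 1 N * Phi 2 N = q ^ r * ∑ S ∈ SS Fq r, ∏ P ∈ S, c P := by
    have e1 : ∀ N : Fq[X], Phi 1 N * Phi 2 N = ∑ S ∈ (pf N).powerset, ∏ P ∈ S, f P := by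
      intro N
      unfold Phi
      rw [← Finset.prod_mul_distrib, ← Finset.prod_one_add]
      apply Finset.prod_congr rfl
      intro P _
      simp only [f]
      have e2 : ((Fintype.card Fq : ℝ)^(2 * P.1.natDegree))⁻¹ = xP P ^ 2 := by
        rw [xP, inv_pow, ← pow_mul, mul_comm]
      rw [e2, one_mul, ← xP]
      ring
    simp_rw [e1]
    rw [sum_pf, Finset.mul_sum]
    apply Finset.sum_congr rfl
    intro S hS
    rw [mem_SS] at hS
    rw [nsmul_eq_mul]
    simp only [c]
    rw [Finset.prod_mul_distrib, prod_xP]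
    push_cast
    rw [← hqd, pow_sub₀ _ hq.ne' hS]; ring
  rw [hN, ← hprod, ← hC.sum_add_tsum_compl (s := SS Fq r), ← mul_sub, sub_add_cancel_left, mul_neg, abs_neg, abs_mul, abs_of_nonneg (by positivity)]
  have hBs := (hB.mul_left ((s ^ r)⁻¹))
  have hbd : |∑' x : ((↑(SS Fq r) : Set (Finset (Pr Fq)))ᶜ : Set (Finset (Pr Fq))), ∏ P ∈ x.1, c P| ≤ (s ^ r)⁻¹ * ∑' S : Finset (Pr Fq), ∏ P ∈ S, b P := by
    rw [← tsum_mul_left]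
    rw [← Real.norm_eq_abs]
    refine (tsum_of_norm_bounded (E := ℝ) ((hBs.subtype ((↑(SS Fq r) : Set (Finset (Pr Fq)))ᶜ)).hasSum) ?_).trans (Summable.tsum_subtype_le (fun S : Finset (Pr Fq) => (s ^ r)⁻¹ * ∏ P ∈ S, b P) _ (fun S => mul_nonneg (by positivity) (Finset.prod_nonneg fun P _ => hb0 P)) hBs)
    rintro ⟨S, hS⟩
    replace hS : ¬ dl S ≤ r := fun h => hS (Finset.mem_coe.2 (mem_SS.2 h))
    simp only [Function.comp]
    rw [Real.norm_eq_abs, Finset.abs_prod]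
    calc ∏ P ∈ S, |c P| ≤ ∏ P ∈ S, (b P * (s ^ P.1.natDegree)⁻¹) :=
          Finset.prod_le_prod (fun P _ => abs_nonneg _) (fun P _ => hcb P)
      _ = (∏ P ∈ S, b P) * (s ^ dl S)⁻¹ := by
          rw [Finset.prod_mul_distrib, Finset.prod_inv_distrib, Finset.prod_pow_eq_pow_sum, dl]
      _ ≤ (∏ P ∈ S, b P) * (s ^ r)⁻¹ := by
          apply mul_le_mul_of_nonneg_left _ (Finset.prod_nonneg fun P _ => hb0 P)
          apply inv_anti₀ (by positivity)
          exact pow_le_pow_right₀ hs.le (by omega)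
      _ = _ := mul_comm _ _
  refine (mul_le_mul_of_nonneg_left hbd (by positivity)).trans (le_of_eq ?_)
  rw [← hsq]
  field_simp
  ring

end Helpers7
end EvenChar

set_option linter.unusedSectionVars false
set_option linter.unusedVariables false
namespace EvenChar
section Helpers8
open scoped Classical
variable {Fq : Type} [Field Fq] [Fintype Fq] [CharP Fq 2]

lemma geo {y : ℝ} (hy : 4 / 3 ≤ y) (n : ℕ) : ∑ k ∈ Finset.range (n+1), y ^ k ≤ 4 * y ^ n := by
  induction n with
  | zero => simp
  | succ n ih =>
    rw [Finset.sum_range_succ]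
    have : 0 < y ^ n := by positivity
    rw [pow_succ]
    nlinarith

lemma geo' {s : ℝ} (hs : 4 / 3 ≤ s) (j n : ℕ) (hj : 1 ≤ j) : ∑ k ∈ Finset.range (n+1), s ^ (j * k) ≤ 4 * s ^ (j * n) := by
  simp_rw [pow_mul]
  apply geo
  exact hs.trans (le_self_pow₀ (by linarith) (by omega))

/-- error term -/
def er (s C : ℝ) (K r m : ℕ) : ℝ := 2 * (m + 1) * s ^ (K + 3 * m + 2 * r) + 2 * s ^ (2 * K + 2 * r) + C * s ^ (2 * K + 2 * m + r)

lemma block {s : ℝ} (hs : 1 < s) (hsq : s ^ 2 = (Fintype.card Fq : ℝ)) :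
    ∃ C : ℝ, 0 ≤ C ∧ ∀ (L : Finset Fq) (r m K : ℕ), 2 * m ≤ K + 1 → r + m ≤ K → 2 * r ≤ K →
    |∑ N ∈ Mon Fq r, ∑ a ∈ Mon Fq m, TT' L K N a -
      L.card * (Fintype.card Fq : ℝ)^(K + m + r) * ((1 - (Fintype.card Fq : ℝ)⁻¹) * eulerPR Fq 2)| ≤ L.card * er s C K r m := by
  obtain ⟨C, hC, h⟩ := euler_sum (Fq := Fq) hs hsq
  refine ⟨C, hC, fun L r m K h1 h2 h3 => ?_⟩
  have hq := q_pos (Fq := Fq)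
  have A := main_sieve L hs.le hsq h1 h2 h3
  have B := mul_le_mul_of_nonneg_left (h r) (show 0 ≤ L.card * (Fintype.card Fq : ℝ)^(K + m) by positivity)
  rw [← abs_of_nonneg (show 0 ≤ L.card * (Fintype.card Fq : ℝ)^(K + m) by positivity), ← abs_mul, abs_of_nonneg (show 0 ≤ L.card * (Fintype.card Fq : ℝ)^(K + m) by positivity)] at B
  refine le_trans (le_of_eq ?_) ((abs_add_le _ _).trans ((add_le_add A B).trans (le_of_eq ?_)))
  · congr 1; rw [pow_add _ (K+m) r]; ring
  · rw [← hsq, er]; ring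

lemma RR_sum (L : Finset Fq) (K g : ℕ) (N : Fq[X]) : ∑ E ∈ (LD L K).filter (Smooth N), (RR g N E : ℝ) =
    ∑ m ∈ Finset.range (g+1), ∑ a ∈ Mon Fq m, TT' L K N a := by
  unfold RR TT'
  push_cast
  rw [Finset.sum_comm]
  apply Finset.sum_congr rfl
  intro m _
  rw [Finset.sum_comm]

lemma final_R {s : ℝ} (hs : 4 / 3 ≤ s) (hsq : s ^ 2 = (Fintype.card Fq : ℝ)) (ξ : Fq) (hξ : ∀ x : Fq, x ^ 2 + x ≠ ξ) :
    ∃ C : ℝ, 0 ≤ C ∧ ∀ g : ℕ, 1 ≤ g →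
      |(∑' u : (Ifam ξ (g + 1) : Set (RatFunc Fq)), (hClass u.1 : ℝ)) -
          2 * eulerPR Fq 2 * (Fintype.card Fq : ℝ) ^ (3 * g + 1)| ≤ C * g * s ^ (5 * g) := by
  obtain ⟨C, hC, hb⟩ := block (Fq := Fq) (by linarith : 1 < s) hsq
  have hq := q_pos (Fq := Fq)
  have hq2 := q_ge2 (Fq := Fq)
  set q : ℝ := (Fintype.card Fq : ℝ) with hqd
  set P := eulerPR Fq 2 with hP
  have hs0 : 0 < s := by linarith
  have hs1 : 1 ≤ s := by linarith
  refine ⟨2 * (2 * (q - 1) * (40 + 16 * C) + 4 * |P|), by have := abs_nonneg P; have : 0 ≤ q - 1 := by linarith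
                                                          positivity, fun g hg => ?_⟩
  have hR := sum_R (Fq := Fq) g hξ
  rw [← hqd] at hR
  set H := (∑' u : (Ifam ξ (g + 1) : Set (RatFunc Fq)), (hClass u.1 : ℝ)) with hH
  set L : Finset Fq := Finset.univ \ {0} with hL
  have hLc : (L.card : ℝ) = q - 1 := by
    rw [hL, Finset.card_sdiff]
    simp
    rw [Nat.cast_sub (by have := two_le_q (Fq := Fq); omega)]
    simp [hqd]
  have hR2 : q ^ (g+1) * H = 2 * ∑ r ∈ Finset.range (g+1), ∑ m ∈ Finset.range (g+1), ∑ N ∈ Mon Fq r, ∑ a ∈ Mon Fq m, TT' L (2*g+1) N a := by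
    rw [hR]
    congr 1
    apply Finset.sum_congr rfl
    intro r _
    rw [Finset.sum_comm]
    apply Finset.sum_congr rfl
    intro N _
    exact RR_sum L (2*g+1) g N
  have hZ : (q - 1) * ∑ k ∈ Finset.range (g+1), q ^ k = q ^ (g+1) - 1 := by
    rw [mul_comm]; exact geom_sum_mul q (g+1)
  have hmain : ∑ r ∈ Finset.range (g+1), ∑ m ∈ Finset.range (g+1), (L.card * q^(2*g+1 + m + r) * ((1 - q⁻¹) * P)) = q^(2*g) * P * (q^(g+1)-1)^2 := by
    rw [← hZ, hLc]
    have e : ∀ r m : ℕ, (q - 1) * q^(2*g+1 + m + r) * ((1 - q⁻¹) * P) = ((q-1)^2 * q^(2*g) * P) * (q ^ r * q ^ m) := by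
      intro r m
      field_simp
      ring
    simp_rw [e, ← Finset.mul_sum, ← Finset.sum_mul]
    ring
  have herr : |∑ r ∈ Finset.range (g+1), ∑ m ∈ Finset.range (g+1), (∑ N ∈ Mon Fq r, ∑ a ∈ Mon Fq m, TT' L (2*g+1) N a - L.card * q^(2*g+1 + m + r) * ((1 - q⁻¹) * P))|
      ≤ (q - 1) * ((g+1) * s ^ (7*g+2) * (40 + 16 * C)) := by
    calc _ ≤ ∑ r ∈ Finset.range (g+1), ∑ m ∈ Finset.range (g+1), (q - 1) * er s C (2*g+1) r m := by
          refine (Finset.abs_sum_le_sum_abs _ _).trans (Finset.sum_le_sum fun r hr => ?_)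
          refine (Finset.abs_sum_le_sum_abs _ _).trans (Finset.sum_le_sum fun m hm => ?_)
          rw [Finset.mem_range] at hr hm
          rw [← hLc]
          exact hb L r m (2*g+1) (by omega) (by omega) (by omega)
      _ = (q - 1) * ∑ r ∈ Finset.range (g+1), ∑ m ∈ Finset.range (g+1), er s C (2*g+1) r m := by
          simp_rw [Finset.mul_sum]
      _ ≤ _ := by
          apply mul_le_mul_of_nonneg_left _ (by linarith)
          have e1 : ∀ r ∈ Finset.range (g+1), ∀ m ∈ Finset.range (g+1), er s C (2*g+1) r m ≤
              (2 * (g+1) * s ^ (2*g+1)) * (s ^ (2 * r) * s ^ (3 * m)) + (2 * s ^ (4*g+2)) * (s ^ (2*r) * 1) + (C * s ^ (4*g+2)) * (s ^ (1 * r) * s ^ (2 * m)) := by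
            intro r hr m hm
            rw [Finset.mem_range] at hr hm
            have hm' : (m:ℝ) ≤ g := by exact_mod_cast (by omega)
            have : 2 * ((m:ℝ) + 1) * s ^ (2*g+1 + 3 * m + 2 * r) ≤ 2 * (g+1) * s ^ (2*g+1 + 3 * m + 2 * r) := by gcongr
            unfold er
            refine (add_le_add (add_le_add this le_rfl) le_rfl).trans (le_of_eq ?_)
            ring
          refine (Finset.sum_le_sum fun r hr => Finset.sum_le_sum fun m hm => e1 r hr m hm).trans ?_
          simp_rw [Finset.sum_add_distrib, ← Finset.mul_sum, ← Finset.sum_mul]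
          have g1 := geo' hs 1 g le_rfl
          have g2 := geo' hs 2 g (by norm_num)
          have g3 := geo' hs 3 g (by norm_num)
          have n2 : 0 ≤ ∑ k ∈ Finset.range (g+1), s ^ (2 * k) := Finset.sum_nonneg fun k _ => by positivity
          have n3 : 0 ≤ ∑ k ∈ Finset.range (g+1), s ^ (3 * k) := Finset.sum_nonneg fun k _ => by positivity
          have p1 : (2 * (g+1) * s ^ (2*g+1)) * ((∑ k ∈ Finset.range (g+1), s ^ (2 * k)) * ∑ k ∈ Finset.range (g+1), s ^ (3 * k)) ≤
              (2 * (g+1) * s ^ (2*g+1)) * ((4 * s ^ (2 * g)) * (4 * s ^ (3 * g))) := by gcongr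
          have p2 : (2 * s ^ (4*g+2)) * ((∑ k ∈ Finset.range (g+1), s ^ (2 * k)) * ∑ k ∈ Finset.range (g+1), (1:ℝ)) ≤
              (2 * s ^ (4*g+2)) * ((4 * s ^ (2 * g)) * (g+1)) := by
            rw [Finset.sum_const, Finset.card_range, nsmul_eq_mul, mul_one]
            push_cast
            gcongr
          have p3 : (C * s ^ (4*g+2)) * ((∑ k ∈ Finset.range (g+1), s ^ (1 * k)) * ∑ k ∈ Finset.range (g+1), s ^ (2 * k)) ≤
              (C * s ^ (4*g+2)) * ((4 * s ^ (1 * g)) * (4 * s ^ (2 * g))) := by gcongr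
          refine (add_le_add (add_le_add p1 p2) p3).trans ?_
          have q1 : s ^ (7*g+1) ≤ s ^ (7*g+2) := pow_le_pow_right₀ hs1 (by omega)
          have q2 : s ^ (6*g+2) ≤ s ^ (7*g+2) := pow_le_pow_right₀ hs1 (by omega)
          have t1 : (2 * ((g:ℝ)+1) * s ^ (2*g+1)) * ((4 * s ^ (2 * g)) * (4 * s ^ (3 * g))) = 32 * (g+1) * s ^ (7*g+1) := by ring
          have t2 : (2 * s ^ (4*g+2)) * ((4 * s ^ (2 * g)) * ((g:ℝ)+1)) = 8 * (g+1) * s ^ (6*g+2) := by ring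
          have t3 : (C * s ^ (4*g+2)) * ((4 * s ^ (1 * g)) * (4 * s ^ (2 * g))) = 16 * C * 1 * s ^ (7*g+2) := by ring
          rw [t1, t2, t3]
          have u1 : 32 * ((g:ℝ)+1) * s ^ (7*g+1) ≤ 32 * (g+1) * s ^ (7*g+2) := by gcongr
          have u2 : 8 * ((g:ℝ)+1) * s ^ (6*g+2) ≤ 8 * (g+1) * s ^ (7*g+2) := by gcongr
          have u3 : 16 * C * 1 * s ^ (7*g+2) ≤ 16 * C * ((g:ℝ)+1) * s ^ (7*g+2) := by
            gcongr
            linarith [Nat.cast_nonneg (α := ℝ) g]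
          linarith
  simp_rw [Finset.sum_sub_distrib] at herr
  rw [hmain] at herr
  have hfin : q ^ (g+1) * |H - 2 * P * q ^ (3*g+1)| ≤ q ^ (g+1) * ((2 * (q - 1) * (40 + 16 * C) + 4 * |P|) * (g+1) * s ^ (5*g)) := by
    rw [← abs_of_nonneg (show 0 ≤ q ^ (g+1) by positivity), ← abs_mul, abs_of_nonneg (show 0 ≤ q ^ (g+1) by positivity), mul_sub, hR2]
    set X := ∑ r ∈ Finset.range (g+1), ∑ m ∈ Finset.range (g+1), ∑ N ∈ Mon Fq r, ∑ a ∈ Mon Fq m, TT' L (2*g+1) N a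
    have e1 : 2 * X - q ^ (g+1) * (2 * P * q ^ (3*g+1)) = 2 * (X - q^(2*g) * P * (q^(g+1)-1)^2) + 2 * P * (q ^ (2*g) * (1 - 2 * q^(g+1))) := by ring
    have hq1 : 1 ≤ q ^ (g+1) := one_le_pow₀ (by linarith)
    have e2 : |2 * P * (q ^ (2*g) * (1 - 2 * q^(g+1)))| ≤ 4 * |P| * s ^ (7*g+2) := by
      rw [abs_mul, abs_mul, abs_mul, abs_two, abs_of_nonneg (show 0 ≤ q ^ (2*g) by positivity), abs_of_nonpos (show 1 - 2 * q ^ (g+1) ≤ 0 by linarith)]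
      have : q ^ (2*g) * -(1 - 2 * q^(g+1)) ≤ 2 * s ^ (7*g+2) := by
        calc q ^ (2*g) * -(1 - 2 * q^(g+1)) ≤ q ^ (2*g) * (2 * q ^ (g+1)) := by gcongr; linarith
          _ = 2 * s ^ (6*g+2) := by rw [← hsq]; ring
          _ ≤ _ := by
            have : s ^ (6*g+2) ≤ s ^ (7*g+2) := pow_le_pow_right₀ hs1 (by omega)
            linarith
      calc _ ≤ 2 * |P| * (2 * s ^ (7*g+2)) := by gcongr
        _ = _ := by ring
    rw [e1]
    refine (abs_add_le _ _).trans ?_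
    rw [abs_mul, abs_two]
    have e3 : 4 * |P| * 1 * s ^ (7*g+2) ≤ 4 * |P| * ((g:ℝ) + 1) * s ^ (7*g+2) := by
      gcongr
      linarith [Nat.cast_nonneg (α := ℝ) g]
    have e4 : q ^ (g+1) * ((2 * (q - 1) * (40 + 16 * C) + 4 * |P|) * (g+1) * s ^ (5*g)) = (2 * (q - 1) * (40 + 16 * C) + 4 * |P|) * (g+1) * s ^ (7*g+2) := by
      have : q ^ (g+1) * s ^ (5*g) = s ^ (7*g+2) := by rw [← hsq]; ring
      rw [← this]; ring
    rw [e4]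
    linarith
  have hfin2 := le_of_mul_le_mul_left hfin (by positivity)
  refine hfin2.trans ?_
  have hg' : (g:ℝ) + 1 ≤ 2 * g := by
    have : (1:ℝ) ≤ g := by exact_mod_cast hg
    linarith
  have hq1 : 0 ≤ q - 1 := by linarith
  calc _ ≤ (2 * (q - 1) * (40 + 16 * C) + 4 * |P|) * (2 * g) * s ^ (5*g) := by gcongr
    _ = _ := by ring

end Helpers8
end EvenChar

set_option linter.unusedSectionVars false
set_option linter.unusedVariables false
namespace EvenChar
section Helpers9
open scoped Classical
variable {Fq : Type} [Field Fq] [Fintype Fq] [CharP Fq 2]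

lemma final_I {s : ℝ} (hs : 4 / 3 ≤ s) (hsq : s ^ 2 = (Fintype.card Fq : ℝ)) (ξ : Fq) (hξ : ∀ x : Fq, x ^ 2 + x ≠ ξ) :
    ∃ C : ℝ, 0 ≤ C ∧ ∀ g : ℕ, 1 ≤ g →
      |(∑' u : (F'fam ξ (g + 1) : Set (RatFunc Fq)), (hClass u.1 : ℝ)) -
          2 * ((Fintype.card Fq : ℝ) / ((Fintype.card Fq : ℝ) + 1)) * eulerPR Fq 2 *
            (Fintype.card Fq : ℝ) ^ (3 * g + 2)| ≤ C * g * s ^ (5 * g) := by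
  obtain ⟨C, hC, hb⟩ := block (Fq := Fq) (by linarith : 1 < s) hsq
  have hq := q_pos (Fq := Fq)
  have hq2 := q_ge2 (Fq := Fq)
  set q : ℝ := (Fintype.card Fq : ℝ) with hqd
  set P := eulerPR Fq 2 with hP
  have hs0 : 0 < s := by linarith
  have hs1 : 1 ≤ s := by linarith
  refine ⟨3 * (10 + 4 * C + |P|) * s ^ 5, by positivity, fun g hg => ?_⟩
  have hI := sum_I (Fq := Fq) g hξ
  rw [← hqd] at hI
  set H := (∑' u : (F'fam ξ (g + 1) : Set (RatFunc Fq)), (hClass u.1 : ℝ)) with hH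
  let B : ℕ → ℝ := fun m => ∑ N ∈ Mon Fq (g+1), ∑ a ∈ Mon Fq m, TT' {ξ} (2*g+2) N a
  let W : ℕ → ℝ := fun m => if m ≤ g then q + 1 else 1
  have hW0 : ∀ m, 0 ≤ W m := fun m => by simp only [W]; split_ifs <;> linarith
  have hW1 : ∀ m, W m ≤ q + 1 := fun m => by simp only [W]; split_ifs <;> linarith
  have hWr : ∀ (F : ℕ → ℝ), ∑ m ∈ Finset.range (g+2), W m * F m = (q+1) * ∑ m ∈ Finset.range (g+1), F m + F (g+1) := by
    intro F
    rw [Finset.sum_range_succ, Finset.mul_sum]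
    congr 1
    · apply Finset.sum_congr rfl
      intro m hm
      rw [Finset.mem_range] at hm
      simp only [W]; rw [if_pos (by omega)]
    · simp only [W]; rw [if_neg (by omega), one_mul]
  have hI2 : q ^ (g+1) * ((q+1) * H) = ∑ m ∈ Finset.range (g+2), W m * B m := by
    rw [hI, hWr]
    simp only [B]
    rw [Finset.sum_comm, Finset.mul_sum, ← Finset.sum_add_distrib]
    apply Finset.sum_congr rfl
    intro N _
    rw [Finset.sum_add_distrib, ← Finset.mul_sum, RR_sum]
    congr 1
    unfold TT'
    rw [Finset.sum_comm]
  have hZ : (q - 1) * ∑ k ∈ Finset.range (g+1), q ^ k = q ^ (g+1) - 1 := by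
    rw [mul_comm]; exact geom_sum_mul q (g+1)
  have hmain : ∑ m ∈ Finset.range (g+2), W m * (q^(2*g+2 + m + (g+1)) * ((1 - q⁻¹) * P)) = 2 * P * q ^ (4*g+4) - (q+1) * P * q ^ (3*g+2) := by
    rw [hWr]
    have e : ∀ m : ℕ, q^(2*g+2 + m + (g+1)) * ((1 - q⁻¹) * P) = (q^(3*g+2) * P) * ((q-1) * q ^ m) := by
      intro m
      field_simp
      ring
    simp_rw [e, ← Finset.mul_sum, hZ]
    ring
  have herr : |∑ m ∈ Finset.range (g+2), (W m * B m - W m * (q^(2*g+2 + m + (g+1)) * ((1 - q⁻¹) * P)))|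
      ≤ (q + 1) * ((g+2) * s ^ (7*g+7) * (10 + 4 * C)) := by
    calc _ ≤ ∑ m ∈ Finset.range (g+2), (q + 1) * er s C (2*g+2) (g+1) m := by
          refine (Finset.abs_sum_le_sum_abs _ _).trans (Finset.sum_le_sum fun m hm => ?_)
          rw [Finset.mem_range] at hm
          rw [← mul_sub, abs_mul, abs_of_nonneg (hW0 m)]
          have := hb {ξ} (g+1) m (2*g+2) (by omega) (by omega) (by omega)
          rw [Finset.card_singleton, Nat.cast_one, one_mul, one_mul] at this
          exact mul_le_mul (hW1 m) this (abs_nonneg _) (by linarith)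
      _ = (q + 1) * ∑ m ∈ Finset.range (g+2), er s C (2*g+2) (g+1) m := by
          rw [Finset.mul_sum]
      _ ≤ _ := by
          apply mul_le_mul_of_nonneg_left _ (by linarith)
          have e1 : ∀ m ∈ Finset.range (g+2), er s C (2*g+2) (g+1) m ≤
              (2 * (g+2) * s ^ (4*g+4)) * s ^ (3 * m) + (2 * s ^ (6*g+6)) * 1 + (C * s ^ (5*g+5)) * s ^ (2 * m) := by
            intro m hm
            rw [Finset.mem_range] at hm
            have hm' : (m:ℝ) + 1 ≤ g + 2 := by exact_mod_cast (by omega)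
            have : 2 * ((m:ℝ) + 1) * s ^ (2*g+2 + 3 * m + 2 * (g+1)) ≤ 2 * (g+2) * s ^ (2*g+2 + 3 * m + 2 * (g+1)) := by gcongr
            unfold er
            refine (add_le_add (add_le_add this le_rfl) le_rfl).trans (le_of_eq ?_)
            ring
          refine (Finset.sum_le_sum e1).trans ?_
          simp_rw [Finset.sum_add_distrib, ← Finset.mul_sum]
          have g2 := geo' hs 2 (g+1) (by norm_num)
          have g3 := geo' hs 3 (g+1) (by norm_num)
          have p1 : (2 * (g+2) * s ^ (4*g+4)) * (∑ k ∈ Finset.range (g+2), s ^ (3 * k)) ≤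
              (2 * (g+2) * s ^ (4*g+4)) * (4 * s ^ (3 * (g+1))) := by gcongr
          have p2 : (2 * s ^ (6*g+6)) * (∑ k ∈ Finset.range (g+2), (1:ℝ)) = (2 * s ^ (6*g+6)) * (g+2) := by
            rw [Finset.sum_const, Finset.card_range, nsmul_eq_mul, mul_one]
            push_cast
            rfl
          have p3 : (C * s ^ (5*g+5)) * (∑ k ∈ Finset.range (g+2), s ^ (2 * k)) ≤
              (C * s ^ (5*g+5)) * (4 * s ^ (2 * (g+1))) := by gcongr
          refine (add_le_add (add_le_add p1 p2.le) p3).trans ?_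
          have q2 : s ^ (6*g+6) ≤ s ^ (7*g+7) := pow_le_pow_right₀ hs1 (by omega)
          have t1 : (2 * ((g:ℝ)+2) * s ^ (4*g+4)) * (4 * s ^ (3 * (g+1))) = 8 * (g+2) * s ^ (7*g+7) := by ring
          have t3 : (C * s ^ (5*g+5)) * (4 * s ^ (2 * (g+1))) = 4 * C * 1 * s ^ (7*g+7) := by ring
          rw [t1, t3]
          have u2 : 2 * s ^ (6*g+6) * ((g:ℝ)+2) ≤ 2 * s ^ (7*g+7) * (g+2) := by gcongr
          have u3 : 4 * C * 1 * s ^ (7*g+7) ≤ 4 * C * ((g:ℝ)+2) * s ^ (7*g+7) := by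
            gcongr
            linarith [Nat.cast_nonneg (α := ℝ) g]
          linarith
  rw [Finset.sum_sub_distrib, hmain, ← hI2] at herr
  have hfin : (q ^ (g+1) * (q + 1)) * |H - 2 * (q / (q + 1)) * P * q ^ (3*g+2)| ≤ (q ^ (g+1) * (q+1)) * ((10 + 4 * C + |P|) * (g+2) * s ^ (5*g+5)) := by
    rw [← abs_of_nonneg (show 0 ≤ q ^ (g+1) * (q+1) by positivity), ← abs_mul, abs_of_nonneg (show 0 ≤ q ^ (g+1) * (q+1) by positivity)]
    have e1 : q ^ (g+1) * (q+1) * (H - 2 * (q / (q + 1)) * P * q ^ (3*g+2)) =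
        (q ^ (g+1) * ((q+1) * H) - (2 * P * q ^ (4*g+4) - (q+1) * P * q ^ (3*g+2))) + -((q+1) * P * q ^ (3*g+2)) := by
      field_simp
      ring
    have e2 : |-((q+1) * P * q ^ (3*g+2))| ≤ (q+1) * (|P| * s ^ (7*g+7)) := by
      rw [abs_neg, abs_mul, abs_mul, abs_of_nonneg (show 0 ≤ q + 1 by linarith), abs_of_nonneg (show 0 ≤ q ^ (3*g+2) by positivity), mul_assoc]
      have : q ^ (3*g+2) ≤ s ^ (7*g+7) := by
        rw [← hsq, ← pow_mul]
        exact pow_le_pow_right₀ hs1 (by omega)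
      gcongr
    rw [e1]
    refine (abs_add_le _ _).trans ((add_le_add herr e2).trans ?_)
    have e3 : |P| * 1 * s ^ (7*g+7) ≤ |P| * ((g:ℝ) + 2) * s ^ (7*g+7) := by
      gcongr
      linarith [Nat.cast_nonneg (α := ℝ) g]
    have e4 : (q ^ (g+1) * (q+1)) * ((10 + 4 * C + |P|) * (g+2) * s ^ (5*g+5)) = (q+1) * ((10 + 4 * C + |P|) * (g+2) * s ^ (7*g+7)) := by
      have : q ^ (g+1) * s ^ (5*g+5) = s ^ (7*g+7) := by rw [← hsq]; ring
      rw [← this]; ring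
    rw [e4, ← mul_add]
    apply mul_le_mul_of_nonneg_left _ (by linarith)
    linarith
  have hfin2 := le_of_mul_le_mul_left hfin (by positivity)
  refine hfin2.trans ?_
  have hg' : (g:ℝ) + 2 ≤ 3 * g := by
    have : (1:ℝ) ≤ g := by exact_mod_cast hg
    linarith
  calc _ ≤ (10 + 4 * C + |P|) * (3 * g) * s ^ (5*g+5) := by gcongr
    _ = _ := by ring

lemma zeta_quot : (zetaR (Fintype.card Fq) 2)⁻¹ * zetaR (Fintype.card Fq) 3 = (Fintype.card Fq : ℝ) / ((Fintype.card Fq : ℝ) + 1) := by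
  have hq := q_pos (Fq := Fq)
  have hq2 := q_ge2 (Fq := Fq)
  unfold zetaR
  have e1 : (1:ℝ) - 2 = ((-1 : ℤ) : ℝ) := by norm_num
  have e2 : (1:ℝ) - 3 = ((-2 : ℤ) : ℝ) := by norm_num
  rw [e1, e2, Real.rpow_intCast, Real.rpow_intCast, inv_inv, zpow_neg_one]
  have e3 : (Fintype.card Fq : ℝ) ^ (-2 : ℤ) = ((Fintype.card Fq : ℝ)^2)⁻¹ := by
    rw [zpow_neg]; norm_cast
  rw [e3]
  have h1 : (Fintype.card Fq : ℝ) - 1 ≠ 0 := by linarith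
  have h2 : (Fintype.card Fq : ℝ)^2 - 1 ≠ 0 := by nlinarith
  have h3 : (1 - ((Fintype.card Fq : ℝ)^2)⁻¹) = ((Fintype.card Fq : ℝ)^2 - 1) / (Fintype.card Fq : ℝ)^2 := by field_simp
  rw [h3, inv_div]
  field_simp
  ring

end Helpers9
end EvenChar

namespace EvenChar

theorem statement7 {Fq : Type} [Field Fq] [Fintype Fq] (hchar : ringChar Fq = 2)
    (ξ : Fq) (hξ : ∀ x : Fq, x ^ 2 + x ≠ ξ) :
    ∃ C : ℝ, 0 < C ∧ ∀ g : ℕ, 1 ≤ g →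
      |(∑' u : (Ifam ξ (g + 1) : Set (RatFunc Fq)), (hClass u.1 : ℝ)) -
          2 * eulerPR Fq 2 * (Fintype.card Fq : ℝ) ^ (3 * g + 1)| ≤
        C * g * (Fintype.card Fq : ℝ) ^ (5 * (g : ℝ) / 2) ∧
      |(∑' u : (F'fam ξ (g + 1) : Set (RatFunc Fq)), (hClass u.1 : ℝ)) -
          2 * (zetaR (Fintype.card Fq) 2)⁻¹ * zetaR (Fintype.card Fq) 3 * eulerPR Fq 2 *
            (Fintype.card Fq : ℝ) ^ (3 * g + 2)| ≤
        C * g * (Fintype.card Fq : ℝ) ^ (5 * (g : ℝ) / 2) := by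
  haveI : CharP Fq 2 := ringChar.of_eq hchar
  have hq := q_pos (Fq := Fq)
  have hq2 := q_ge2 (Fq := Fq)
  have hsq : Real.sqrt (Fintype.card Fq : ℝ) ^ 2 = (Fintype.card Fq : ℝ) := Real.sq_sqrt hq.le
  have hs : 4 / 3 ≤ Real.sqrt (Fintype.card Fq : ℝ) := by
    apply Real.le_sqrt_of_sq_le
    linarith
  have hpow : ∀ g : ℕ, (Fintype.card Fq : ℝ) ^ (5 * (g : ℝ) / 2) = Real.sqrt (Fintype.card Fq : ℝ) ^ (5 * g) := by
    intro g
    rw [Real.sqrt_eq_rpow, ← Real.rpow_natCast, ← Real.rpow_mul hq.le]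
    congr 1
    push_cast
    ring
  obtain ⟨C1, h1, H1⟩ := final_R hs hsq ξ hξ
  obtain ⟨C2, h2, H2⟩ := final_I hs hsq ξ hξ
  refine ⟨C1 + C2 + 1, by linarith, fun g hg => ?_⟩
  rw [hpow]
  refine ⟨(H1 g hg).trans ?_, ?_⟩
  · gcongr
    linarith
  · have e := zeta_quot (Fq := Fq)
    rw [mul_assoc 2 _ (zetaR _ 3), e]
    refine (H2 g hg).trans ?_
    gcongr
    linarith

end EvenChar
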